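/- Let ω = (√5 − 1)/2, κ = 1.3 and ε = 1.2342. Then there exists a real-analytic, 1-periodic map K : ℝ → ℝ² satisfying F(K(θ − ω), θ − ω) = K(θ) for all θ ∈ ℝ, and there exist a real-analytic, 1-periodic map P : ℝ → Matrix(2, 2, ℝ) with P(θ) invertible for every θ, and real numbers λ_s, λ_u with |λ_s| ≤ 0.6725 and |λ_u| ≥ 1.487 (in particular |λ_s| < 1 < |λ_u|), such that D_{(x,y)}F(K(θ − ω), θ − ω)·P(θ − ω) = P(θ)·diag(λ_s, λ_u) for all θ ∈ ℝ. That is, even at this parameter value close to the critical breakdown value ε_c ≈ 1.2352755, the perturbed standard map has a real-analytic fiberwise hyperbolic invariant torus with constant diagonal reduced linearized dynamics. -/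

import Mathlib

/-- The perturbed standard map `F : ℝ² × ℝ → ℝ²`. -/
noncomputable def stdF (κ ε : ℝ) (x y θ : ℝ) : ℝ × ℝ :=
  (x + y - κ / (2 * Real.pi) * Real.sin (2 * Real.pi * x) - ε * Real.sin (2 * Real.pi * θ),
   y - κ / (2 * Real.pi) * Real.sin (2 * Real.pi * x) - ε * Real.sin (2 * Real.pi * θ))

/-- Jacobian of `F` with respect to `(x, y)` at `(x, y, θ)`. -/
noncomputable def stdDF (κ : ℝ) (x : ℝ) : Matrix (Fin 2) (Fin 2) ℝ :=
  !![1 - κ * Real.cos (2 * Real.pi * x), 1;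
     -(κ * Real.cos (2 * Real.pi * x)), 1]

/-- Continuous real functions on the circle `ℝ / ℤ`. -/
abbrev CircleFun := C(UnitAddCircle, ℝ)

namespace CircleFun

open scoped ContDiff Topology
open Filter MeasureTheory

/-- Translation of a function on the circle. -/
noncomputable def trans (s : UnitAddCircle) : CircleFun →L[ℝ] CircleFun :=
  ⟨(ContinuousMap.compRightAlgHom ℝ ℝ
    (⟨fun x => x + s, by fun_prop⟩ : C(UnitAddCircle, UnitAddCircle))).toLinearMap,
    ContinuousMap.continuous_precomp _⟩

@[simp] theorem trans_apply (s : UnitAddCircle) (f : CircleFun) (x : UnitAddCircle) :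
    trans s f x = f (x + s) := rfl

theorem trans_zero (f : CircleFun) : trans 0 f = f := by ext x; simp

theorem continuous_trans (f : CircleFun) :
    Continuous fun s : ℝ => trans (s : UnitAddCircle) f := by
  refine ContinuousMap.continuous_of_continuous_uncurry _ ?_
  change Continuous fun p : ℝ × UnitAddCircle => f (p.2 + ((p.1 : ℝ) : UnitAddCircle))
  have : Continuous fun p : ℝ × UnitAddCircle => ((p.1 : ℝ) : UnitAddCircle) :=
    (AddCircle.continuous_mk' 1).comp continuous_fst
  fun_prop

/-- The translates of `f` depend analytically on the translation. -/
def TransAnalytic (f : CircleFun) : Prop :=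
  ContDiffAt ℝ ω (fun s : ℝ => trans (s : UnitAddCircle) f) 0

theorem transAnalytic_of_implicit {Φ : ℝ × CircleFun → CircleFun} {f : CircleFun}
    (hΦ : ContDiffAt ℝ ω Φ (0, f))
    (hz : ∀ s : ℝ, Φ (s, trans (s : UnitAddCircle) f) = 0) {A : CircleFun →L[ℝ] CircleFun}
    (hA : IsUnit A) (hd : HasFDerivAt (fun h => Φ (0, h)) A f) : TransAnalytic f := by
  have hinv : (fderiv ℝ Φ (0, f) ∘L .inr ℝ ℝ CircleFun).IsInvertible := by
    have h1 : HasFDerivAt Φ (fderiv ℝ Φ (0, f)) (0, f) :=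
      (hΦ.differentiableAt (by simp)).hasFDerivAt
    have h2 : HasFDerivAt (fun h => Φ (0, h)) (fderiv ℝ Φ (0, f) ∘L .inr ℝ ℝ CircleFun) f :=
      h1.comp f (hasFDerivAt_prodMk_right 0 f)
    rw [h2.unique hd]
    obtain ⟨u, rfl⟩ := hA
    exact ⟨ContinuousLinearEquiv.ofUnit u, rfl⟩
  have hlim : Tendsto (fun s : ℝ => (s, trans (s : UnitAddCircle) f)) (𝓝 0) (𝓝 (0, f)) := by
    have : Continuous fun s : ℝ => (s, trans (s : UnitAddCircle) f) :=
      continuous_id.prodMk (continuous_trans f)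
    simpa [trans_zero] using this.tendsto 0
  have hev := hlim.eventually (hΦ.eventually_apply_eq_iff_implicitFunction (by simp) hinv)
  have h0 : Φ (0, f) = 0 := by simpa [trans_zero] using hz 0
  refine (hΦ.contDiffAt_implicitFunction (by simp) hinv).congr_of_eventuallyEq ?_
  filter_upwards [hev] with s hs
  exact (hs.mp (by rw [hz, h0])).symm

theorem exists_pos_le {g : CircleFun} (hg : ∀ x, 0 < g x) : ∃ c > 0, ∀ x, c ≤ g x := by
  obtain ⟨x₀, -, hx₀⟩ := isCompact_univ.exists_isMinOn Set.univ_nonempty g.continuous.continuousOn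
  exact ⟨g x₀, hg x₀, fun x => hx₀ (Set.mem_univ x)⟩

/-- Pointwise inverse of a positive function. -/
noncomputable def inv (g : CircleFun) (hg : ∀ x, 0 < g x) : CircleFun :=
  ⟨fun x => (g x)⁻¹, g.continuous.inv₀ fun x => (hg x).ne'⟩

@[simp] theorem inv_apply (g : CircleFun) (hg : ∀ x, 0 < g x) (x : UnitAddCircle) :
    inv g hg x = (g x)⁻¹ := rfl

theorem isUnit_mulLeft {g : CircleFun} (hg : ∀ x, 0 < g x) :
    IsUnit (ContinuousLinearMap.mul ℝ CircleFun g) := by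
  refine ⟨⟨ContinuousLinearMap.mul ℝ CircleFun g, ContinuousLinearMap.mul ℝ CircleFun (inv g hg),
    ?_, ?_⟩, rfl⟩ <;>
  · ext f x
    simp [ne_of_gt (hg x)]

/-- A positive operator with a strict positive supersolution has spectral radius below one. -/
theorem isUnit_one_sub_of_pos {B : CircleFun →L[ℝ] CircleFun}
    (hB : ∀ f : CircleFun, (∀ x, 0 ≤ f x) → ∀ x, 0 ≤ B f x)
    {w : CircleFun} (hw : ∀ x, 0 < w x) (hlt : ∀ x, B w x < w x) : IsUnit (1 - B) := by
  obtain ⟨c, hc, hcw⟩ := exists_pos_le (g := (w - B w) * inv w hw) fun x => by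
    have := hlt x
    have := hw x
    simp only [ContinuousMap.mul_apply, ContinuousMap.sub_apply, inv_apply]
    have : 0 < w x - B w x := by linarith
    positivity
  have hBw : ∀ x, B w x ≤ (1 - c) * w x := fun x => by
    have h := hcw x
    simp only [ContinuousMap.mul_apply, ContinuousMap.sub_apply, inv_apply] at h
    have := mul_le_mul_of_nonneg_right h (hw x).le
    rw [mul_assoc, inv_mul_cancel₀ (hw x).ne'] at this
    linarith
  have hc1 : 0 ≤ 1 - c := by
    have h0 : 0 ≤ B w 0 := hB w (fun x => (hw x).le) 0
    by_contra! h
    have := hBw 0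
    nlinarith [hw 0]
  set W := ContinuousLinearMap.mul ℝ CircleFun w with hW
  set V := ContinuousLinearMap.mul ℝ CircleFun (inv w hw) with hV
  have hWV : W * V = 1 := by ext f x; simp [W, V, (hw x).ne']
  have hnorm : ‖V * B * W‖ ≤ 1 - c := by
    refine ContinuousLinearMap.opNorm_le_bound _ hc1 fun g => ?_
    refine (ContinuousMap.norm_le _ (by positivity)).mpr fun x => ?_
    have hle : ∀ y, |g y| ≤ ‖g‖ := fun y => g.norm_coe_le_norm y
    have h1 := hB (‖g‖ • w - w * g) fun y => by
      have := (abs_le.mp (hle y)).2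
      have := hw y
      simp only [ContinuousMap.sub_apply, ContinuousMap.smul_apply,
        ContinuousMap.mul_apply, smul_eq_mul]
      nlinarith
    have h2 := hB (‖g‖ • w + w * g) fun y => by
      have := (abs_le.mp (hle y)).1
      have := hw y
      simp only [ContinuousMap.add_apply, ContinuousMap.smul_apply,
        ContinuousMap.mul_apply, smul_eq_mul]
      nlinarith
    have h1x := h1 x
    have h2x := h2 x
    simp only [map_sub, map_add, map_smul, ContinuousMap.sub_apply,
      ContinuousMap.add_apply, ContinuousMap.smul_apply, smul_eq_mul] at h1x h2x
    have hb : |B (w * g) x| ≤ (1 - c) * ‖g‖ * w x := by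
      have := mul_le_mul_of_nonneg_left (hBw x) (norm_nonneg g)
      rw [abs_le]
      constructor <;> linarith
    change ‖(inv w hw * B (w * g)) x‖ ≤ _
    rw [ContinuousMap.mul_apply, norm_mul, inv_apply, Real.norm_eq_abs, Real.norm_eq_abs,
      abs_of_pos (inv_pos.mpr (hw x)), inv_mul_le_iff₀ (hw x)]
    linarith
  have hnorm1 : ‖V * B * W‖ < 1 := by linarith
  have hu : IsUnit (1 - V * B * W) :=
    isUnit_one_sub_of_norm_lt_one (R := CircleFun →L[ℝ] CircleFun) hnorm1
  have hVW : V * W = 1 := by ext f x; simp [W, V, (hw x).ne']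
  have hdec : 1 - B = W * (1 - V * B * W) * V := by
    calc 1 - B = W * V - (W * V) * B * (W * V) := by rw [hWV]; simp
      _ = _ := by noncomm_ring
  rw [hdec]
  have hWu : IsUnit W := isUnit_mulLeft hw
  have hVu : IsUnit V := ⟨⟨V, W, hVW, hWV⟩, rfl⟩
  exact (hWu.mul hu).mul hVu

/-- Comparison principle for a positive operator with a strict supersolution. -/
theorem abs_le_of_supersolution {B : CircleFun →L[ℝ] CircleFun}
    (hB : ∀ f : CircleFun, (∀ x, 0 ≤ f x) → ∀ x, 0 ≤ B f x)
    {w : CircleFun} (hw : ∀ x, 0 < w x) (hlt : ∀ x, B w x < w x) {h : CircleFun} {F : ℝ}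
    (hh : ∀ x, |h x - B h x| ≤ F * (w x - B w x)) (x : UnitAddCircle) : |h x| ≤ F * w x := by
  have hF : 0 ≤ F := by
    by_contra! hF
    have := (abs_nonneg _).trans (hh 0)
    nlinarith [hlt 0]
  obtain ⟨x₀, -, hx₀⟩ := isCompact_univ.exists_isMaxOn Set.univ_nonempty
    (f := fun x => |h x| * (w x)⁻¹)
    (h.continuous.abs.mul (w.continuous.inv₀ fun x => (hw x).ne')).continuousOn
  set m := |h x₀| * (w x₀)⁻¹ with hm
  have hmle : ∀ y, |h y| ≤ m * w y := fun y => by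
    have : |h y| * (w y)⁻¹ ≤ m := hx₀ (Set.mem_univ y)
    rwa [← div_eq_mul_inv, div_le_iff₀ (hw y)] at this
  have hmeq : |h x₀| = m * w x₀ := by
    rw [hm, mul_assoc, inv_mul_cancel₀ (hw x₀).ne', mul_one]
  have hb : |B h x₀| ≤ m * B w x₀ := by
    have h1 := hB (m • w - h) fun y => by
      simpa using (abs_le.mp (hmle y)).2
    have h2 := hB (m • w + h) fun y => by
      have := (abs_le.mp (hmle y)).1
      simp only [ContinuousMap.add_apply, ContinuousMap.smul_apply,
        smul_eq_mul]
      linarith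
    have h1x := h1 x₀
    have h2x := h2 x₀
    simp only [map_sub, map_add, map_smul, ContinuousMap.sub_apply,
      ContinuousMap.add_apply, ContinuousMap.smul_apply, smul_eq_mul] at h1x h2x
    rw [abs_le]
    constructor <;> linarith
  have hmF : m ≤ F := by
    by_contra! hlt'
    have h1 : |h x₀| ≤ |h x₀ - B h x₀| + |B h x₀| := by
      simpa using abs_add_le (h x₀ - B h x₀) (B h x₀)
    have := hh x₀
    nlinarith [hlt x₀]
  exact (hmle x).trans (mul_le_mul_of_nonneg_right hmF (hw x).le)

/-- Superposition with the sine. -/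
noncomputable def sinC (f : CircleFun) : CircleFun := ⟨fun x => Real.sin (f x), by fun_prop⟩

/-- Superposition with the cosine. -/
noncomputable def cosC (f : CircleFun) : CircleFun := ⟨fun x => Real.cos (f x), by fun_prop⟩

/-- Superposition with the exponential. -/
noncomputable def expC (f : CircleFun) : CircleFun := ⟨fun x => Real.exp (f x), by fun_prop⟩

@[simp] theorem sinC_apply (f : CircleFun) (x : UnitAddCircle) : sinC f x = Real.sin (f x) := rfl
@[simp] theorem cosC_apply (f : CircleFun) (x : UnitAddCircle) : cosC f x = Real.cos (f x) := rfl
@[simp] theorem expC_apply (f : CircleFun) (x : UnitAddCircle) : expC f x = Real.exp (f x) := rfl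

theorem exp_apply_real (f : CircleFun) (x : UnitAddCircle) :
    NormedSpace.exp f x = Real.exp (f x) := by
  rw [Real.exp_eq_exp_ℝ]
  exact NormedSpace.map_exp_of_mem_ball (𝕂 := ℝ)
    (ContinuousMap.evalAlgHom ℝ ℝ x)
    (continuous_eval_const x) f
    ((NormedSpace.expSeries_radius_eq_top ℝ CircleFun).symm ▸ edist_lt_top _ _)

theorem exp_apply_complex (f : C(UnitAddCircle, ℂ)) (x : UnitAddCircle) :
    NormedSpace.exp f x = Complex.exp (f x) := by
  rw [Complex.exp_eq_exp_ℂ]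
  exact NormedSpace.map_exp_of_mem_ball (𝕂 := ℂ)
    (ContinuousMap.evalAlgHom ℂ ℂ x)
    (continuous_eval_const x) f
    ((NormedSpace.expSeries_radius_eq_top ℂ C(UnitAddCircle, ℂ)).symm ▸ edist_lt_top _ _)

theorem expC_eq : expC = NormedSpace.exp := by
  ext f x
  rw [exp_apply_real, expC_apply]

theorem contDiff_expC : ContDiff ℝ ω expC := by
  rw [expC_eq]
  exact contDiff_iff_contDiffAt.mpr fun f => (NormedSpace.exp_analytic (𝕂 := ℝ) f).contDiffAt

theorem hasFDerivAt_expC (f : CircleFun) :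
    HasFDerivAt expC (ContinuousLinearMap.mul ℝ CircleFun (expC f)) f := by
  rw [expC_eq]
  refine (hasFDerivAt_exp (𝕂 := ℝ) (x := f)).congr_fderiv ?_
  ext g x
  rfl

/-- Multiplication by the imaginary unit, from real to complex functions. -/
noncomputable def mulI : CircleFun →L[ℝ] C(UnitAddCircle, ℂ) :=
  ContinuousLinearMap.compLeftContinuous ℝ UnitAddCircle
    ((ContinuousLinearMap.mul ℝ ℂ Complex.I).comp Complex.ofRealCLM)

/-- Real part of a complex function. -/
noncomputable def reC : C(UnitAddCircle, ℂ) →L[ℝ] CircleFun :=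
  ContinuousLinearMap.compLeftContinuous ℝ UnitAddCircle Complex.reCLM

/-- Imaginary part of a complex function. -/
noncomputable def imC : C(UnitAddCircle, ℂ) →L[ℝ] CircleFun :=
  ContinuousLinearMap.compLeftContinuous ℝ UnitAddCircle Complex.imCLM

theorem mulI_apply (f : CircleFun) (x : UnitAddCircle) : mulI f x = Complex.I * (f x : ℂ) := rfl
theorem reC_apply (f : C(UnitAddCircle, ℂ)) (x : UnitAddCircle) : reC f x = (f x).re := rfl
theorem imC_apply (f : C(UnitAddCircle, ℂ)) (x : UnitAddCircle) : imC f x = (f x).im := rfl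

theorem sinC_eq : sinC = fun f => imC (NormedSpace.exp (mulI f)) := by
  ext f x
  rw [imC_apply, exp_apply_complex, mulI_apply, mul_comm, Complex.exp_ofReal_mul_I_im, sinC_apply]

theorem cosC_eq : cosC = fun f => reC (NormedSpace.exp (mulI f)) := by
  ext f x
  rw [reC_apply, exp_apply_complex, mulI_apply, mul_comm, Complex.exp_ofReal_mul_I_re, cosC_apply]

theorem contDiff_exp_mulI : ContDiff ℝ ω fun f => NormedSpace.exp (mulI f) :=
  (contDiff_iff_contDiffAt.mpr fun f : C(UnitAddCircle, ℂ) =>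
    (NormedSpace.exp_analytic (𝕂 := ℝ) f).contDiffAt).comp mulI.contDiff

theorem contDiff_sinC : ContDiff ℝ ω sinC := by
  rw [sinC_eq]
  exact imC.contDiff.comp contDiff_exp_mulI

theorem contDiff_cosC : ContDiff ℝ ω cosC := by
  rw [cosC_eq]
  exact reC.contDiff.comp contDiff_exp_mulI

theorem hasFDerivAt_sinC (f : CircleFun) :
    HasFDerivAt sinC (ContinuousLinearMap.mul ℝ CircleFun (cosC f)) f := by
  rw [sinC_eq]
  have h := imC.hasFDerivAt.comp f
    ((hasFDerivAt_exp (𝕂 := ℝ) (x := mulI f)).comp f mulI.hasFDerivAt)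
  refine h.congr_fderiv ?_
  ext g x
  symm
  change Real.cos (f x) * g x = (NormedSpace.exp (mulI f) x * mulI g x).im
  rw [exp_apply_complex, mulI_apply, mulI_apply, mul_comm Complex.I (f x : ℂ)]
  simp [Complex.exp_ofReal_mul_I_re, Complex.exp_ofReal_mul_I_im]

theorem trans_sinC (s : UnitAddCircle) (f : CircleFun) : trans s (sinC f) = sinC (trans s f) := rfl
theorem trans_expC (s : UnitAddCircle) (f : CircleFun) : trans s (expC f) = expC (trans s f) := rfl
theorem trans_trans (s t : UnitAddCircle) (f : CircleFun) :
    trans s (trans t f) = trans (s + t) f := by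
  ext x; simp [add_assoc]

theorem trans_comm (s t : UnitAddCircle) (f : CircleFun) :
    trans s (trans t f) = trans t (trans s f) := by
  rw [trans_trans, trans_trans, add_comm]

/-- The second-order difference operator `f ↦ E f - f(· + a) - f(· - a)`. -/
noncomputable def schr (a : UnitAddCircle) (E : CircleFun) : CircleFun →L[ℝ] CircleFun :=
  ContinuousLinearMap.mul ℝ CircleFun E - trans a - trans (-a)

theorem schr_apply (a : UnitAddCircle) (E f : CircleFun) (x : UnitAddCircle) :
    schr a E f x = E x * f x - f (x + a) - f (x - a) := by
  simp [schr, sub_eq_add_neg]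

theorem isUnit_schr {a : UnitAddCircle} {E w : CircleFun} {δ : ℝ} (hδ : 0 < δ)
    (hw : ∀ x, 0 < w x) (h : ∀ x, w (x + a) + w (x - a) + δ ≤ E x * w x) :
    IsUnit (schr a E) ∧ ∀ (f : CircleFun) (c : ℝ), (∀ x, |schr a E f x| ≤ c * δ) →
      ∀ x, |f x| ≤ c * w x := by
  have hE : ∀ x, 0 < E x := fun x => by
    have : 0 < E x * w x := by linarith [h x, hw (x + a), hw (x - a)]
    exact pos_of_mul_pos_left this (hw x).le
  set B : CircleFun →L[ℝ] CircleFun :=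
    ContinuousLinearMap.mul ℝ CircleFun (inv E hE) * (trans a + trans (-a)) with hBdef
  have hBa : ∀ (f : CircleFun) x, B f x = (E x)⁻¹ * (f (x + a) + f (x - a)) := fun f x => by
    simp [B, sub_eq_add_neg]
  have hB : ∀ f : CircleFun, (∀ x, 0 ≤ f x) → ∀ x, 0 ≤ B f x := fun f hf x => by
    rw [hBa]
    exact mul_nonneg (inv_nonneg.mpr (hE x).le) (add_nonneg (hf _) (hf _))
  have hdec : schr a E = ContinuousLinearMap.mul ℝ CircleFun E * (1 - B) := by
    ext f x
    change schr a E f x = E x * (f x - B f x)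
    rw [schr_apply, hBa, mul_sub, mul_inv_cancel_left₀ (hE x).ne']
    ring
  have hw' : ∀ x, δ ≤ E x * (w x - B w x) := fun x => by
    rw [hBa, mul_sub, mul_inv_cancel_left₀ (hE x).ne']
    linarith [h x]
  have hlt : ∀ x, B w x < w x := fun x => by
    have := pos_of_mul_pos_right (hδ.trans_le (hw' x)) (hE x).le
    linarith
  refine ⟨hdec ▸ (isUnit_mulLeft hE).mul (isUnit_one_sub_of_pos hB hw hlt), fun f c hf x => ?_⟩
  refine abs_le_of_supersolution hB hw hlt (fun y => ?_) x
  have h1 := hf y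
  have hc : 0 ≤ c := by
    by_contra! hc
    nlinarith [abs_nonneg (schr a E f y)]
  have h2 : schr a E f y = E y * (f y - B f y) := by rw [hdec]; rfl
  rw [h2, abs_mul, abs_of_pos (hE y)] at h1
  have h3 := mul_le_mul_of_nonneg_left (hw' y) hc
  have h4 : E y * |f y - B f y| ≤ E y * (c * (w y - B w y)) := by linarith
  exact le_of_mul_le_mul_left h4 (hE y)

/-- The invariance equation of the torus. -/
noncomputable def torusEq (a : UnitAddCircle) (κ : ℝ) (g f : CircleFun) : CircleFun :=
  (2 : ℝ) • f + κ • sinC f - trans a f - trans (-a) f - g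

/-- The potential of the linearised invariance equation. -/
noncomputable def torusPot (κ : ℝ) (f : CircleFun) : CircleFun :=
  ContinuousMap.const _ 2 + κ • cosC f

theorem torusEq_apply (a : UnitAddCircle) (κ : ℝ) (g f : CircleFun) (x : UnitAddCircle) :
    torusEq a κ g f x = 2 * f x + κ * Real.sin (f x) - f (x + a) - f (x - a) - g x := by
  simp [torusEq, sub_eq_add_neg]

@[simp] theorem torusPot_apply (κ : ℝ) (f : CircleFun) (x : UnitAddCircle) :
    torusPot κ f x = 2 + κ * Real.cos (f x) := by simp [torusPot]

theorem abs_sin_sub_sin_sub_le {v r x y : ℝ} (hx : |x - v| ≤ r) (hy : |y - v| ≤ r) :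
    |Real.sin x - Real.sin y - Real.cos v * (x - y)| ≤ r * |x - y| := by
  have h := (convex_closedBall v r).norm_image_sub_le_of_norm_hasDerivWithin_le
    (f := fun t => Real.sin t - Real.cos v * t) (f' := fun t => Real.cos t - Real.cos v) (C := r)
    (fun t _ => by
      have h1 := ((Real.hasDerivAt_sin t).sub
        ((hasDerivAt_id t).const_mul (Real.cos v))).hasDerivWithinAt (s := Metric.closedBall v r)
      rw [mul_one] at h1
      exact h1)
    (fun t ht => by
      rw [Metric.mem_closedBall, Real.dist_eq] at ht
      have := Real.abs_cos_sub_cos_le t v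
      rw [Real.norm_eq_abs]
      linarith)
    (x := y) (y := x) (by simpa [Real.dist_eq] using hy) (by simpa [Real.dist_eq] using hx)
  simp only [Real.norm_eq_abs] at h
  convert h using 2
  ring

/-- Newton–Kantorovich: an approximate solution of the invariance equation with a supersolution
of the linearised equation is close to a true solution. -/
theorem exists_torus {a : UnitAddCircle} {κ : ℝ} (hκ : 0 ≤ κ) {g f₀ w : CircleFun} {δ M r : ℝ}
    (hδ : 0 < δ) (hr : 0 ≤ r) (hw : ∀ x, 0 < w x) (hwM : ∀ x, w x ≤ M)
    (hsup : ∀ x, w (x + a) + w (x - a) + δ ≤ torusPot κ f₀ x * w x)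
    (hres : ∀ x, |torusEq a κ g f₀ x| ≤ (δ / M - κ * r) * r) :
    ∃ f, torusEq a κ g f = 0 ∧ ∀ x, |f x - f₀ x| ≤ r := by
  have hM : 0 < M := (hw 0).trans_le (hwM 0)
  obtain ⟨⟨u, hu⟩, hbd⟩ := isUnit_schr hδ hw hsup
  let rinv : (schr a (torusPot κ f₀)).NonlinearRightInverse :=
    { toFun := fun y => (↑u⁻¹ : CircleFun →L[ℝ] CircleFun) y
      nnnorm := ⟨M / δ, by positivity⟩
      bound' := fun y => by
        refine (ContinuousMap.norm_le _ (mul_nonneg (NNReal.coe_nonneg _) (norm_nonneg _))).mpr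
          fun x => ?_
        have hy : schr a (torusPot κ f₀) ((↑u⁻¹ : CircleFun →L[ℝ] CircleFun) y) = y := by
          rw [← hu]
          exact congrArg (fun T : CircleFun →L[ℝ] CircleFun => T y) u.mul_inv
        have := hbd _ (‖y‖ / δ) (fun z => by
          rw [hy, div_mul_cancel₀ _ hδ.ne']
          exact y.norm_coe_le_norm z) x
        refine this.trans ?_
        change ‖y‖ / δ * w x ≤ M / δ * ‖y‖
        calc ‖y‖ / δ * w x ≤ ‖y‖ / δ * M := by gcongr; exact hwM x
          _ = _ := by ring
      right_inv' := fun y => by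
        rw [← hu]
        exact congrArg (fun T : CircleFun →L[ℝ] CircleFun => T y) u.mul_inv }
  have happ : ApproximatesLinearOn (torusEq a κ g) (schr a (torusPot κ f₀))
      (Metric.closedBall f₀ r) ⟨κ * r, by positivity⟩ := by
    intro f hf h hh
    have hf' : ∀ x, |f x - f₀ x| ≤ r := fun x =>
      (ContinuousMap.norm_coe_le_norm (f - f₀) x).trans (by simpa [dist_eq_norm] using hf)
    have hh' : ∀ x, |h x - f₀ x| ≤ r := fun x =>
      (ContinuousMap.norm_coe_le_norm (h - f₀) x).trans (by simpa [dist_eq_norm] using hh)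
    refine (ContinuousMap.norm_le _ (mul_nonneg (NNReal.coe_nonneg _) (norm_nonneg _))).mpr
      fun x => ?_
    have h1 := abs_sin_sub_sin_sub_le (hf' x) (hh' x)
    have h2 : |f x - h x| ≤ ‖f - h‖ := ContinuousMap.norm_coe_le_norm (f - h) x
    have h3 : (torusEq a κ g f - torusEq a κ g h - schr a (torusPot κ f₀) (f - h)) x =
        κ * (Real.sin (f x) - Real.sin (h x) - Real.cos (f₀ x) * (f x - h x)) := by
      simp only [ContinuousMap.sub_apply, torusEq_apply, schr_apply, torusPot_apply]
      ring
    rw [h3, Real.norm_eq_abs, abs_mul, abs_of_nonneg hκ]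
    change _ ≤ κ * r * ‖f - h‖
    rw [mul_assoc]
    gcongr
    exact h1.trans (by gcongr)
  obtain ⟨f, hf, hf0⟩ := happ.surjOn_closedBall_of_nonlinearRightInverse rinv hr subset_rfl
    (a := 0) (by
      rw [mem_closedBall_iff_norm, zero_sub, norm_neg]
      refine (ContinuousMap.norm_le _ ?_).mpr fun x => ?_
      · exact ((abs_nonneg _).trans (hres 0)).trans_eq
          (by change _ = ((M / δ)⁻¹ - _) * _; rw [inv_div]; rfl)
      · exact (hres x).trans_eq (by change _ = ((M / δ)⁻¹ - _) * _; rw [inv_div]; rfl))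
  exact ⟨f, hf0, fun x => (ContinuousMap.norm_coe_le_norm (f - f₀) x).trans
    (by simpa [dist_eq_norm] using hf)⟩

theorem TransAnalytic.comp {f : CircleFun} (hf : TransAnalytic f) {N : CircleFun → CircleFun}
    (hN : ContDiffAt ℝ ω N f) (hc : ∀ s : UnitAddCircle, trans s (N f) = N (trans s f)) :
    TransAnalytic (N f) := by
  unfold TransAnalytic
  simp only [hc]
  refine ContDiffAt.comp (g := N) 0 ?_ hf
  simpa [trans_zero] using hN

theorem transAnalytic_torus {a : UnitAddCircle} {κ : ℝ} {g f : CircleFun} (hg : TransAnalytic g)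
    (hf : torusEq a κ g f = 0) (hA : IsUnit (schr a (torusPot κ f))) : TransAnalytic f := by
  let Φ : ℝ × CircleFun → CircleFun := fun p => (2 : ℝ) • p.2 + κ • sinC p.2 - trans a p.2
    - trans (-a) p.2 - trans (p.1 : UnitAddCircle) g
  refine transAnalytic_of_implicit (Φ := Φ) ?_ (fun s => ?_) hA ?_
  · have h1 : ContDiffAt ℝ ω (fun p : ℝ × CircleFun => trans (p.1 : UnitAddCircle) g) (0, f) :=
      ContDiffAt.comp (g := fun s : ℝ => trans (s : UnitAddCircle) g) (0, f) hg contDiffAt_fst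
    have h2 : ContDiffAt ℝ ω (fun p : ℝ × CircleFun => sinC p.2) (0, f) :=
      (contDiff_sinC.comp contDiff_snd).contDiffAt
    have h3 (b : UnitAddCircle) : ContDiffAt ℝ ω (fun p : ℝ × CircleFun => trans b p.2) (0, f) :=
      ((trans b).contDiff.comp contDiff_snd).contDiffAt
    exact (((((contDiffAt_snd.const_smul (2 : ℝ))).add (h2.const_smul κ)).sub (h3 a)).sub
      (h3 (-a))).sub h1
  · change (2 : ℝ) • trans s f + κ • sinC (trans s f) - trans a (trans s f)
      - trans (-a) (trans s f) - trans s g = 0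
    rw [trans_comm a, trans_comm (-a), ← trans_sinC, ← map_smul, ← map_smul, ← map_add,
      ← map_sub, ← map_sub, ← map_sub]
    change trans s (torusEq a κ g f) = 0
    rw [hf, map_zero]
  · have h := (((((hasFDerivAt_id f).const_smul (2 : ℝ)).add
      ((hasFDerivAt_sinC f).const_smul κ)).sub (trans a).hasFDerivAt).sub
      (trans (-a)).hasFDerivAt).sub_const (trans ((0 : ℝ) : UnitAddCircle) g)
    refine h.congr_fderiv ?_
    ext h x
    simp [schr]
    ring

/-- One step of the Riccati recursion, relative to a subsolution and in logarithmic scale. -/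
noncomputable def riccatiStep (d σ s : ℝ) : ℝ := Real.log (d + σ⁻¹ - (σ + Real.exp s)⁻¹)

theorem riccatiStep_arg_pos {d σ : ℝ} (hd : 0 < d) (hσ : 0 < σ) (s : ℝ) :
    0 < d + σ⁻¹ - (σ + Real.exp s)⁻¹ := by
  have : (σ + Real.exp s)⁻¹ ≤ σ⁻¹ := inv_anti₀ hσ (by linarith [Real.exp_pos s])
  linarith

theorem abs_riccatiStep_sub_le {d δ σ m : ℝ} (hδ : 0 < δ) (hd : δ ≤ d) (hm : 0 < m)
    (hσ : m ≤ σ) (s t : ℝ) :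
    |riccatiStep d σ s - riccatiStep d σ t| ≤ (1 + δ * m)⁻¹ * |s - t| := by
  have hσ0 : 0 < σ := hm.trans_le hσ
  have hd0 : 0 < d := hδ.trans_le hd
  refine (convex_univ (𝕜 := ℝ) (E := ℝ)).norm_image_sub_le_of_norm_hasDerivWithin_le
    (f := riccatiStep d σ)
    (f' := fun s => (Real.exp s / (σ + Real.exp s) ^ 2) / (d + σ⁻¹ - (σ + Real.exp s)⁻¹))
    (fun x _ => ?_) (fun x _ => ?_) (Set.mem_univ t) (Set.mem_univ s)
  · refine HasDerivAt.hasDerivWithinAt ?_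
    refine HasDerivAt.log ?_ (riccatiStep_arg_pos hd0 hσ0 x).ne'
    have h1 := (((Real.hasDerivAt_exp x).const_add σ).inv
      (by linarith [Real.exp_pos x] : σ + Real.exp x ≠ 0)).const_sub (d + σ⁻¹)
    refine h1.congr_deriv ?_
    ring
  · have ha := riccatiStep_arg_pos hd0 hσ0 x
    have he := Real.exp_pos x
    set y := Real.exp x
    rw [Real.norm_of_nonneg (by positivity), div_le_iff₀ ha, inv_mul_eq_div,
      le_div_iff₀ (by positivity)]
    have h2 : σ⁻¹ - (σ + y)⁻¹ = y / (σ * (σ + y)) := by field_simp; ring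
    have h3 : y / (σ + y) ^ 2 ≤ y / (σ * (σ + y)) := by
      apply div_le_div_of_nonneg_left he.le (by positivity)
      nlinarith
    have h4 : y / (σ + y) ^ 2 * m ≤ 1 := by
      rw [div_mul_eq_mul_div, div_le_one (by positivity)]
      nlinarith [mul_le_mul_of_nonneg_left hσ he.le]
    have h5 := mul_le_mul_of_nonneg_left h4 hδ.le
    nlinarith

/-- The Riccati equation with a strict positive subsolution has a positive analytic solution that
dominates all positive subsolutions. -/
theorem exists_riccati {a : UnitAddCircle} {E σ₀ : CircleFun} (hE : TransAnalytic E) {δ : ℝ}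
    (hδ : 0 < δ) (hσ₀ : ∀ x, 0 < σ₀ x) (hsub : ∀ x, σ₀ x + (σ₀ (x - a))⁻¹ + δ ≤ E x) :
    ∃ r : CircleFun, (∀ x, 0 < r x) ∧ (∀ x, r x = E x - (r (x - a))⁻¹) ∧ TransAnalytic r ∧
      ∀ σ : CircleFun, (∀ x, 0 < σ x) → (∀ x, σ x + (σ (x - a))⁻¹ ≤ E x) → ∀ x, σ x ≤ r x := by
  obtain ⟨m, hm, hmσ⟩ := exists_pos_le hσ₀
  have hd : ∀ x, δ ≤ E x - σ₀ x - (σ₀ (x - a))⁻¹ := fun x => by linarith [hsub x]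
  have hpos : ∀ (s : CircleFun) x, 0 < E x - σ₀ x - (σ₀ (x - a))⁻¹ + (σ₀ (x - a))⁻¹
      - (σ₀ (x - a) + Real.exp (s (x - a)))⁻¹ := fun s x =>
    riccatiStep_arg_pos (hδ.trans_le (hd x)) (hσ₀ _) _
  let N : CircleFun → CircleFun := fun s =>
    ⟨fun x => riccatiStep (E x - σ₀ x - (σ₀ (x - a))⁻¹) (σ₀ (x - a)) (s (x - a)), by
      refine Continuous.log ?_ fun x => (hpos s x).ne'
      have h1 : Continuous fun x => (σ₀ (x - a))⁻¹ :=
        Continuous.inv₀ (by fun_prop) fun x => (hσ₀ _).ne'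
      have h2 : Continuous fun x => (σ₀ (x - a) + Real.exp (s (x - a)))⁻¹ :=
        Continuous.inv₀ (by fun_prop) fun x => by
          linarith [hσ₀ (x - a), Real.exp_pos (s (x - a))]
      fun_prop⟩
  have hN : ContractingWith ⟨(1 + δ * m)⁻¹, by positivity⟩ N := by
    constructor
    · change (1 + δ * m)⁻¹ < 1
      exact inv_lt_one_of_one_lt₀ (by nlinarith [mul_pos hδ hm])
    · refine LipschitzWith.of_dist_le_mul fun s t => ?_
      rw [dist_eq_norm, dist_eq_norm]
      refine (ContinuousMap.norm_le _ (mul_nonneg (NNReal.coe_nonneg _) (norm_nonneg _))).mpr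
        fun x => ?_
      refine (abs_riccatiStep_sub_le hδ (hd x) hm (hmσ _) (s (x - a)) (t (x - a))).trans ?_
      exact mul_le_mul_of_nonneg_left (ContinuousMap.norm_coe_le_norm (s - t) (x - a))
        (by positivity)
  obtain ⟨s, hs, -⟩ := hN.exists_fixedPoint 0 (edist_ne_top _ _)
  have hs' : ∀ x, Real.exp (s x) = E x - σ₀ x - (σ₀ (x - a))⁻¹ + (σ₀ (x - a))⁻¹
      - (σ₀ (x - a) + Real.exp (s (x - a)))⁻¹ := fun x => by
    have h1 : N s x = s x := by rw [hs.eq]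
    rw [← h1]
    exact Real.exp_log (hpos s x)
  set r : CircleFun := σ₀ + expC s with hr
  have hrx : ∀ x, r x = σ₀ x + Real.exp (s x) := fun x => rfl
  have hrpos : ∀ x, 0 < r x := fun x => by
    rw [hrx]; linarith [hσ₀ x, Real.exp_pos (s x)]
  have hric : ∀ x, r x = E x - (r (x - a))⁻¹ := fun x => by
    rw [hrx, hs', hrx]; ring
  have hrσ : ∀ x, σ₀ x < r x := fun x => by rw [hrx]; linarith [Real.exp_pos (s x)]
  -- the gap `r - σ₀` is a strict supersolution of the linearisation
  have hgap : ∀ x, (r (x - a) - σ₀ (x - a)) * ((r (x - a))⁻¹ * (σ₀ (x - a))⁻¹) + δ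
      ≤ r x - σ₀ x := fun x => by
    have h1 : (r (x - a) - σ₀ (x - a)) * ((r (x - a))⁻¹ * (σ₀ (x - a))⁻¹)
        = (σ₀ (x - a))⁻¹ - (r (x - a))⁻¹ := by
      have := (hrpos (x - a)).ne'
      have := (hσ₀ (x - a)).ne'
      field_simp
    rw [h1, hric x]
    linarith [hsub x]
  refine ⟨r, hrpos, hric, ?_, fun σ hσ hσs x => ?_⟩
  · let Φ : ℝ × CircleFun → CircleFun := fun p =>
      p.2 * trans (-a) p.2 - trans (p.1 : UnitAddCircle) E * trans (-a) p.2 + 1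
    have hq : ∀ x, 0 < trans (-a) r x := fun x => hrpos _
    set q := inv (trans (-a) r) hq with hqdef
    let B : CircleFun →L[ℝ] CircleFun :=
      ContinuousLinearMap.mul ℝ CircleFun (q * q) * trans (-a)
    have hBa : ∀ (g : CircleFun) x,
        B g x = ((r (x - a))⁻¹ * (r (x - a))⁻¹) * g (x - a) := fun g x => by
      simp [B, q, sub_eq_add_neg]
    have hBu : IsUnit (1 - B) := by
      refine isUnit_one_sub_of_pos (w := r - σ₀) (fun g hg x => ?_) (fun x => ?_) fun x => ?_
      · rw [hBa]
        have := hg (x - a)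
        have := hrpos (x - a)
        positivity
      · simpa using hrσ x
      · rw [hBa]
        refine lt_of_lt_of_le ?_ (hgap x)
        have h1 : (r (x - a))⁻¹ ≤ (σ₀ (x - a))⁻¹ := inv_anti₀ (hσ₀ _) (hrσ _).le
        have h2 : (r (x - a))⁻¹ * (r (x - a))⁻¹ ≤ (r (x - a))⁻¹ * (σ₀ (x - a))⁻¹ :=
          mul_le_mul_of_nonneg_left h1 (inv_nonneg.mpr (hrpos _).le)
        have h3 := mul_le_mul_of_nonneg_left h2 (sub_nonneg.mpr (hrσ (x - a)).le)
        rw [ContinuousMap.sub_apply]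
        linarith
    refine transAnalytic_of_implicit (Φ := Φ) ?_ (fun s => ?_)
      ((isUnit_mulLeft hq).mul hBu) ?_
    · have h1 : ContDiffAt ℝ ω (fun p : ℝ × CircleFun => trans (p.1 : UnitAddCircle) E) (0, r) :=
        ContDiffAt.comp (g := fun s : ℝ => trans (s : UnitAddCircle) E) (0, r) hE contDiffAt_fst
      have h3 : ContDiffAt ℝ ω (fun p : ℝ × CircleFun => trans (-a) p.2) (0, r) :=
        ((trans (-a)).contDiff.comp contDiff_snd).contDiffAt
      exact ((contDiffAt_snd.mul h3).sub (h1.mul h3)).add contDiffAt_const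
    · ext x
      change r (x + s) * r (x + -a + s) - E (x + s) * r (x + -a + s) + 1 = 0
      have h1 := hric (x + s)
      have h2 : x + s - a = x + -a + (s : UnitAddCircle) := by abel
      rw [h2] at h1
      have h3 := (hrpos (x + -a + s)).ne'
      rw [h1]
      field_simp
      ring
    · have h1 : HasFDerivAt (fun h : CircleFun => trans (-a) h) (trans (-a)) r :=
        (trans (-a)).hasFDerivAt
      have h2 := (((hasFDerivAt_id r).mul h1).sub
        (h1.const_mul (trans ((0 : ℝ) : UnitAddCircle) E))).add_const (1 : CircleFun)
      refine h2.congr_fderiv ?_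
      ext g x
      have h3 := hric x
      have h4 := (hrpos (x - a)).ne'
      rw [sub_eq_add_neg x a] at h3 h4
      simp [B, q, h3]
      field_simp
      ring
  · by_contra! hlt
    obtain ⟨x₀, -, hx₀⟩ := isCompact_univ.exists_isMaxOn Set.univ_nonempty
      (f := fun x => (σ x - r x) / (r x - σ₀ x))
      (Continuous.div (by fun_prop) (by fun_prop)
        fun x => (sub_pos.mpr (hrσ x)).ne').continuousOn
    set M := (σ x₀ - r x₀) / (r x₀ - σ₀ x₀) with hM
    have hMle : ∀ y, σ y - r y ≤ M * (r y - σ₀ y) := fun y => by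
      have : (σ y - r y) / (r y - σ₀ y) ≤ M := hx₀ (Set.mem_univ y)
      rwa [div_le_iff₀ (sub_pos.mpr (hrσ y))] at this
    have hMpos : 0 < M := by
      have h1 := hMle x
      have h2 := sub_pos.mpr (hrσ x)
      by_contra! h
      nlinarith
    have hMeq : σ x₀ - r x₀ = M * (r x₀ - σ₀ x₀) := by
      rw [hM, div_mul_cancel₀ _ (sub_pos.mpr (hrσ x₀)).ne']
    set y := x₀ - a with hy
    have h1 : σ x₀ - r x₀ ≤ (r y)⁻¹ - (σ y)⁻¹ := by linarith [hσs x₀, hric x₀]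
    have h2 : 0 < σ x₀ - r x₀ := by rw [hMeq]; exact mul_pos hMpos (sub_pos.mpr (hrσ x₀))
    have h3 : r y < σ y := by
      by_contra! h
      have := inv_anti₀ (hσ y) h
      linarith
    have h4 : (r y)⁻¹ - (σ y)⁻¹ = (σ y - r y) * ((r y)⁻¹ * (σ y)⁻¹) := by
      have := (hrpos y).ne'
      have := (hσ y).ne'
      field_simp
    have h5 : (r y)⁻¹ * (σ y)⁻¹ ≤ (r y)⁻¹ * (σ₀ y)⁻¹ :=
      mul_le_mul_of_nonneg_left (inv_anti₀ (hσ₀ y) ((hrσ y).trans h3).le)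
        (inv_nonneg.mpr (hrpos y).le)
    have h6 : 0 < (r y)⁻¹ * (σ₀ y)⁻¹ := mul_pos (inv_pos.mpr (hrpos y)) (inv_pos.mpr (hσ₀ y))
    have h7 := mul_le_mul_of_nonneg_left h5 (sub_pos.mpr h3).le
    have h8 := mul_le_mul_of_nonneg_right (hMle y) h6.le
    have h9 := mul_le_mul_of_nonneg_left (hgap x₀) hMpos.le
    rw [← hy] at h9
    nlinarith [mul_pos hMpos hδ]

theorem transAnalytic_of_expC {f : CircleFun} (hf : TransAnalytic (expC f)) : TransAnalytic f := by
  refine transAnalytic_of_implicit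
    (Φ := fun p => expC p.2 - trans (p.1 : UnitAddCircle) (expC f)) ?_ (fun s => ?_)
    (isUnit_mulLeft (g := expC f) fun x => Real.exp_pos _) ?_
  · exact (contDiff_expC.comp contDiff_snd).contDiffAt.sub
      (ContDiffAt.comp (g := fun s : ℝ => trans (s : UnitAddCircle) (expC f)) (0, f) hf
        contDiffAt_fst)
  · simp [trans_expC]
  · exact (hasFDerivAt_expC f).sub_const (trans ((0 : ℝ) : UnitAddCircle) (expC f))

theorem hasSum_of_eq {ι E : Type*} [AddCommMonoid E] [TopologicalSpace E] {f g : ι → E} {a : E}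
    (h : HasSum f a) (hfg : f = g) : HasSum g a := hfg ▸ h

/-- A real function on the circle as a complex function. -/
noncomputable def toComplex (f : CircleFun) : C(UnitAddCircle, ℂ) :=
  ⟨fun x => (f x : ℂ), by fun_prop⟩

@[simp] theorem toComplex_apply (f : CircleFun) (x : UnitAddCircle) :
    toComplex f x = (f x : ℂ) := rfl

theorem integrable_toComplex (f : CircleFun) :
    Integrable (toComplex f) AddCircle.haarAddCircle :=
  (toComplex f).continuous.integrable_of_hasCompactSupport (HasCompactSupport.of_compactSpace _)

/-- The Fourier coefficient as a continuous functional. -/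
noncomputable def coeffCLM (k : ℤ) : CircleFun →L[ℝ] ℂ :=
  LinearMap.mkContinuous
    { toFun := fun f => fourierCoeff (toComplex f) k
      map_add' := fun f g => by
        rw [← Pi.add_apply, ← fourierCoeff.add (integrable_toComplex f) (integrable_toComplex g)]
        congr 1
        ext x
        simp
      map_smul' := fun c f => by
        have := fourierCoeff.const_smul (toComplex f) (c : ℂ) k
        rw [RingHom.id_apply, Complex.real_smul, ← smul_eq_mul, ← this]
        congr 1
        ext x
        simp } 1 fun f => by
    change ‖∫ t, fourier (-k) t • toComplex f t ∂AddCircle.haarAddCircle‖ ≤ 1 * ‖f‖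
    refine (norm_integral_le_of_norm_le_const (C := ‖f‖) (ae_of_all _ fun x => ?_)).trans ?_
    · rw [norm_smul, fourier_apply, Circle.norm_coe, one_mul, toComplex_apply, Complex.norm_real]
      exact f.norm_coe_le_norm x
    · simp

theorem coeffCLM_apply (k : ℤ) (f : CircleFun) : coeffCLM k f = fourierCoeff (toComplex f) k := rfl

theorem norm_coeffCLM_le (k : ℤ) (f : CircleFun) : ‖coeffCLM k f‖ ≤ ‖f‖ :=
  (ContinuousLinearMap.le_of_opNorm_le _ (LinearMap.mkContinuous_norm_le _ zero_le_one _)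
    f).trans_eq (one_mul _)

theorem coeffCLM_zero (f : CircleFun) :
    coeffCLM 0 f = ((∫ x, f x ∂AddCircle.haarAddCircle : ℝ) : ℂ) := by
  rw [coeffCLM_apply, fourierCoeff, ← integral_complex_ofReal]
  simp

theorem coeffCLM_trans (k : ℤ) (s : ℝ) (f : CircleFun) :
    coeffCLM k (trans (s : UnitAddCircle) f)
      = Complex.exp (2 * Real.pi * Complex.I * k * s) * coeffCLM k f := by
  simp only [coeffCLM_apply, fourierCoeff]
  rw [← integral_const_mul, ← integral_add_right_eq_self
    (fun t => Complex.exp (2 * Real.pi * Complex.I * k * s) * (fourier (-k) t • toComplex f t))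
    (s : UnitAddCircle)]
  refine integral_congr_ae (ae_of_all _ fun t => ?_)
  have h1 : (fourier (-k) (t + (s : UnitAddCircle)) : ℂ)
      = fourier (-k) t * fourier (-k) (s : UnitAddCircle) := by
    simp only [fourier_apply, smul_add, AddCircle.toCircle_add, Circle.coe_mul]
  have h2 : (fourier (-k) (s : UnitAddCircle) : ℂ)
      = (Complex.exp (2 * Real.pi * Complex.I * k * s))⁻¹ := by
    rw [fourier_coe_apply, ← Complex.exp_neg]
    congr 1
    push_cast
    ring
  simp only [toComplex_apply, trans_apply, smul_eq_mul]
  rw [h1, h2]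
  field_simp

/-- Fourier coefficients of an analytic function decay exponentially. -/
theorem TransAnalytic.exists_norm_coeff_le {f : CircleFun} (hf : TransAnalytic f) :
    ∃ C η : ℝ, 0 < C ∧ 0 < η ∧ ∀ k : ℤ, ‖coeffCLM k f‖ ≤ C * Real.exp (-(η * |(k : ℝ)|)) := by
  have hfa : AnalyticAt ℝ (fun s : ℝ => trans (s : UnitAddCircle) f) 0 := by
    rw [← analyticWithinAt_univ, ← contDiffWithinAt_omega_iff_analyticWithinAt,
      contDiffWithinAt_univ]
    exact hf
  obtain ⟨p, hp⟩ := hfa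
  obtain ⟨ρ, hρ0, hρ⟩ : ∃ ρ : NNReal, 0 < ρ ∧ (ρ : ENNReal) < p.radius := by
    obtain ⟨r, hr0, hr⟩ := ENNReal.lt_iff_exists_nnreal_btwn.mp hp.radius_pos
    exact ⟨r, by simpa using hr0, hr⟩
  obtain ⟨C, hC, hCn⟩ := p.norm_mul_pow_le_of_lt_radius hρ
  have hcoef : ∀ (k : ℤ) (n : ℕ), coeffCLM k (p.coeff n)
      = (2 * Real.pi * Complex.I * k) ^ n / (n.factorial : ℂ) * coeffCLM k f := by
    intro k n
    let q₁ : FormalMultilinearSeries ℝ ℝ ℂ := fun n =>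
      ContinuousMultilinearMap.mkPiRing ℝ (Fin n) (coeffCLM k (p.coeff n))
    let q₂ : FormalMultilinearSeries ℝ ℝ ℂ := fun n =>
      ContinuousMultilinearMap.mkPiRing ℝ (Fin n)
        ((2 * Real.pi * Complex.I * k) ^ n / (n.factorial : ℂ) * coeffCLM k f)
    have c₁ : ∀ n, q₁.coeff n = coeffCLM k (p.coeff n) := fun n => by
      rw [FormalMultilinearSeries.coeff, ContinuousMultilinearMap.mkPiRing_apply]
      simp
    have c₂ : ∀ n, q₂.coeff n
        = (2 * Real.pi * Complex.I * k) ^ n / (n.factorial : ℂ) * coeffCLM k f := fun n => by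
      rw [FormalMultilinearSeries.coeff, ContinuousMultilinearMap.mkPiRing_apply]
      simp
    let g : ℝ → ℂ := fun s => coeffCLM k (trans (s : UnitAddCircle) f)
    have h₁ : HasFPowerSeriesAt g q₁ 0 := by
      rw [hasFPowerSeriesAt_iff]
      filter_upwards [hasFPowerSeriesAt_iff.mp hp] with s hs
      simpa only [c₁, map_smul] using (coeffCLM k).hasSum hs
    have h₂ : HasFPowerSeriesAt g q₂ 0 := by
      rw [hasFPowerSeriesAt_iff]
      refine Eventually.of_forall fun s => ?_
      have h := (NormedSpace.expSeries_div_hasSum_exp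
        (2 * Real.pi * Complex.I * k * s)).mul_right (coeffCLM k f)
      rw [← Complex.exp_eq_exp_ℂ, ← coeffCLM_trans] at h
      simp only [zero_add, g, c₂]
      refine hasSum_of_eq h (funext fun n => ?_)
      rw [Complex.real_smul]
      push_cast
      ring
    rw [← c₁, ← c₂, h₁.eq_formalMultilinearSeries h₂]
  refine ⟨2 * C, Real.pi * ρ, by positivity, by positivity, fun k => ?_⟩
  have hle : ∀ n : ℕ, ‖coeffCLM k f‖ * ((Real.pi * ρ * |(k : ℝ)|) ^ n / n.factorial)
      ≤ C * (1 / 2) ^ n := fun n => by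
    have h1 := norm_coeffCLM_le k (p.coeff n)
    rw [hcoef, norm_mul, norm_div, norm_pow, Complex.norm_natCast,
      ← p.norm_apply_eq_norm_coef] at h1
    have h2 : ‖2 * Real.pi * Complex.I * (k : ℂ)‖ = 2 * Real.pi * |(k : ℝ)| := by
      simp [abs_of_pos Real.pi_pos]
    rw [h2] at h1
    have h3 := mul_le_mul_of_nonneg_right h1 (by positivity : 0 ≤ (ρ : ℝ) ^ n * (1 / 2) ^ n)
    calc _ = (2 * Real.pi * |(k : ℝ)|) ^ n / n.factorial * ‖coeffCLM k f‖
          * (ρ ^ n * (1 / 2) ^ n) := by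
          rw [show (2 * Real.pi * |(k : ℝ)|) = Real.pi * |(k : ℝ)| * 2 by ring, mul_pow, mul_pow,
            mul_pow, mul_pow, one_div, inv_pow]
          field_simp
      _ ≤ _ := h3
      _ = ‖p n‖ * ρ ^ n * (1 / 2) ^ n := by ring
      _ ≤ _ := by gcongr; exact hCn n
  have hs₁ := (NormedSpace.expSeries_div_hasSum_exp (Real.pi * ρ * |(k : ℝ)|)).mul_left
    ‖coeffCLM k f‖
  rw [← Real.exp_eq_exp_ℝ] at hs₁
  have hs₂ := hasSum_geometric_two.mul_left C
  have := hasSum_le hle hs₁ hs₂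
  rw [Real.exp_neg, ← div_eq_mul_inv, le_div_iff₀ (Real.exp_pos _)]
  linarith

/-- The cohomological equation over a Diophantine rotation. -/
theorem TransAnalytic.exists_cohomological {a : ℝ} {c : ℝ} (hc : 0 < c)
    (ha : ∀ k : ℤ, k ≠ 0 → c / |(k : ℝ)| ≤ ‖Complex.exp (2 * Real.pi * Complex.I * k * a) - 1‖)
    {f : CircleFun} (hf : TransAnalytic f) :
    ∃ b : ℝ → ℝ, (∀ θ, AnalyticAt ℝ b θ) ∧ Function.Periodic b 1 ∧
      ∀ θ : ℝ, b (θ + a) - b θ = f (θ : UnitAddCircle) - ∫ x, f x ∂AddCircle.haarAddCircle := by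
  obtain ⟨C, η, hC, hη, hdec⟩ := hf.exists_norm_coeff_le
  let e : ℤ → ℂ := fun k => Complex.exp (2 * Real.pi * Complex.I * k * a) - 1
  let β : ℤ → ℂ := fun k => coeffCLM k f / e k
  have hβ : ∀ k, ‖β k‖ ≤ 2 * C / (c * η) * Real.exp (-(η / 2 * |(k : ℝ)|)) := fun k => by
    rcases eq_or_ne k 0 with rfl | hk
    · simp only [β, e]
      simp
      positivity
    · have hk0 : 0 < |(k : ℝ)| := abs_pos.mpr (by exact_mod_cast hk)
      have h1 : 0 < c / |(k : ℝ)| := by positivity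
      have h2 := ha k hk
      rw [norm_div]
      have h3 : η / 2 * |(k : ℝ)| ≤ Real.exp (η / 2 * |(k : ℝ)|) := by
        linarith [Real.add_one_le_exp (η / 2 * |(k : ℝ)|)]
      calc ‖coeffCLM k f‖ / ‖e k‖ ≤ C * Real.exp (-(η * |(k : ℝ)|)) / (c / |(k : ℝ)|) := by
            gcongr
            exact hdec k
        _ = 2 * C / (c * η) * Real.exp (-(η * |(k : ℝ)|)) * (η / 2 * |(k : ℝ)|) := by
            field_simp
        _ ≤ 2 * C / (c * η) * Real.exp (-(η * |(k : ℝ)|)) * Real.exp (η / 2 * |(k : ℝ)|) := by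
            gcongr
        _ = _ := by
            rw [mul_assoc, ← Real.exp_add]
            ring_nf
  have hsum : Summable fun k : ℤ => Real.exp (-(η / 4 * |(k : ℝ)|)) := by
    have hn : Summable fun n : ℕ => Real.exp (-(η / 4 * (n : ℝ))) := by
      have := Real.summable_exp_nat_mul_iff.mpr (by linarith : -(η / 4) < 0)
      refine this.congr fun n => ?_
      ring_nf
    refine Summable.of_nat_of_neg ?_ ?_ <;> simpa using hn
  set A := 2 * C / (c * η) with hA
  let U : Set ℂ := {z | |z.im| < η / (8 * Real.pi)}
  have hU : IsOpen U := isOpen_lt (by fun_prop) continuous_const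
  let G : ℤ → ℂ → ℂ := fun k z => β k * Complex.exp (2 * Real.pi * Complex.I * k * z)
  have hG : ∀ (k : ℤ) (z : ℂ), z ∈ U → ‖G k z‖ ≤ A * Real.exp (-(η / 4 * |(k : ℝ)|)) := by
    intro k z hz
    have h1 : (2 * Real.pi * Complex.I * k * z).re = -(2 * Real.pi * k * z.im) := by
      simp [Complex.mul_re, Complex.mul_im]
    have hz' : |z.im| * (8 * Real.pi) ≤ η := by
      have : |z.im| < η / (8 * Real.pi) := hz
      rw [lt_div_iff₀ (by positivity)] at this
      exact this.le
    have h2 : -(2 * Real.pi * k * z.im) ≤ η / 4 * |(k : ℝ)| := by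
      refine (neg_le_abs _).trans ?_
      rw [abs_mul, abs_mul, abs_of_pos (by positivity : 0 < 2 * Real.pi)]
      nlinarith [abs_nonneg (k : ℝ), mul_le_mul_of_nonneg_left hz' (abs_nonneg (k : ℝ))]
    rw [norm_mul, Complex.norm_exp, h1]
    calc _ ≤ A * Real.exp (-(η / 2 * |(k : ℝ)|)) * Real.exp (η / 4 * |(k : ℝ)|) := by
          gcongr
          exact hβ k
      _ = _ := by
          rw [mul_assoc, ← Real.exp_add]
          ring_nf
  let H : ℂ → ℂ := fun z => ∑' k, G k z
  have hH : DifferentiableOn ℂ H U :=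
    Complex.differentiableOn_tsum_of_summable_norm (hsum.mul_left A)
      (fun k => by dsimp only [G]; fun_prop) hU hG
  have hreal : ∀ θ : ℝ, (θ : ℂ) ∈ U := fun θ => by
    simp only [U, Set.mem_ofPred_eq, Complex.ofReal_im, abs_zero]
    positivity
  have hGs : ∀ θ : ℝ, HasSum (fun k => G k θ) (H θ) := fun θ =>
    (Summable.of_norm_bounded (hsum.mul_left A) fun k => hG k θ (hreal θ)).hasSum
  refine ⟨fun θ => (H θ).re, fun θ => ?_, fun θ => ?_, fun θ => ?_⟩
  · have h1 : AnalyticAt ℂ H θ := hH.analyticAt (hU.mem_nhds (hreal θ))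
    exact h1.re_ofReal
  · refine congrArg Complex.re (tsum_congr fun k => ?_)
    simp only [G]
    congr 1
    rw [Complex.exp_eq_exp_iff_exists_int]
    exact ⟨k, by push_cast; ring⟩
  · have hsumf : Summable (fourierCoeff (toComplex f)) := by
      refine Summable.of_norm_bounded (hsum.mul_left C) fun k => (hdec k).trans ?_
      gcongr
      have := abs_nonneg (k : ℝ)
      nlinarith
    have h1 := has_pointwise_sum_fourier_series_of_summable hsumf (θ : UnitAddCircle)
    have h2 := (hGs (θ + a : ℝ)).sub (hGs θ)
    have h3 : HasSum (fun k : ℤ => if k = 0 then coeffCLM 0 f else 0) (coeffCLM 0 f) :=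
      hasSum_ite_eq 0 _
    have h4 := h1.sub h3
    have h5 : H (θ + a : ℝ) - H θ = toComplex f θ - coeffCLM 0 f := by
      refine (hasSum_of_eq h2 (funext fun k => ?_)).unique h4
      rcases eq_or_ne k 0 with rfl | hk
      · simp [G, coeffCLM_apply]
      · have hek : e k ≠ 0 := by
          have h6 : 0 < c / |(k : ℝ)| := div_pos hc (abs_pos.mpr (by exact_mod_cast hk))
          exact norm_pos_iff.mp (h6.trans_le (ha k hk))
        have h7 : Complex.exp (2 * Real.pi * Complex.I * k * (θ + a : ℝ))
            = Complex.exp (2 * Real.pi * Complex.I * k * θ) * (e k + 1) := by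
          simp only [e, sub_add_cancel]
          rw [← Complex.exp_add]
          push_cast
          ring_nf
        rw [if_neg hk, sub_zero, fourier_coe_apply, ← coeffCLM_apply, smul_eq_mul]
        simp only [G, β]
        rw [h7]
        simp only [Complex.ofReal_one, div_one]
        field_simp
        ring
    have h6 := congrArg Complex.re h5
    rw [coeffCLM_zero, toComplex_apply, ← Complex.ofReal_sub, Complex.ofReal_re,
      Complex.sub_re] at h6
    exact h6

theorem golden_small_divisor {a : ℝ} (ha : a = (Real.sqrt 5 - 1) / 2) (k : ℤ) (hk : k ≠ 0) :
    1 / |(k : ℝ)| ≤ ‖Complex.exp (2 * Real.pi * Complex.I * k * a) - 1‖ := by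
  set m : ℤ := round (k * a) with hm
  set y : ℝ := k * a - m with hy
  have hy2 : |y| ≤ 1 / 2 := abs_sub_round _
  have hk1 : 1 ≤ |(k : ℝ)| := by
    rw [← Int.cast_abs]; exact_mod_cast Int.one_le_abs hk
  have h5 : Real.sqrt 5 ^ 2 = 5 := Real.sq_sqrt (by norm_num)
  have h5' : Real.sqrt 5 < 9 / 4 := by
    rw [Real.sqrt_lt' (by norm_num)]; norm_num
  have hnorm : y * (y - k * Real.sqrt 5) = ((m ^ 2 + m * k - k ^ 2 : ℤ) : ℝ) := by
    rw [hy, ha]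
    push_cast
    nlinarith
  have hN : (m ^ 2 + m * k - k ^ 2 : ℤ) ≠ 0 := by
    intro h0
    have hirr : Irrational (Real.sqrt 5) := by
      simpa using (Nat.prime_five).irrational_sqrt
    have h1 : ((2 * m + k : ℤ) : ℝ) ^ 2 = 5 * (k : ℝ) ^ 2 := by
      have : ((m ^ 2 + m * k - k ^ 2 : ℤ) : ℝ) = 0 := by rw [h0]; simp
      push_cast at this ⊢
      linarith
    have hk0 : (k : ℝ) ≠ 0 := by exact_mod_cast hk
    have h2 : Real.sqrt 5 = |((2 * m + k : ℤ) : ℝ) / k| := by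
      rw [← Real.sqrt_sq_eq_abs]
      congr 1
      rw [div_pow, h1]
      field_simp
    refine hirr ⟨|((2 * m + k : ℤ) : ℚ) / k|, ?_⟩
    rw [h2]
    push_cast
    rfl
  have hN1 : (1 : ℝ) ≤ |y| * |y - k * Real.sqrt 5| := by
    rw [← abs_mul, hnorm, ← Int.cast_abs]
    exact_mod_cast Int.one_le_abs hN
  have hle : |y - k * Real.sqrt 5| ≤ 3 * |(k : ℝ)| := by
    calc _ ≤ |y| + |k * Real.sqrt 5| := abs_sub _ _
      _ = |y| + |(k : ℝ)| * Real.sqrt 5 := by rw [abs_mul, abs_of_nonneg (Real.sqrt_nonneg 5)]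
      _ ≤ _ := by nlinarith
  have hylow : 1 / (3 * |(k : ℝ)|) ≤ |y| := by
    rw [div_le_iff₀ (by positivity)]
    nlinarith [abs_nonneg y]
  have hexp : Complex.exp (2 * Real.pi * Complex.I * k * a)
      = Complex.exp (Complex.I * ((2 * Real.pi * y : ℝ) : ℂ)) := by
    rw [Complex.exp_eq_exp_iff_exists_int]
    exact ⟨m, by rw [hy]; push_cast; ring⟩
  rw [hexp, Complex.norm_exp_I_mul_ofReal_sub_one, Real.norm_eq_abs, abs_mul,
    show 2 * Real.pi * y / 2 = Real.pi * y by ring]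
  have hsin : 2 * |y| ≤ |Real.sin (Real.pi * y)| := by
    have h1 : Real.sin (Real.pi * |y|) ≤ |Real.sin (Real.pi * y)| := by
      rcases abs_cases y with ⟨h, -⟩ | ⟨h, -⟩ <;> rw [h]
      · exact le_abs_self _
      · rw [mul_neg, Real.sin_neg]; exact neg_le_abs _
    have h2 := Real.mul_le_sin (x := Real.pi * |y|) (by positivity)
      (by nlinarith [Real.pi_pos])
    have h3 : 2 / Real.pi * (Real.pi * |y|) = 2 * |y| := by
      field_simp
    linarith
  have h6 : 1 / |(k : ℝ)| = 3 * (1 / (3 * |(k : ℝ)|)) := by field_simp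
  rw [h6, abs_two]
  nlinarith [abs_nonneg y]

theorem TransAnalytic.analyticAt {f : CircleFun} (hf : TransAnalytic f) (θ : ℝ) :
    AnalyticAt ℝ (fun t : ℝ => f (t : UnitAddCircle)) θ := by
  have hfa : AnalyticAt ℝ (fun s : ℝ => trans (s : UnitAddCircle) f) 0 := by
    rw [← analyticWithinAt_univ, ← contDiffWithinAt_omega_iff_analyticWithinAt,
      contDiffWithinAt_univ]
    exact hf
  have h1 : AnalyticAt ℝ (fun t : ℝ => t - θ) θ := analyticAt_id.sub analyticAt_const
  have h2 := ((ContinuousMap.evalCLM ℝ (θ : UnitAddCircle)).analyticAt _).comp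
    (AnalyticAt.comp_of_eq (g := fun s : ℝ => trans (s : UnitAddCircle) f) hfa h1 (sub_self θ))
  refine h2.congr (Eventually.of_forall fun t => ?_)
  change f ((θ : UnitAddCircle) + ((t - θ : ℝ) : UnitAddCircle)) = f t
  rw [← AddCircle.coe_add, add_sub_cancel]

theorem integrable_haar (f : CircleFun) : Integrable f AddCircle.haarAddCircle :=
  f.continuous.integrable_of_hasCompactSupport (HasCompactSupport.of_compactSpace _)

/-- Pointwise logarithm of a positive function. -/
noncomputable def logC (g : CircleFun) (hg : ∀ x, 0 < g x) : CircleFun :=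
  ⟨fun x => Real.log (g x), g.continuous.log fun x => (hg x).ne'⟩

@[simp] theorem logC_apply (g : CircleFun) (hg : ∀ x, 0 < g x) (x : UnitAddCircle) :
    logC g hg x = Real.log (g x) := rfl

/-- Exponentially growing positive Floquet solution of `p(· + a) + p(· - a) = E p`, from an
approximate one. -/
theorem exists_floquet {a c : ℝ} (hc : 0 < c)
    (ha : ∀ k : ℤ, k ≠ 0 → c / |(k : ℝ)| ≤ ‖Complex.exp (2 * Real.pi * Complex.I * k * a) - 1‖)
    {E p : CircleFun} (hE : TransAnalytic E) {δ l : ℝ} (hδ : 0 < δ) (hl : 0 < l)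
    (hp : ∀ x, 0 < p x)
    (hsub : ∀ x, l * p (x + (a : UnitAddCircle)) + l⁻¹ * p (x - (a : UnitAddCircle)) + δ
      ≤ E x * p x) :
    ∃ (r : CircleFun) (μ : ℝ) (P : ℝ → ℝ), (∀ x, 0 < r x) ∧
      (∀ x, r x = E x - (r (x - (a : UnitAddCircle)))⁻¹) ∧
      (∀ σ : CircleFun, (∀ x, 0 < σ x) → (∀ x, σ x + (σ (x - (a : UnitAddCircle)))⁻¹ ≤ E x) →
        ∀ x, σ x ≤ r x) ∧
      l ≤ μ ∧ (∀ θ, AnalyticAt ℝ P θ) ∧ Function.Periodic P 1 ∧ (∀ θ, 0 < P θ) ∧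
      ∀ θ : ℝ, μ * P (θ + a) = r (θ : UnitAddCircle) * P θ := by
  let σ₀ : CircleFun := l • (trans (a : UnitAddCircle) p * inv p hp)
  have hσ₀ : ∀ x, σ₀ x = l * p (x + (a : UnitAddCircle)) / p x := fun x => by
    simp [σ₀, div_eq_mul_inv, mul_assoc]
  have hσ₀pos : ∀ x, 0 < σ₀ x := fun x => by
    rw [hσ₀]
    have := hp x
    have := hp (x + (a : UnitAddCircle))
    positivity
  have hnorm : ∀ x, p x ≤ ‖p‖ := fun x => (le_abs_self _).trans (p.norm_coe_le_norm x)
  have hM : 0 < ‖p‖ := (hp 0).trans_le (hnorm 0)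
  have hσsub : ∀ x, σ₀ x + (σ₀ (x - (a : UnitAddCircle)))⁻¹ + δ / ‖p‖ ≤ E x := fun x => by
    have h0 := hp x
    rw [hσ₀, hσ₀, sub_add_cancel, inv_div]
    have h1 : δ / ‖p‖ ≤ δ / p x := div_le_div_of_nonneg_left hδ.le h0 (hnorm x)
    have h2 : p (x - (a : UnitAddCircle)) / (l * p x)
        = l⁻¹ * p (x - (a : UnitAddCircle)) / p x := by
      field_simp
    have h3 : (l * p (x + (a : UnitAddCircle)) + l⁻¹ * p (x - (a : UnitAddCircle)) + δ) / p x
        ≤ E x := by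
      rw [div_le_iff₀ h0]; exact hsub x
    rw [add_div, add_div] at h3
    rw [h2]
    linarith
  obtain ⟨r, hr, hric, hran, hmax⟩ := exists_riccati hE (div_pos hδ hM) hσ₀pos hσsub
  have hexp : expC (logC r hr) = r := by
    ext x
    simp [Real.exp_log (hr x)]
  have hlog : TransAnalytic (logC r hr) := transAnalytic_of_expC (by rw [hexp]; exact hran)
  obtain ⟨b, hb, hbp, hbe⟩ := hlog.exists_cohomological hc ha
  set m := ∫ x, logC r hr x ∂AddCircle.haarAddCircle with hm
  refine ⟨r, Real.exp m, fun θ => Real.exp (b θ), hr, hric, hmax, ?_, fun θ => (hb θ).rexp,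
    fun θ => ?_, fun θ => Real.exp_pos _, fun θ => ?_⟩
  · rw [← Real.log_le_iff_le_exp hl]
    have h1 : ∀ x, Real.log l + (trans (a : UnitAddCircle) (logC p hp) x - logC p hp x)
        ≤ logC r hr x := fun x => by
      have h2 := hmax σ₀ hσ₀pos (fun x => by
        have := hσsub x
        have := div_pos hδ hM
        linarith) x
      have h3 := Real.log_le_log (hσ₀pos x) h2
      rw [hσ₀, Real.log_div (mul_pos hl (hp _)).ne' (hp x).ne',
        Real.log_mul hl.ne' (hp _).ne'] at h3
      simp only [trans_apply, logC_apply]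
      linarith
    have h2 : ∫ x, (Real.log l + (trans (a : UnitAddCircle) (logC p hp) x - logC p hp x))
        ∂AddCircle.haarAddCircle = Real.log l := by
      rw [integral_add (f := fun _ => Real.log l)
          (g := fun x => trans (a : UnitAddCircle) (logC p hp) x - logC p hp x)
          (integrable_const _) ((integrable_haar _).sub (integrable_haar _)),
        integral_sub (integrable_haar _) (integrable_haar _)]
      have h3 := integral_add_right_eq_self (μ := AddCircle.haarAddCircle) (fun x => logC p hp x)
        (a : UnitAddCircle)
      simp only [trans_apply]
      rw [h3]
      simp
    rw [← h2, hm]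
    exact integral_mono ((integrable_const _).add ((integrable_haar _).sub (integrable_haar _)))
      (integrable_haar _) h1
  · exact congrArg Real.exp (hbp θ)
  · have h1 : m + b (θ + a) = Real.log (r θ) + b θ := by
      have := hbe θ
      rw [logC_apply] at this
      linarith
    dsimp only
    rw [← Real.exp_add, h1, Real.exp_add, Real.exp_log (hr _)]

/-- The forcing term `A sin(2πθ)`. -/
noncomputable def forcing (A : ℝ) : CircleFun := A • imC (fourier 1)

theorem forcing_coe (A θ : ℝ) : forcing A (θ : UnitAddCircle) = A * Real.sin (2 * Real.pi * θ) := by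
  change A * (fourier 1 (θ : UnitAddCircle)).im = _
  rw [fourier_coe_apply, show 2 * (Real.pi : ℂ) * Complex.I * ((1 : ℤ) : ℂ) * θ / ((1 : ℝ) : ℂ)
    = ((2 * Real.pi * θ : ℝ) : ℂ) * Complex.I by push_cast; ring, Complex.exp_ofReal_mul_I_im]

theorem transAnalytic_forcing (A : ℝ) : TransAnalytic (forcing A) := by
  have h : ∀ s : ℝ, trans (s : UnitAddCircle) (forcing A)
      = Real.cos (2 * Real.pi * s) • forcing A
        + (A * Real.sin (2 * Real.pi * s)) • reC (fourier 1) := by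
    intro s
    ext x
    induction x using QuotientAddGroup.induction_on with | H θ => ?_
    have h1 : reC (fourier 1) (θ : UnitAddCircle) = Real.cos (2 * Real.pi * θ) := by
      change (fourier 1 (θ : UnitAddCircle)).re = _
      rw [fourier_coe_apply, show 2 * (Real.pi : ℂ) * Complex.I * ((1 : ℤ) : ℂ) * θ / ((1 : ℝ) : ℂ)
        = ((2 * Real.pi * θ : ℝ) : ℂ) * Complex.I by push_cast; ring, Complex.exp_ofReal_mul_I_re]
    change forcing A ((θ + s : ℝ) : UnitAddCircle)
      = Real.cos (2 * Real.pi * s) * forcing A (θ : UnitAddCircle)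
        + (A * Real.sin (2 * Real.pi * s)) * reC (fourier 1) (θ : UnitAddCircle)
    rw [forcing_coe, forcing_coe, h1, mul_add, Real.sin_add]
    ring
  unfold TransAnalytic
  simp only [h]
  have hc : ContDiff ℝ ω fun s : ℝ => Real.cos (2 * Real.pi * s) :=
    Real.contDiff_cos.comp (contDiff_const.mul contDiff_id)
  have hs : ContDiff ℝ ω fun s : ℝ => A * Real.sin (2 * Real.pi * s) :=
    contDiff_const.mul (Real.contDiff_sin.comp (contDiff_const.mul contDiff_id))
  exact ((hc.smul contDiff_const).add (hs.smul contDiff_const)).contDiffAt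

theorem sqrt_add_sqrt_add_le {E l p pp pm q qp qm δ : ℝ} (hl : 0 < l) (hp : 0 ≤ p) (hpp : 0 ≤ pp)
    (hpm : 0 ≤ pm) (hq : 0 ≤ q) (hqp : 0 ≤ qp) (hqm : 0 ≤ qm) (hδ : 0 ≤ δ) (hE : 0 ≤ E)
    (h₁ : l * pp + l⁻¹ * pm + δ ≤ E * p) (h₂ : l⁻¹ * qp + l * qm + δ ≤ E * q) :
    √(pp * qp) + √(pm * qm) + δ ≤ E * √(p * q) := by
  have h3 : (l * pp + l⁻¹ * pm + δ) * (l⁻¹ * qp + l * qm + δ) ≤ (E * √(p * q)) ^ 2 := by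
    rw [mul_pow, Real.sq_sqrt (mul_nonneg hp hq)]
    calc _ ≤ (E * p) * (E * q) := mul_le_mul h₁ h₂ (by positivity) (by positivity)
      _ = _ := by ring
  refine abs_le_of_sq_le_sq' (le_trans ?_ h3) (by positivity) |>.2
  obtain ⟨m, hm, rfl⟩ : ∃ m : ℝ, 0 < m ∧ m ^ 2 = l := ⟨√l, Real.sqrt_pos.mpr hl, Real.sq_sqrt hl.le⟩
  obtain ⟨a, ha, rfl⟩ : ∃ m : ℝ, 0 ≤ m ∧ m ^ 2 = pp := ⟨√pp, Real.sqrt_nonneg _, Real.sq_sqrt hpp⟩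
  obtain ⟨b, hb, rfl⟩ : ∃ m : ℝ, 0 ≤ m ∧ m ^ 2 = pm := ⟨√pm, Real.sqrt_nonneg _, Real.sq_sqrt hpm⟩
  obtain ⟨c, hc, rfl⟩ : ∃ m : ℝ, 0 ≤ m ∧ m ^ 2 = qp := ⟨√qp, Real.sqrt_nonneg _, Real.sq_sqrt hqp⟩
  obtain ⟨d, hd, rfl⟩ : ∃ m : ℝ, 0 ≤ m ∧ m ^ 2 = qm := ⟨√qm, Real.sqrt_nonneg _, Real.sq_sqrt hqm⟩
  rw [← mul_pow, ← mul_pow, Real.sqrt_sq (by positivity), Real.sqrt_sq (by positivity)]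
  obtain ⟨n, hn⟩ : ∃ n, n = m⁻¹ := ⟨_, rfl⟩
  have hmn : m * n = 1 := by rw [hn]; field_simp
  rw [← inv_pow, ← hn]
  have h4 : (m ^ 2 * a ^ 2 + n ^ 2 * b ^ 2 + δ) * (n ^ 2 * c ^ 2 + m ^ 2 * d ^ 2 + δ)
      - ((m * a) * (n * c) + (n * b) * (m * d) + δ) ^ 2
      = ((m * a) * (m * d) - (n * b) * (n * c)) ^ 2
        + δ * ((m * a - n * c) ^ 2 + (n * b - m * d) ^ 2) := by ring
  have h5 : (m * a) * (n * c) + (n * b) * (m * d) + δ = a * c + b * d + δ := by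
    linear_combination (a * c + b * d) * hmn
  rw [h5] at h4
  have : 0 ≤ δ * ((m * a - n * c) ^ 2 + (n * b - m * d) ^ 2) := by positivity
  nlinarith [sq_nonneg ((m * a) * (m * d) - (n * b) * (n * c))]

/-- Pointwise square root. -/
noncomputable def sqrtC (f : CircleFun) : CircleFun := ⟨fun x => √(f x), by fun_prop⟩

@[simp] theorem sqrtC_apply (f : CircleFun) (x : UnitAddCircle) : sqrtC f x = √(f x) := rfl

theorem sqrt_mul_supersolution {a : UnitAddCircle} {E p q : CircleFun} {l δ : ℝ} (hl : 0 < l)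
    (hδ : 0 < δ) (hE : ∀ x, 0 ≤ E x) (hp : ∀ x, 0 < p x) (hq : ∀ x, 0 < q x)
    (hpE : ∀ x, l * p (x + a) + l⁻¹ * p (x - a) + δ ≤ E x * p x)
    (hqE : ∀ x, l * q (x - a) + l⁻¹ * q (x + a) + δ ≤ E x * q x) (x : UnitAddCircle) :
    sqrtC (p * q) (x + a) + sqrtC (p * q) (x - a) + δ ≤ E x * sqrtC (p * q) x := by
  simp only [sqrtC_apply, ContinuousMap.mul_apply]
  exact sqrt_add_sqrt_add_le hl (hp _).le (hp _).le (hp _).le (hq _).le (hq _).le (hq _).le hδ.le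
    (hE x) (hpE x) (by linarith [hqE x])

/-- Growing and decaying positive Floquet solutions of `p(· + a) + p(· - a) = E p`. -/
theorem exists_frame {a c : ℝ} (hc : 0 < c)
    (ha : ∀ k : ℤ, k ≠ 0 → c / |(k : ℝ)| ≤ ‖Complex.exp (2 * Real.pi * Complex.I * k * a) - 1‖)
    {E p q : CircleFun} (hE : TransAnalytic E) (hE0 : ∀ x, 0 ≤ E x) {δ l : ℝ} (hδ : 0 < δ)
    (hl : 0 < l) (hp : ∀ x, 0 < p x) (hq : ∀ x, 0 < q x)
    (hpE : ∀ x, l * p (x + (a : UnitAddCircle)) + l⁻¹ * p (x - (a : UnitAddCircle)) + δ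
      ≤ E x * p x)
    (hqE : ∀ x, l * q (x - (a : UnitAddCircle)) + l⁻¹ * q (x + (a : UnitAddCircle)) + δ
      ≤ E x * q x) :
    ∃ (U S : ℝ → ℝ) (μ ν : ℝ), (∀ θ, AnalyticAt ℝ U θ) ∧ (∀ θ, AnalyticAt ℝ S θ) ∧
      Function.Periodic U 1 ∧ Function.Periodic S 1 ∧ l ≤ μ ∧ l ≤ ν ∧
      (∀ θ : ℝ, μ * U (θ + a) + μ⁻¹ * U (θ - a) = E (θ : UnitAddCircle) * U θ) ∧
      (∀ θ : ℝ, ν⁻¹ * S (θ + a) + ν * S (θ - a) = E (θ : UnitAddCircle) * S θ) ∧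
      ∀ θ : ℝ, S θ * (μ⁻¹ * U (θ - a)) < U θ * (ν * S (θ - a)) := by
  have ha' : ∀ k : ℤ, k ≠ 0 →
      c / |(k : ℝ)| ≤ ‖Complex.exp (2 * Real.pi * Complex.I * k * ((-a : ℝ) : ℂ)) - 1‖ := by
    intro k hk
    have := ha (-k) (neg_ne_zero.mpr hk)
    push_cast at this ⊢
    rw [abs_neg] at this
    refine this.trans_eq ?_
    congr 3
    ring
  obtain ⟨r, μ, U, hr, hric, hmax, hμ, hUa, hUp, hU, hUe⟩ := exists_floquet hc ha hE hδ hl hp hpE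
  obtain ⟨R, ν, S, hR, hRic, hRmax, hν, hSa, hSp, hS, hSe⟩ := exists_floquet hc ha' hE hδ hl hq
    (fun x => by
      rw [AddCircle.coe_neg, sub_neg_eq_add, ← sub_eq_add_neg]
      exact hqE x)
  have hμ0 := hl.trans_le hμ
  have hν0 := hl.trans_le hν
  have hU1 : ∀ θ, μ⁻¹ * U (θ - a) = (r ((θ : UnitAddCircle) - (a : UnitAddCircle)))⁻¹ * U θ := by
    intro θ
    have h1 := hUe (θ - a)
    rw [sub_add_cancel, AddCircle.coe_sub] at h1
    have := hr ((θ : UnitAddCircle) - (a : UnitAddCircle))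
    field_simp
    linarith
  have hS0 : ∀ θ, ν * S (θ - a) = R (θ : UnitAddCircle) * S θ := by
    intro θ
    have h1 := hSe θ
    rwa [← sub_eq_add_neg] at h1
  have hS1 : ∀ θ, ν⁻¹ * S (θ + a) = (R ((θ : UnitAddCircle) + (a : UnitAddCircle)))⁻¹ * S θ := by
    intro θ
    have h1 := hS0 (θ + a)
    rw [add_sub_cancel_right, AddCircle.coe_add] at h1
    have := hR ((θ : UnitAddCircle) + (a : UnitAddCircle))
    field_simp
    linarith
  refine ⟨U, S, μ, ν, hUa, hSa, hUp, hSp, hμ, hν, fun θ => ?_, fun θ => ?_, fun θ => ?_⟩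
  · rw [hUe, hU1]
    linear_combination U θ * hric θ
  · rw [hS0, hS1]
    have h1 := hRic θ
    rw [AddCircle.coe_neg, sub_neg_eq_add] at h1
    linear_combination S θ * h1
  set w := sqrtC (p * q) with hwdef
  have hw : ∀ x, 0 < w x := fun x => Real.sqrt_pos.mpr (mul_pos (hp x) (hq x))
  have hwE := sqrt_mul_supersolution hl hδ hE0 hp hq hpE hqE
  rw [← hwdef] at hwE
  have hnorm : ∀ x, w x ≤ ‖w‖ := fun x => (le_abs_self _).trans (w.norm_coe_le_norm x)
  have hM : 0 < ‖w‖ := (hw 0).trans_le (hnorm 0)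
  set η := δ / ‖w‖ with hη
  have hη0 : 0 < η := div_pos hδ hM
  have hwE' : ∀ x, w (x + (a : UnitAddCircle)) / w x + w (x - (a : UnitAddCircle)) / w x + η
      ≤ E x := fun x => by
    have h1 : η ≤ δ / w x := div_le_div_of_nonneg_left hδ.le (hw x) (hnorm x)
    have h2 : (w (x + (a : UnitAddCircle)) + w (x - (a : UnitAddCircle)) + δ) / w x ≤ E x := by
      rw [div_le_iff₀ (hw x)]; exact hwE x
    rw [add_div, add_div] at h2
    linarith
  set t : UnitAddCircle := (θ : UnitAddCircle)
  have h1 : w (t - (a : UnitAddCircle)) / w t ≤ R t := by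
    have := hRmax (trans (-(a : UnitAddCircle)) w * inv w hw) (fun x => by
      simpa using mul_pos (hw _) (inv_pos.mpr (hw x))) (fun x => by
      have := hwE' x
      simp only [ContinuousMap.mul_apply, trans_apply, inv_apply, AddCircle.coe_neg, sub_neg_eq_add,
        ← sub_eq_add_neg, add_sub_cancel_right, ← div_eq_mul_inv]
      rw [inv_div]
      linarith) t
    simpa [div_eq_mul_inv, sub_eq_add_neg] using this
  have h2 : w t / w (t - (a : UnitAddCircle)) + η ≤ r (t - (a : UnitAddCircle)) := by
    have := hmax (trans (a : UnitAddCircle) w * inv w hw + ContinuousMap.const _ η) (fun x => by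
      simpa using add_pos (mul_pos (hw _) (inv_pos.mpr (hw x))) hη0) (fun x => by
      have h3 := hwE' x
      simp only [ContinuousMap.add_apply, ContinuousMap.mul_apply, trans_apply, inv_apply,
        ContinuousMap.const_apply, sub_add_cancel, ← div_eq_mul_inv]
      have h4 : (w x / w (x - (a : UnitAddCircle)) + η)⁻¹ ≤ w (x - (a : UnitAddCircle)) / w x := by
        rw [← inv_div (w x)]
        exact inv_anti₀ (div_pos (hw _) (hw _)) (by linarith)
      linarith) (t - (a : UnitAddCircle))
    simpa [div_eq_mul_inv] using this
  have h3 : (r (t - (a : UnitAddCircle)))⁻¹ < R t := by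
    refine lt_of_lt_of_le ?_ h1
    rw [← inv_div]
    exact inv_strictAnti₀ (div_pos (hw _) (hw _)) (by linarith)
  rw [hU1, hS0]
  have h4 := mul_lt_mul_of_pos_left h3 (mul_pos (hU θ) (hS θ))
  linarith

theorem supersolution_of_close {a : UnitAddCircle} {E E₀ p : CircleFun} {l m δ M : ℝ}
    (hp : ∀ x, 0 < p x) (hpM : ∀ x, p x ≤ M) (hE : ∀ x, |E x - E₀ x| ≤ δ / (2 * M))
    (h : ∀ x, l * p (x + a) + m * p (x - a) + δ ≤ E₀ x * p x) (x : UnitAddCircle) :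
    l * p (x + a) + m * p (x - a) + δ / 2 ≤ E x * p x := by
  have hM : 0 < M := (hp 0).trans_le (hpM 0)
  have hd : 0 ≤ δ / (2 * M) := (abs_nonneg _).trans (hE 0)
  have h1 : |E x - E₀ x| * p x ≤ δ / (2 * M) * M := mul_le_mul (hE x) (hpM x) (hp x).le hd
  have h2 : δ / (2 * M) * M = δ / 2 := by field_simp
  have h3 := mul_le_mul_of_nonneg_right (neg_le_of_abs_le (le_refl |E x - E₀ x|)) (hp x).le
  nlinarith [h x]

/-- Reflection of a function on the circle. -/
noncomputable def refl (f : CircleFun) : CircleFun := ⟨fun x => f (-x), by fun_prop⟩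

@[simp] theorem refl_apply (f : CircleFun) (x : UnitAddCircle) : refl f x = f (-x) := rfl

/-- An odd approximate solution of the invariance equation together with an approximate
growing Floquet solution of the linearisation produces a true solution and true Floquet
solutions. -/
theorem exists_torus_and_frame {a κ l M : ℝ}
    (ha : a = (Real.sqrt 5 - 1) / 2) (hκ : 0 < κ) (hκ2 : κ ≤ 2) (hl : 0 < l)
    {g f₀ p : CircleFun} (hg : TransAnalytic g)
    (hodd : ∀ x, f₀ (-x) = -f₀ x) (hp : ∀ x, 0 ≤ p x) (hpM : ∀ x, p x ≤ M)
    (hpE : ∀ x, l * p (x + (a : UnitAddCircle)) + l⁻¹ * p (x - (a : UnitAddCircle)) + 1 / 2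
      ≤ torusPot κ f₀ x * p x)
    (hres : ∀ x, |torusEq (a : UnitAddCircle) κ g f₀ x| ≤ 1 / (16 * κ * M ^ 2)) :
    ∃ v : CircleFun, torusEq (a : UnitAddCircle) κ g v = 0 ∧ TransAnalytic v ∧
    ∃ (U S : ℝ → ℝ) (μ ν : ℝ), (∀ θ, AnalyticAt ℝ U θ) ∧ (∀ θ, AnalyticAt ℝ S θ) ∧
      Function.Periodic U 1 ∧ Function.Periodic S 1 ∧ l ≤ μ ∧ l ≤ ν ∧
      (∀ θ : ℝ, μ * U (θ + a) + μ⁻¹ * U (θ - a) = torusPot κ v (θ : UnitAddCircle) * U θ) ∧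
      (∀ θ : ℝ, ν⁻¹ * S (θ + a) + ν * S (θ - a) = torusPot κ v (θ : UnitAddCircle) * S θ) ∧
      ∀ θ : ℝ, S θ * (μ⁻¹ * U (θ - a)) < U θ * (ν * S (θ - a)) := by
  have hpot : ∀ f x, 0 ≤ torusPot κ f x := fun f x => by
    rw [torusPot_apply]
    nlinarith [Real.neg_one_le_cos (f x)]
  have hpos : ∀ x, 0 < p x := fun x => by
    refine (hp x).lt_of_ne fun h0 => ?_
    have h1 := hpE x
    rw [← h0, mul_zero] at h1
    have := mul_nonneg hl.le (hp (x + (a : UnitAddCircle)))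
    have := mul_nonneg (inv_pos.mpr hl).le (hp (x - (a : UnitAddCircle)))
    linarith
  have hM : 0 < M := (hpos 0).trans_le (hpM 0)
  set q := refl p
  have hqpos : ∀ x, 0 < q x := fun x => hpos _
  have hqE : ∀ x, l * q (x - (a : UnitAddCircle)) + l⁻¹ * q (x + (a : UnitAddCircle)) + 1 / 2
      ≤ torusPot κ f₀ x * q x := fun x => by
    have h1 := hpE (-x)
    rw [torusPot_apply, hodd, Real.cos_neg] at h1
    simp only [q, refl_apply, torusPot_apply, neg_sub, neg_add_rev]
    rw [show -x + (a : UnitAddCircle) = (a : UnitAddCircle) - x by abel,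
      show -x - (a : UnitAddCircle) = -(a : UnitAddCircle) + -x by abel] at h1
    exact h1
  have hwpos : ∀ x, 0 < sqrtC (p * q) x := fun x => Real.sqrt_pos.mpr (mul_pos (hpos x) (hqpos x))
  have hwM : ∀ x, sqrtC (p * q) x ≤ M := fun x => by
    refine Real.sqrt_le_iff.mpr ⟨hM.le, ?_⟩
    rw [sq]
    exact mul_le_mul (hpM x) (hpM (-x)) (hqpos x).le hM.le
  have hwE := sqrt_mul_supersolution hl one_half_pos (hpot f₀) hpos hqpos hpE hqE
  obtain ⟨v, hv, hclose⟩ := exists_torus (r := 1 / (4 * κ * M)) hκ.le one_half_pos (by positivity)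
    hwpos hwM hwE (g := g) (fun x => (hres x).trans_eq (by field_simp; norm_num))
  have hE : ∀ x, |torusPot κ v x - torusPot κ f₀ x| ≤ (1 / 2) / (2 * M) := fun x => by
    rw [torusPot_apply, torusPot_apply, add_sub_add_left_eq_sub, ← mul_sub, abs_mul, abs_of_pos hκ]
    have h1 : |Real.cos (v x) - Real.cos (f₀ x)| ≤ |v x - f₀ x| := by
      simpa [Real.dist_eq] using Real.lipschitzWith_cos.dist_le_mul (v x) (f₀ x)
    calc _ ≤ κ * (1 / (4 * κ * M)) := by gcongr; exact h1.trans (hclose x)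
      _ = _ := by field_simp; norm_num
  have hA : IsUnit (schr (a : UnitAddCircle) (torusPot κ v)) := by
    refine (isUnit_schr (δ := 1 / 2 / 2) (by norm_num) hwpos fun x => ?_).1
    have := supersolution_of_close (l := 1) (m := 1) hwpos hwM hE
      (fun x => by simpa only [one_mul] using hwE x) x
    simpa only [one_mul] using this
  have hva := transAnalytic_torus hg hv hA
  have hEa : TransAnalytic (torusPot κ v) :=
    hva.comp (N := torusPot κ) (contDiff_const.add (contDiff_cosC.const_smul κ)).contDiffAt
      fun s => by ext x; simp
  refine ⟨v, hv, hva, ?_⟩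
  refine exists_frame one_pos (golden_small_divisor ha) hEa (hpot v) (δ := 1 / 2 / 2) (by norm_num)
    hl hpos hqpos (supersolution_of_close hpos hpM hE hpE) fun x => ?_
  have := supersolution_of_close hqpos (fun x => hpM (-x)) hE (l := l⁻¹) (m := l)
    (a := (a : UnitAddCircle)) (fun x => by linarith [hqE x]) x
  linarith

end CircleFun

open CircleFun in
theorem torus_of_certificate (ω : ℝ) (hω : ω = (Real.sqrt 5 - 1) / 2) {f₀ p : CircleFun} {M : ℝ}
    (hodd : ∀ x, f₀ (-x) = -f₀ x) (hp : ∀ x, 0 ≤ p x) (hpM : ∀ x, p x ≤ M)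
    (hpE : ∀ x, 1.487 * p (x + (ω : UnitAddCircle)) + 1.487⁻¹ * p (x - (ω : UnitAddCircle)) + 1 / 2
      ≤ torusPot 1.3 f₀ x * p x)
    (hres : ∀ x, |torusEq (ω : UnitAddCircle) 1.3 (forcing (2 * Real.pi * 1.2342)) f₀ x|
      ≤ 1 / (16 * 1.3 * M ^ 2)) :
    ∃ (K : ℝ → ℝ × ℝ) (P : ℝ → Matrix (Fin 2) (Fin 2) ℝ) (lams lamu : ℝ),
      (∀ θ : ℝ, AnalyticAt ℝ K θ) ∧ Function.Periodic K 1 ∧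
      (∀ θ : ℝ, stdF 1.3 1.2342 (K (θ - ω)).1 (K (θ - ω)).2 (θ - ω) = K θ) ∧
      (∀ (i j : Fin 2) (θ : ℝ), AnalyticAt ℝ (fun t => P t i j) θ) ∧
      Function.Periodic P 1 ∧
      (∀ θ : ℝ, IsUnit (P θ)) ∧
      |lams| ≤ 0.6725 ∧ 1.487 ≤ |lamu| ∧ |lams| < 1 ∧ 1 < |lamu| ∧
      (∀ θ : ℝ,
        stdDF 1.3 (K (θ - ω)).1 * P (θ - ω) = P θ * Matrix.diagonal ![lams, lamu]) := by
  obtain ⟨v, hv, hva, U, S, μ, ν, hUa, hSa, hUp, hSp, hμ, hν, hU, hS, hdet⟩ :=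
    exists_torus_and_frame hω (by norm_num) (by norm_num) (by norm_num)
      (transAnalytic_forcing _) hodd hp hpM hpE hres
  have hμ0 : 0 < μ := by linarith
  have hν0 : 0 < ν := by linarith
  have hπ := Real.pi_pos
  obtain ⟨V, hV⟩ : ∃ V : ℝ → ℝ, ∀ t, V t = v (t : UnitAddCircle) := ⟨_, fun _ => rfl⟩
  have hVa : ∀ θ, AnalyticAt ℝ V θ := fun θ => by
    rw [funext hV]
    exact hva.analyticAt θ
  have hVp : Function.Periodic V 1 := fun θ => by
    rw [hV, hV, AddCircle.coe_add_period]
  have hVe : ∀ θ, V (θ + ω) + V (θ - ω) - 2 * V θ - 1.3 * Real.sin (V θ)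
      + 2 * Real.pi * 1.2342 * Real.sin (2 * Real.pi * θ) = 0 := fun θ => by
    have h1 := DFunLike.congr_fun hv (θ : UnitAddCircle)
    rw [torusEq_apply, forcing_coe, ← AddCircle.coe_add, ← AddCircle.coe_sub, ← hV, ← hV, ← hV,
      ContinuousMap.zero_apply] at h1
    linarith
  have hshift : ∀ {f : ℝ → ℝ}, (∀ θ, AnalyticAt ℝ f θ) → ∀ θ, AnalyticAt ℝ (fun t => f (t - ω)) θ :=
    fun hf θ => AnalyticAt.fun_comp (hf (θ - ω)) (analyticAt_id.sub analyticAt_const)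
  have hper : ∀ {f : ℝ → ℝ}, Function.Periodic f 1 → ∀ θ, f (θ + 1 - ω) = f (θ - ω) :=
    fun hf θ => by rw [add_sub_right_comm, hf]
  have htwo : ∀ y, 2 * Real.pi * (1 / 2 + y / (2 * Real.pi)) = y + Real.pi := fun y => by
    field_simp; ring
  refine ⟨fun θ => (1 / 2 + V θ / (2 * Real.pi), (V θ - V (θ - ω)) / (2 * Real.pi)),
    fun θ => !![S θ, U θ; S θ - ν * S (θ - ω), U θ - μ⁻¹ * U (θ - ω)], ν⁻¹, μ,
    fun θ => ?_, fun θ => ?_, fun θ => ?_, fun i j θ => ?_, fun θ => ?_, fun θ => ?_, ?_, ?_, ?_,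
    ?_, fun θ => ?_⟩
  · exact (analyticAt_const.add ((hVa θ).div_const)).prod
      (((hVa θ).sub (hshift hVa θ)).div_const)
  · simp only [hVp θ, hper hVp]
  · have h1 := hVe (θ - ω)
    rw [sub_add_cancel] at h1
    have hc : 2 * Real.pi * (2 * Real.pi)⁻¹ = 1 := mul_inv_cancel₀ (by positivity)
    simp only [stdF, htwo, Real.sin_add_pi]
    simp only [div_eq_mul_inv _ (2 * Real.pi)]
    refine Prod.ext ?_ ?_ <;>
    linear_combination (-(2 * Real.pi)⁻¹) * h1
      + 1.2342 * Real.sin (2 * Real.pi * (θ - ω)) * hc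
  · fin_cases i <;> fin_cases j
    · exact hSa θ
    · exact hUa θ
    · exact (hSa θ).sub (analyticAt_const.mul (hshift hSa θ))
    · exact (hUa θ).sub (analyticAt_const.mul (hshift hUa θ))
  · simp only [hSp θ, hUp θ, hper hSp, hper hUp]
  · rw [Matrix.isUnit_iff_isUnit_det, isUnit_iff_ne_zero, Matrix.det_fin_two_of]
    have := hdet θ
    intro h
    linarith
  · rw [abs_of_pos (inv_pos.mpr hν0)]
    calc ν⁻¹ ≤ 1.487⁻¹ := inv_anti₀ (by norm_num) hν
      _ ≤ 0.6725 := by norm_num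
  · rwa [abs_of_pos hμ0]
  · rw [abs_of_pos (inv_pos.mpr hν0)]
    calc ν⁻¹ ≤ 1.487⁻¹ := inv_anti₀ (by norm_num) hν
      _ < 1 := by norm_num
  · rw [abs_of_pos hμ0]
    linarith
  · have h1 := hU (θ - ω)
    have h2 := hS (θ - ω)
    rw [torusPot_apply, ← hV, sub_add_cancel] at h1 h2
    simp only [stdDF, htwo, Real.cos_add_pi]
    have h3 : μ * μ⁻¹ = 1 := mul_inv_cancel₀ hμ0.ne'
    have h4 : ν * ν⁻¹ = 1 := mul_inv_cancel₀ hν0.ne'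
    ext i j
    fin_cases i <;> fin_cases j <;> simp [Matrix.mul_apply, Fin.sum_univ_two]
    · linarith
    · linarith
    · linear_combination -h2 + S (θ - ω) * h4
    · linear_combination -h1 + U (θ - ω) * h3

namespace CoeffList

/-- Evaluation of a list of coefficients as a polynomial. -/
def ev {R : Type*} [CommRing R] (l : List ℤ) (x : R) : R :=
  l.foldr (fun (c : ℤ) (r : R) => (c : R) + x * r) 0

section Ring

variable {R : Type*} [CommRing R]

@[simp] theorem ev_nil (x : R) : ev [] x = 0 := rfl

@[simp] theorem ev_cons (c : ℤ) (l : List ℤ) (x : R) : ev (c :: l) x = c + x * ev l x := rfl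

/-- Coefficientwise sum. -/
def addL : List ℤ → List ℤ → List ℤ
  | [], m => m
  | c :: l, [] => c :: l
  | c :: l, d :: m => (c + d) :: addL l m

@[simp] theorem ev_addL (l m : List ℤ) (x : R) : ev (addL l m) x = ev l x + ev m x := by
  induction l generalizing m with
  | nil => simp [addL]
  | cons c l ih =>
    cases m with
    | nil => simp [addL]
    | cons d m => simp [addL, ih]; ring

/-- Multiplication by an integer. -/
def smulL (c : ℤ) (l : List ℤ) : List ℤ := l.map (c * ·)

@[simp] theorem ev_smulL (c : ℤ) (l : List ℤ) (x : R) : ev (smulL c l) x = c * ev l x := by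
  induction l with
  | nil => simp [smulL]
  | cons d l ih => simp only [smulL, List.map_cons, ev_cons] at ih ⊢; rw [ih]; push_cast; ring

/-- Multiplication by a power of the variable. -/
def shiftL (n : ℕ) (l : List ℤ) : List ℤ := List.replicate n 0 ++ l

@[simp] theorem ev_shiftL (n : ℕ) (l : List ℤ) (x : R) : ev (shiftL n l) x = x ^ n * ev l x := by
  induction n with
  | zero => simp [shiftL]
  | succ n ih =>
    have : shiftL (n + 1) l = 0 :: shiftL n l := by simp [shiftL, List.replicate_succ]
    rw [this, ev_cons, ih]; push_cast; ring

theorem ev_append (l m : List ℤ) (x : R) : ev (l ++ m) x = ev l x + x ^ l.length * ev m x := by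
  induction l with
  | nil => simp
  | cons c l ih => simp [ih]; ring

theorem ev_reverse {l : List ℤ} {x y : R} (hxy : x * y = 1) {n : ℕ} (hn : l.length = n + 1) :
    ev l.reverse x = x ^ n * ev l y := by
  have h : ∀ l : List ℤ, x ^ l.length * ev l y = x * ev l.reverse x := fun l => by
    induction l with
    | nil => simp
    | cons c l ih =>
      rw [List.reverse_cons, ev_append, List.length_cons, List.length_reverse, ev_cons, ev_cons,
        ev_nil]
      linear_combination ih + x ^ l.length * ev l y * hxy
  have h1 := h l
  rw [hn] at h1
  linear_combination (-(x ^ n * ev l y) + ev l.reverse x) * (-hxy) + y * (-h1)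

/-- Product of coefficient lists. -/
def convL : List ℤ → List ℤ → List ℤ
  | [], _ => []
  | c :: l, m => addL (smulL c m) (0 :: convL l m)

theorem ev_convL (l m : List ℤ) (x : R) : ev (convL l m) x = ev l x * ev m x := by
  induction l with
  | nil => simp [convL]
  | cons c l ih => simp [convL, ih]; ring

end Ring

/-- Sum of the absolute values of the coefficients. -/
def l1 (l : List ℤ) : ℕ := l.foldr (fun c s => c.natAbs + s) 0

@[simp] theorem l1_nil : l1 [] = 0 := rfl

@[simp] theorem l1_cons (c : ℤ) (l : List ℤ) : l1 (c :: l) = c.natAbs + l1 l := rfl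

theorem l1_addL_le (l m : List ℤ) : l1 (addL l m) ≤ l1 l + l1 m := by
  induction l generalizing m with
  | nil => simp [addL]
  | cons c l ih =>
    cases m with
    | nil => simp [addL]
    | cons d m =>
      have := ih m
      have := Int.natAbs_add_le c d
      simp only [addL, l1_cons]
      lia

theorem l1_smulL (c : ℤ) (l : List ℤ) : l1 (smulL c l) = c.natAbs * l1 l := by
  induction l with
  | nil => simp [smulL]
  | cons d l ih =>
    simp only [smulL, List.map_cons, l1_cons, Int.natAbs_mul] at ih ⊢
    rw [ih]; ring

theorem l1_convL_le (l m : List ℤ) : l1 (convL l m) ≤ l1 l * l1 m := by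
  induction l with
  | nil => simp [convL]
  | cons c l ih =>
    refine (l1_addL_le _ _).trans ?_
    rw [l1_smulL, l1_cons, l1_cons]
    simp only [Int.natAbs_zero, zero_add]
    linarith [add_mul c.natAbs (l1 l) (l1 m)]

theorem norm_ev_le (l : List ℤ) {x : ℂ} (hx : ‖x‖ = 1) : ‖ev l x‖ ≤ l1 l := by
  induction l with
  | nil => simp
  | cons c l ih =>
    rw [ev_cons, l1_cons, Nat.cast_add, Nat.cast_natAbs]
    refine (norm_add_le _ _).trans ?_
    rw [norm_mul, hx, one_mul, Complex.norm_intCast, Int.cast_abs]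
    linarith

/-- A list of small integers is determined by its value at a large integer. -/
theorem ev_eq_zero_of_large {l : List ℤ} {N : ℕ} (hl : l1 l < N) (h : ev l (N : ℤ) = 0)
    {R : Type*} [CommRing R] (x : R) : ev l x = 0 := by
  induction l with
  | nil => simp
  | cons c l ih =>
    rw [l1_cons] at hl
    rw [ev_cons, Int.cast_id] at h
    have hc : c = 0 := by
      have hd : (N : ℤ) ∣ c := ⟨-ev l (N : ℤ), by linarith⟩
      exact Int.eq_zero_of_abs_lt_dvd hd (by rw [Int.abs_eq_natAbs]; lia)
    subst hc
    have hN : (N : ℤ) ≠ 0 := by lia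
    have h2 : ev l (N : ℤ) = 0 := by
      rw [zero_add] at h
      exact (mul_eq_zero.mp h).resolve_left hN
    rw [ev_cons, ih (by lia) h2]
    simp

/-- Evaluation at an integer. -/
def packL (x : ℤ) (l : List ℤ) : ℤ := l.foldr (fun c r => c + x * r) 0

theorem packL_eq_ev (x : ℤ) (l : List ℤ) : packL x l = ev l x := rfl

/-- Evaluation of pairs of consecutive coefficients. -/
def pairL (x : ℤ) : List ℤ → List ℤ
  | [] => []
  | [c] => [c]
  | c :: d :: l => (c + x * d) :: pairL x l

theorem ev_pairL (x : ℤ) (l : List ℤ) : ev (pairL x l) (x * x) = ev l x := by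
  induction l using pairL.induct with
  | case1 => rfl
  | case2 c => simp [pairL]
  | case3 c d l ih => simp [pairL, ih]; ring

/-- Evaluation at an integer by `k` steps of bisection. -/
def packF : ℕ → ℤ → List ℤ → ℤ
  | 0, x, l => packL x l
  | k + 1, x, l => packF k (x * x) (pairL x l)

theorem packF_eq_ev (k : ℕ) (x : ℤ) (l : List ℤ) : packF k x l = ev l x := by
  induction k generalizing x l with
  | zero => rfl
  | succ k ih => rw [packF, ih, ev_pairL]

/-- Sums of pairs of consecutive terms. -/
def pairSum : List ℕ → List ℕ
  | [] => []
  | [c] => [c]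
  | c :: d :: l => (c + d) :: pairSum l

theorem sum_pairSum (l : List ℕ) : (pairSum l).sum = l.sum := by
  induction l using pairSum.induct with
  | case1 => rfl
  | case2 c => rfl
  | case3 c d l ih => simp [pairSum, ih]; ring

/-- Sum by `k` steps of bisection. -/
def sumF : ℕ → List ℕ → ℕ
  | 0, l => l.sum
  | k + 1, l => sumF k (pairSum l)

theorem sumF_eq_sum (k : ℕ) (l : List ℕ) : sumF k l = l.sum := by
  induction k generalizing l with
  | zero => rfl
  | succ k ih => rw [sumF, ih, sum_pairSum]

/-- Sum of the absolute values of the coefficients, by bisection. -/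
def l1F (l : List ℤ) : ℕ := sumF 12 (l.map Int.natAbs)

theorem l1F_eq_l1 (l : List ℤ) : l1F l = l1 l := by
  rw [l1F, sumF_eq_sum]
  induction l with
  | nil => rfl
  | cons c l ih => simp [ih]

/-- Products of coefficient lists can be certified at one large integer. -/
def isMul (N : ℕ) (a b c : List ℤ) : Bool :=
  decide (packF 12 N a * packF 12 N b = packF 12 N c) && Nat.blt (l1F a * l1F b + l1F c) N

theorem ev_mul_of_isMul {N : ℕ} {a b c : List ℤ} (h : isMul N a b c = true) {R : Type*} [CommRing R]
    (x : R) : ev a x * ev b x = ev c x := by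
  rw [isMul, Bool.and_eq_true, decide_eq_true_iff, Nat.blt_eq] at h
  simp only [packF_eq_ev, l1F_eq_l1] at h
  have h1 : l1 (addL (convL a b) (smulL (-1) c)) < N := by
    refine ((l1_addL_le _ _).trans (add_le_add (l1_convL_le a b) ?_)).trans_lt h.2
    rw [l1_smulL]
    simp
  have := ev_eq_zero_of_large h1 (by simp [ev_convL, h.1]) x
  rw [ev_addL, ev_convL, ev_smulL] at this
  push_cast at this
  linear_combination this

/-- Digits in base `N`, diminished by `h`. -/
def digitsL (N h : ℕ) : ℕ → ℕ → List ℤ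
  | 0, _ => []
  | n + 1, v => Int.subNatNat (v % N) h :: digitsL N h n (v / N)

/-- Product of coefficient lists, by multiplication of integers. -/
def mulL (N : ℕ) (a b : List ℤ) : List ℤ :=
  digitsL N (N / 2) (a.length + b.length) (packF 12 N a * packF 12 N b
    + (N / 2 * ((N ^ (a.length + b.length) - 1) / (N - 1)) : ℕ)).toNat

/-- Coefficients of the Euler derivative, the first exponent being `k`. -/
def eulerL (k : ℕ) : List ℤ → List ℤ
  | [] => []
  | c :: l => ((k : ℤ) * c) :: eulerL (k + 1) l

theorem length_eulerL (k : ℕ) (l : List ℤ) : (eulerL k l).length = l.length := by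
  induction l generalizing k with
  | nil => rfl
  | cons c l ih => simp [eulerL, ih]

theorem ev_eulerL_succ {R : Type*} [CommRing R] (k : ℕ) (l : List ℤ) (x : R) :
    ev (eulerL (k + 1) l) x = ev (eulerL k l) x + ev l x := by
  induction l generalizing k with
  | nil => simp [eulerL]
  | cons c l ih => simp [eulerL, ih]; ring

theorem hasDerivAt_ev (l : List ℤ) {f : ℝ → ℂ} {t : ℝ}
    (hf : HasDerivAt f (Complex.I * f t) t) :
    HasDerivAt (fun t => ev l (f t)) (Complex.I * ev (eulerL 0 l) (f t)) t := by
  induction l with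
  | nil => simpa [eulerL] using hasDerivAt_const t (0 : ℂ)
  | cons c l ih =>
    have h := ((hf.fun_mul ih).const_add (c : ℂ))
    simp only [ev_cons]
    refine h.congr_deriv ?_
    rw [eulerL, ev_cons, ev_eulerL_succ]
    push_cast
    ring

theorem continuous_ev (l : List ℤ) : Continuous fun x : ℂ => ev l x := by
  induction l with
  | nil => simpa using continuous_const
  | cons c l ih => simp only [ev_cons]; fun_prop

theorem ev_conj (l : List ℤ) (x : ℂ) : ev l ((starRingEnd ℂ) x) = (starRingEnd ℂ) (ev l x) := by
  induction l with
  | nil => simp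
  | cons c l ih => simp [ih]

theorem ev_reverse_conj {l : List ℤ} {x : ℂ} (hx : ‖x‖ = 1) {n : ℕ} (hn : l.length = n + 1) :
    ev l.reverse x = x ^ n * (starRingEnd ℂ) (ev l x) := by
  rw [← ev_conj]
  exact ev_reverse (by rw [Complex.mul_conj, Complex.normSq_eq_norm_sq, hx]; norm_num) hn

/-- A table approximating the geometric progression `c, c w, c w ^ 2, …`. -/
def IsTable (w : ℂ) (δ : ℝ) : ℂ → List (ℤ × ℤ) → Prop
  | _, [] => True
  | c, z :: l => ‖(z.1 : ℂ) + Complex.I * z.2 - c‖ ≤ δ ∧ IsTable w δ (c * w) l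

/-- Coefficientwise product with the real parts of a table. -/
def mulReL (l : List ℤ) (t : List (ℤ × ℤ)) : List ℤ := List.zipWith (fun c z => c * z.1) l t

/-- Coefficientwise product with the imaginary parts of a table. -/
def mulImL (l : List ℤ) (t : List (ℤ × ℤ)) : List ℤ := List.zipWith (fun c z => c * z.2) l t

theorem norm_rotate_sub_le {w : ℂ} {δ : ℝ} {c : ℂ} {t : List (ℤ × ℤ)} (ht : IsTable w δ c t)
    {l : List ℤ} (hl : l.length ≤ t.length) {x : ℂ} (hx : ‖x‖ = 1) :
    ‖c * ev l (x * w) - (ev (mulReL l t) x + Complex.I * ev (mulImL l t) x)‖ ≤ δ * l1 l := by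
  induction l generalizing c t with
  | nil => simp [mulReL, mulImL]
  | cons d l ih =>
    cases t with
    | nil => simp at hl
    | cons z t =>
      have h1 := ih ht.2 (by simpa using hl)
      have h2 : c * ev (d :: l) (x * w) - (ev (mulReL (d :: l) (z :: t)) x
          + Complex.I * ev (mulImL (d :: l) (z :: t)) x)
          = x * (c * w * ev l (x * w) - (ev (mulReL l t) x + Complex.I * ev (mulImL l t) x))
            - d * ((z.1 : ℂ) + Complex.I * z.2 - c) := by
        simp only [mulReL, mulImL, List.zipWith_cons_cons, ev_cons]
        push_cast
        ring
      rw [h2, l1_cons, Nat.cast_add, Nat.cast_natAbs]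
      refine (norm_sub_le _ _).trans ?_
      rw [norm_mul, hx, one_mul, norm_mul, Complex.norm_intCast, Int.cast_abs]
      have := mul_le_mul_of_nonneg_left ht.1 (abs_nonneg (d : ℝ))
      linarith

/-- The conjugate table. -/
def conjT (t : List (ℤ × ℤ)) : List (ℤ × ℤ) := t.map fun z => (z.1, -z.2)

theorem IsTable.conj {w : ℂ} {δ : ℝ} {c : ℂ} {t : List (ℤ × ℤ)} (ht : IsTable w δ c t) :
    IsTable ((starRingEnd ℂ) w) δ ((starRingEnd ℂ) c) (conjT t) := by
  induction t generalizing c with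
  | nil => trivial
  | cons z t ih =>
    refine ⟨?_, by simpa [conjT] using ih ht.2⟩
    rw [← Complex.norm_conj]
    simpa [mul_comm] using ht.1

theorem mulReL_conjT (l : List ℤ) (t : List (ℤ × ℤ)) : mulReL l (conjT t) = mulReL l t := by
  simp [mulReL, conjT, List.zipWith_map_right]

theorem ev_mulImL_conjT {R : Type*} [CommRing R] (l : List ℤ) (t : List (ℤ × ℤ)) (x : R) :
    ev (mulImL l (conjT t)) x = -ev (mulImL l t) x := by
  induction l generalizing t with
  | nil => simp [mulImL]
  | cons c l ih =>
    cases t with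
    | nil => simp [mulImL, conjT]
    | cons z t =>
      have := ih t
      simp only [mulImL, conjT, List.map_cons, List.zipWith_cons_cons, ev_cons] at this ⊢
      rw [this]
      push_cast
      ring

/-- Prepend the conjugates of the entries of a table. -/
def reflectT : List (ℤ × ℤ) → List (ℤ × ℤ) → List (ℤ × ℤ)
  | [], acc => acc
  | z :: l, acc => reflectT l ((z.1, -z.2) :: acc)

theorem isTable_reflectT {w : ℂ} {δ : ℝ} (hw : ‖w‖ = 1) {c : ℂ} {t acc : List (ℤ × ℤ)}
    (ht : IsTable w δ c t) (hacc : IsTable w δ ((starRingEnd ℂ) c * w) acc) :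
    IsTable w δ ((starRingEnd ℂ) c * w * ((starRingEnd ℂ) w) ^ t.length) (reflectT t acc) := by
  have hww : (starRingEnd ℂ) w * w = 1 := by
    rw [mul_comm, Complex.mul_conj, Complex.normSq_eq_norm_sq, hw]; norm_num
  induction t generalizing c acc with
  | nil => simpa [reflectT] using hacc
  | cons z t ih =>
    have h1 : (starRingEnd ℂ) (c * w) * w = (starRingEnd ℂ) c := by
      rw [map_mul, mul_assoc, hww, mul_one]
    have h2 : IsTable w δ ((starRingEnd ℂ) (c * w) * w) ((z.1, -z.2) :: acc) := by
      rw [h1]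
      refine ⟨?_, hacc⟩
      rw [← Complex.norm_conj]
      simpa [mul_comm] using ht.1
    have h3 := ih ht.2 h2
    rw [h1] at h3
    rw [List.length_cons, pow_succ]
    change IsTable w δ _ (reflectT t ((z.1, -z.2) :: acc))
    convert h3 using 1
    linear_combination (starRingEnd ℂ) c * (starRingEnd ℂ) w ^ t.length * hww

/-- Fixed-point approximations of successive powers of a unit complex number. -/
def rotT (c₁ s₁ : ℤ) : ℕ → ℤ → ℤ → List (ℤ × ℤ)
  | 0, _, _ => []
  | n + 1, c, s => (c, s) ::
      rotT c₁ s₁ n ((c * c₁ - s * s₁) / 2 ^ 64) ((c * s₁ + s * c₁) / 2 ^ 64)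

theorem length_rotT (c₁ s₁ : ℤ) (n : ℕ) (c s : ℤ) : (rotT c₁ s₁ n c s).length = n := by
  induction n generalizing c s with
  | zero => rfl
  | succ n ih => simp [rotT, ih]

theorem abs_ediv_sub_le (m : ℤ) : |((m / 2 ^ 64 : ℤ) : ℝ) - m / 2 ^ 64| ≤ 1 := by
  have h1 := Int.emod_add_mul_ediv m (2 ^ 64)
  have h2 := Int.emod_nonneg m (b := 2 ^ 64) (by norm_num)
  have h3 := Int.emod_lt_of_pos m (b := 2 ^ 64) (by norm_num)
  generalize m / 2 ^ 64 = q at h1 ⊢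
  generalize m % 2 ^ 64 = r at h1 h2 h3
  have h4 : (r : ℝ) + 2 ^ 64 * q = m := by exact_mod_cast h1
  have h5 : (0 : ℝ) ≤ r := by exact_mod_cast h2
  have h6 : (r : ℝ) < 2 ^ 64 := by exact_mod_cast h3
  rw [abs_le]
  constructor
  · rw [← h4]; field_simp; linarith
  · rw [← h4]; field_simp; linarith

theorem isTable_rotT {w : ℂ} (hw : ‖w‖ = 1) {c₁ s₁ : ℤ}
    (h₁ : ‖(c₁ : ℂ) + Complex.I * s₁ - 2 ^ 64 * w‖ ≤ 2) {δ : ℝ} (hδ : δ ≤ 2 ^ 64) (n : ℕ)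
    {C : ℂ} (hC : ‖C‖ = 2 ^ 64) {c s : ℤ}
    (h : ‖(c : ℂ) + Complex.I * s - C‖ ≤ δ - 6 * n) : IsTable w δ C (rotT c₁ s₁ n c s) := by
  induction n generalizing C c s with
  | zero => trivial
  | succ n ih =>
    have hle : ‖(c : ℂ) + Complex.I * s - C‖ ≤ δ := by
      refine h.trans ?_
      have : (0 : ℝ) ≤ (n + 1 : ℕ) := by positivity
      linarith
    refine ⟨hle, ih (by rw [norm_mul, hC, hw, mul_one]) ?_⟩
    set z : ℂ := (c : ℂ) + Complex.I * s with hz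
    set e₁ : ℝ := (((c * c₁ - s * s₁) / 2 ^ 64 : ℤ) : ℝ) - ((c * c₁ - s * s₁ : ℤ) : ℝ) / 2 ^ 64
      with he₁
    set e₂ : ℝ := (((c * s₁ + s * c₁) / 2 ^ 64 : ℤ) : ℝ) - ((c * s₁ + s * c₁ : ℤ) : ℝ) / 2 ^ 64
      with he₂
    have hb₁ : |e₁| ≤ 1 := abs_ediv_sub_le _
    have hb₂ : |e₂| ≤ 1 := abs_ediv_sub_le _
    have key : ((((c * c₁ - s * s₁) / 2 ^ 64 : ℤ) : ℂ)
        + Complex.I * (((c * s₁ + s * c₁) / 2 ^ 64 : ℤ) : ℂ) - C * w)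
        = z * ((c₁ : ℂ) + Complex.I * s₁ - 2 ^ 64 * w) / 2 ^ 64 + (z - C) * w
          + ((e₁ : ℂ) + Complex.I * e₂) := by
      rw [he₁, he₂, hz]
      push_cast
      linear_combination (-(s : ℂ) * s₁ / 2 ^ 64) * Complex.I_sq
    rw [key]
    have hzn : ‖z‖ ≤ 2 * 2 ^ 64 := by
      calc ‖z‖ = ‖(z - C) + C‖ := by rw [sub_add_cancel]
        _ ≤ ‖z - C‖ + ‖C‖ := norm_add_le _ _
        _ ≤ 2 * 2 ^ 64 := by rw [hC]; linarith
    have h2 : ‖z * ((c₁ : ℂ) + Complex.I * s₁ - 2 ^ 64 * w) / 2 ^ 64‖ ≤ 4 := by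
      rw [norm_div, norm_mul, norm_pow, Complex.norm_ofNat, div_le_iff₀ (by positivity)]
      calc _ ≤ (2 * 2 ^ 64) * (2 : ℝ) := by gcongr
        _ = _ := by norm_num
    have h3 : ‖(e₁ : ℂ) + Complex.I * e₂‖ ≤ 2 := by
      refine (norm_add_le _ _).trans ?_
      rw [norm_mul, Complex.norm_I, one_mul, Complex.norm_real, Complex.norm_real]
      simp only [Real.norm_eq_abs]
      linarith
    have h4 : ‖(z - C) * w‖ ≤ δ - 6 * (n + 1 : ℕ) := by rwa [norm_mul, hw, mul_one]
    calc _ ≤ 4 + (δ - 6 * (n + 1 : ℕ)) + 2 :=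
          (norm_add_le _ _).trans (add_le_add ((norm_add_le _ _).trans (add_le_add h2 h4)) h3)
      _ = δ - 6 * n := by push_cast; ring

/-- Taylor polynomials of the exponential on the imaginary axis. -/
theorem sum_range_two_mul_I_mul_pow (y : ℝ) (k : ℕ) :
    ∑ m ∈ Finset.range (2 * k), (Complex.I * y) ^ m / (m.factorial : ℂ)
      = ((∑ j ∈ Finset.range k, (-1) ^ j * y ^ (2 * j) / ((2 * j).factorial : ℝ) : ℝ) : ℂ)
        + Complex.I * ((∑ j ∈ Finset.range k,
          (-1) ^ j * y ^ (2 * j + 1) / ((2 * j + 1).factorial : ℝ) : ℝ) : ℂ) := by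
  induction k with
  | zero => simp
  | succ k ih =>
    rw [show 2 * (k + 1) = 2 * k + 1 + 1 by ring, Finset.sum_range_succ, Finset.sum_range_succ, ih,
      Finset.sum_range_succ, Finset.sum_range_succ, mul_pow, mul_pow, pow_succ Complex.I, pow_mul,
      Complex.I_sq]
    push_cast
    ring

theorem norm_rotation_sub_le {ω : ℝ} (hω : ω = (√5 - 1) / 2) :
    ‖((-13602054981829108552 : ℤ) : ℂ) + Complex.I * ((-12460596582517082391 : ℤ) : ℂ)
      - 2 ^ 64 * Complex.exp (Complex.I * (2 * Real.pi * ω : ℝ))‖ ≤ 2 := by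
  have h5 : |√5 - 2.236067977499789696409| ≤ 1 / 10 ^ 20 := by
    rw [abs_le]
    constructor
    · have : (2.23606797749978969640 : ℝ) ≤ √5 := Real.le_sqrt_of_sq_le (by norm_num)
      linarith
    · have : √5 ≤ (2.23606797749978969641 : ℝ) := by
        rw [Real.sqrt_le_left (by norm_num)]; norm_num
      linarith
  have hφ : |2 * Real.pi * (ω - 1) - (-2.399963229728653322231)| ≤ 7 / 10 ^ 20 := by
    have h1 := Real.pi_gt_d20
    have h2 := Real.pi_lt_d20
    rw [abs_le] at h5
    subst hω
    rw [abs_le]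
    constructor <;> nlinarith
  obtain ⟨y, hy⟩ : ∃ y : ℝ, y = -2.399963229728653322231 := ⟨_, rfl⟩
  rw [← hy] at hφ
  have hexp : Complex.exp (Complex.I * (2 * Real.pi * ω : ℝ))
      = Complex.exp (Complex.I * (2 * Real.pi * (ω - 1) : ℝ)) := by
    rw [← Complex.exp_periodic (Complex.I * (2 * Real.pi * (ω - 1) : ℝ))]
    congr 1
    push_cast
    ring
  have hexp2 : Complex.exp (Complex.I * (2 * Real.pi * (ω - 1) : ℝ)) = Complex.exp (Complex.I * y)
      * Complex.exp (Complex.I * ((2 * Real.pi * (ω - 1) - y : ℝ))) := by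
    rw [← Complex.exp_add]
    congr 1
    push_cast
    ring
  have e1 : ‖Complex.exp (Complex.I * (2 * Real.pi * ω : ℝ)) - Complex.exp (Complex.I * y)‖
      ≤ 7 / 10 ^ 20 := by
    rw [hexp, hexp2, ← mul_sub_one, norm_mul, Complex.norm_exp_I_mul_ofReal, one_mul]
    exact Real.norm_exp_I_mul_ofReal_sub_one_le.trans hφ
  have e2 := Complex.exp_bound' (x := Complex.I * y) (n := 2 * 16) (by
    rw [norm_mul, Complex.norm_I, one_mul, Complex.norm_real, hy]; norm_num)
  rw [sum_range_two_mul_I_mul_pow, norm_mul, Complex.norm_I, one_mul, Complex.norm_real] at e2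
  obtain ⟨u, hu⟩ : ∃ u : ℝ, u = ∑ j ∈ Finset.range 16,
    (-1) ^ j * y ^ (2 * j) / ((2 * j).factorial : ℝ) := ⟨_, rfl⟩
  obtain ⟨v, hv⟩ : ∃ v : ℝ, v = ∑ j ∈ Finset.range 16,
    (-1) ^ j * y ^ (2 * j + 1) / ((2 * j + 1).factorial : ℝ) := ⟨_, rfl⟩
  rw [← hu, ← hv] at e2
  have hu2 : |-13602054981829108552 - 2 ^ 64 * u| ≤ 1 / 4 := by
    rw [hu, hy]
    norm_num [Finset.sum_range_succ, Nat.factorial, abs_le]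
  have hv2 : |-12460596582517082391 - 2 ^ 64 * v| ≤ 3 / 10 := by
    rw [hv, hy]
    norm_num [Finset.sum_range_succ, Nat.factorial, abs_le]
  have e3 : ‖y‖ ^ (2 * 16) / ((2 * 16).factorial : ℝ) * 2 ≤ 1 / 10 ^ 22 := by
    rw [hy]; norm_num [Nat.factorial]
  have key : ((-13602054981829108552 : ℤ) : ℂ) + Complex.I * ((-12460596582517082391 : ℤ) : ℂ)
      - 2 ^ 64 * Complex.exp (Complex.I * (2 * Real.pi * ω : ℝ))
      = (((-13602054981829108552 - 2 ^ 64 * u : ℝ)) : ℂ)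
        + Complex.I * ((-12460596582517082391 - 2 ^ 64 * v : ℝ) : ℂ)
        - 2 ^ 64 * (Complex.exp (Complex.I * y) - (u + Complex.I * v))
        - 2 ^ 64 * (Complex.exp (Complex.I * (2 * Real.pi * ω : ℝ))
          - Complex.exp (Complex.I * y)) := by
    push_cast
    ring
  rw [key]
  refine (norm_sub_le _ _).trans ((add_le_add ((norm_sub_le _ _).trans (add_le_add
    ((norm_add_le _ _).trans (add_le_add le_rfl le_rfl)) le_rfl)) le_rfl).trans ?_)
  rw [norm_mul, norm_mul, norm_mul, norm_pow, Complex.norm_ofNat, Complex.norm_I,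
    Complex.norm_real, Complex.norm_real, Real.norm_eq_abs, Real.norm_eq_abs]
  refine (add_le_add (add_le_add (add_le_add hu2 (mul_le_mul_of_nonneg_left hv2 zero_le_one))
    (mul_le_mul_of_nonneg_left (e2.trans e3) (by positivity)))
    (mul_le_mul_of_nonneg_left e1 (by positivity))).trans ?_
  norm_num

/-- Coefficients of `a + conj d` on the unit circle, multiplied by the `n`-th power of the
variable. -/
def glueL (n : ℕ) (a d : List ℤ) : List ℤ := addL (shiftL n a) d.reverse

theorem ev_glueL {n : ℕ} (a : List ℤ) {d : List ℤ} (hd : d.length = n + 1) {x : ℂ} (hx : ‖x‖ = 1) :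
    ev (glueL n a d) x = x ^ n * (ev a x + (starRingEnd ℂ) (ev d x)) := by
  rw [glueL, ev_addL, ev_shiftL, ev_reverse_conj hx hd]
  ring

/-- Defect of the differential equation satisfied by the exponential of an imaginary function. -/
def phaseDefect (σ N K : ℕ) (a d c : List ℤ) : List ℤ :=
  addL (smulL (2 * σ) (shiftL N (glueL K (eulerL 0 a) (smulL (-1) (eulerL 0 d))))) (smulL (-1) c)

theorem ev_one_complex (l : List ℤ) : ev l (1 : ℂ) = (packL 1 l : ℤ) := by
  rw [packL_eq_ev]
  induction l with
  | nil => simp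
  | cons c l ih => simp [ih]

theorem norm_phase_sub_exp_le {σ N K : ℕ} (hσ : 0 < σ) {b a d c : List ℤ}
    (hb : b.length = N + 1) (hd : d.length = K + 1) {B : ℕ}
    (hc : isMul B (glueL N (eulerL 0 b) (eulerL 0 b)) (glueL K a d) c = true)
    {x : ℂ} (hx : ‖x‖ = 1) :
    ‖(ev a x + (starRingEnd ℂ) (ev d x)) / (2 * σ)
      - Complex.exp (Complex.I * ((ev b x).im / σ : ℝ))‖
      ≤ (packL 1 a + packL 1 d - 2 * σ).natAbs / (2 * σ)
        + Real.pi * (l1 (phaseDefect σ N K a d c) / (2 * σ) ^ 2) := by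
  have hσ' : (0 : ℝ) < σ := by exact_mod_cast hσ
  have hσc : (σ : ℂ) ≠ 0 := by exact_mod_cast hσ.ne'
  set X : ℝ → ℂ := fun t => Complex.exp (Complex.I * t) with hX
  have hX1 : ∀ t, ‖X t‖ = 1 := fun t => Complex.norm_exp_I_mul_ofReal t
  have hXd : ∀ t, HasDerivAt X (Complex.I * X t) t := fun t => by
    have := ((Complex.ofRealCLM.hasDerivAt (x := t)).const_mul Complex.I).cexp
    simpa [hX, mul_comm] using this
  set v : ℝ → ℝ := fun t => (ev b (X t)).im / σ with hv
  set Z : ℝ → ℂ := fun t => (ev a (X t) + (starRingEnd ℂ) (ev d (X t))) / (2 * σ) with hZ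
  have hvd : ∀ t, HasDerivAt v ((ev (eulerL 0 b) (X t)).re / σ) t := fun t => by
    have := (Complex.imCLM.hasFDerivAt.comp_hasDerivAt t (hasDerivAt_ev b (hXd t))).div_const
      (σ : ℝ)
    simpa using this
  have hZd : ∀ t, HasDerivAt Z ((Complex.I * ev (eulerL 0 a) (X t)
      + (starRingEnd ℂ) (Complex.I * ev (eulerL 0 d) (X t))) / (2 * σ)) t := fun t =>
    ((hasDerivAt_ev a (hXd t)).fun_add (hasDerivAt_ev d (hXd t)).star).div_const _
  have hgd : ∀ t, HasDerivAt (fun t => Z t * Complex.exp (-(Complex.I * v t))) _ t := fun t =>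
    (hZd t).mul (((hvd t).ofReal_comp.const_mul Complex.I).fun_neg.cexp)
  have hbound : ∀ t, ‖deriv (fun t => Z t * Complex.exp (-(Complex.I * v t))) t‖
      ≤ l1 (phaseDefect σ N K a d c) / (2 * σ) ^ 2 := fun t => by
    rw [(hgd t).deriv]
    have hev : ev (phaseDefect σ N K a d c) (X t) = (2 * σ) * (X t ^ N * (X t ^ K *
        (ev (eulerL 0 a) (X t) - (starRingEnd ℂ) (ev (eulerL 0 d) (X t)))))
        - X t ^ N * (2 * (ev (eulerL 0 b) (X t)).re) * (X t ^ K * ((2 * σ) * Z t)) := by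
      rw [phaseDefect, ev_addL, ev_smulL, ev_smulL, ev_shiftL, ← ev_mul_of_isMul hc,
        ev_glueL _ (by simpa [smulL, length_eulerL] using hd) (hX1 t),
        ev_glueL _ (by simpa [length_eulerL] using hb) (hX1 t), ev_glueL _ hd (hX1 t),
        Complex.add_conj, hZ, ev_smulL]
      push_cast
      rw [mul_div_cancel₀ _ (by simpa using hσc)]
      simp
      ring
    have h1 := norm_ev_le (phaseDefect σ N K a d c) (hX1 t)
    have h2 : (Complex.I * ev (eulerL 0 a) (X t)
        + (starRingEnd ℂ) (Complex.I * ev (eulerL 0 d) (X t))) / (2 * σ)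
          * Complex.exp (-(Complex.I * v t)) + Z t * (Complex.exp (-(Complex.I * v t))
          * -(Complex.I * ((((ev (eulerL 0 b) (X t)).re / σ : ℝ)) : ℂ)))
        = ev (phaseDefect σ N K a d c) (X t) * (Complex.I * Complex.exp (Complex.I * (-v t : ℝ)))
          / (X t ^ (N + K) * (2 * σ) ^ 2) := by
      have hXn : X t ^ (N + K) ≠ 0 := pow_ne_zero _ (Complex.exp_ne_zero _)
      rw [hev, eq_div_iff (mul_ne_zero hXn (pow_ne_zero 2 (mul_ne_zero two_ne_zero hσc))), map_mul,
        Complex.conj_I,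
        show Complex.I * ((-v t : ℝ) : ℂ) = -(Complex.I * v t) by push_cast; ring]
      push_cast
      field_simp
      ring
    rw [h2, norm_div, norm_mul, norm_mul, norm_mul, norm_pow, hX1, Complex.norm_I,
      Complex.norm_exp_I_mul_ofReal, norm_pow, norm_mul, Complex.norm_natCast, Complex.norm_ofNat]
    simp only [one_pow, mul_one, one_mul]
    gcongr
  have hx' : x = X x.arg := by
    have := Complex.norm_mul_exp_arg_mul_I x
    rw [hx, Complex.ofReal_one, one_mul, mul_comm] at this
    exact this.symm
  have hmv := Convex.norm_image_sub_le_of_norm_deriv_le (s := Set.univ) (x := 0) (y := x.arg)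
    (fun t _ => (hgd t).differentiableAt) (fun t _ => hbound t) convex_univ trivial trivial
  have hX0 : X 0 = 1 := by simp [hX]
  have hv0 : v 0 = 0 := by simp [hv, hX0, ev_one_complex]
  have hZ0 : ‖Z 0 - 1‖ ≤ (packL 1 a + packL 1 d - 2 * σ).natAbs / (2 * σ) := by
    have h1 : Z 0 - 1 = ((packL 1 a + packL 1 d - 2 * σ : ℤ) : ℂ) / (2 * σ) := by
      simp only [hZ, hX0, ev_one_complex]
      simp
      field_simp
    rw [h1, norm_div, Complex.norm_intCast, norm_mul, Complex.norm_natCast, Complex.norm_ofNat,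
      ← Int.cast_abs, ← Nat.cast_natAbs]
  have harg : ‖x.arg - 0‖ ≤ Real.pi := by rw [sub_zero]; exact Complex.abs_arg_le_pi x
  have h3 : (ev a x + (starRingEnd ℂ) (ev d x)) / (2 * σ)
      - Complex.exp (Complex.I * ((ev b x).im / σ : ℝ))
      = Complex.exp (Complex.I * v x.arg) * ((Z x.arg * Complex.exp (-(Complex.I * v x.arg))
        - Z 0 * Complex.exp (-(Complex.I * v 0))) + (Z 0 - 1)) := by
    have h4 : Complex.exp (Complex.I * v x.arg) * Complex.exp (-(Complex.I * v x.arg)) = 1 := by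
      rw [← Complex.exp_add]; simp
    have h5 : (ev a x + (starRingEnd ℂ) (ev d x)) / (2 * σ) = Z x.arg := by
      simp only [hZ, ← hx']
    have h6 : (ev b x).im / σ = v x.arg := by simp only [hv, ← hx']
    rw [h5, h6, hv0]
    simp only [Complex.ofReal_zero, mul_zero, neg_zero, Complex.exp_zero]
    linear_combination -Z x.arg * h4
  rw [h3, norm_mul, Complex.norm_exp_I_mul_ofReal, one_mul]
  refine (norm_add_le _ _).trans ?_
  have h7 := mul_le_mul_of_nonneg_left harg
    (by positivity : (0 : ℝ) ≤ l1 (phaseDefect σ N K a d c) / (2 * σ) ^ 2)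
  linarith

/-- Scaled defect of the invariance equation. -/
def torusDefect (τ : ℕ) (φ : ℤ) (b a d : List ℤ) (t : List (ℤ × ℤ)) : List ℤ :=
  addL (smulL τ (addL (smulL 40 b) (smulL 13 (addL a (smulL (-1) d)))))
    (addL (smulL (-40) (mulReL b t)) [0, -φ])

theorem abs_torusDefect_le {σ τ : ℕ} (hσ : 0 < σ) (hτ : 0 < τ) {b a d : List ℤ}
    {t : List (ℤ × ℤ)} {w : ℂ} {δ : ℝ} (ht : IsTable w δ τ t) (hbt : b.length ≤ t.length)
    {x : ℂ} (hx : ‖x‖ = 1) {η : ℝ}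
    (hη : ‖(ev a x + (starRingEnd ℂ) (ev d x)) / (2 * σ)
      - Complex.exp (Complex.I * ((ev b x).im / σ : ℝ))‖ ≤ η) (A : ℝ) (φ : ℤ) :
    |2 * ((ev b x).im / σ) + 1.3 * Real.sin ((ev b x).im / σ) - (ev b (x * w)).im / σ
      - (ev b (x * (starRingEnd ℂ) w)).im / σ - A * x.im|
      ≤ (l1 (torusDefect τ φ b a d t) + 40 * δ * l1 b + |φ - 20 * σ * τ * A|) / (20 * σ * τ)
        + 1.3 * η := by
  have hσ' : (0 : ℝ) < σ := by exact_mod_cast hσ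
  have hτ' : (0 : ℝ) < τ := by exact_mod_cast hτ
  have hσc : (σ : ℂ) ≠ 0 := by exact_mod_cast hσ.ne'
  have e1 := norm_rotate_sub_le ht hbt hx
  have e2 := norm_rotate_sub_le ht.conj (l := b) (by simpa [conjT] using hbt) hx
  rw [mulReL_conjT, ev_mulImL_conjT, Complex.conj_natCast] at e2
  have e3 := norm_ev_le (torusDefect τ φ b a d t) hx
  have hev : ev (torusDefect τ φ b a d t) x = τ * (40 * ev b x + 13 * (ev a x - ev d x))
      - 40 * ev (mulReL b t) x - φ * x := by
    simp only [torusDefect, ev_addL, ev_smulL, ev_cons, ev_nil]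
    push_cast
    ring
  set Z := (ev a x + (starRingEnd ℂ) (ev d x)) / (2 * σ) with hZ
  have hZim : (ev a x - ev d x).im = 2 * σ * Z.im := by
    have h1 : ev a x + (starRingEnd ℂ) (ev d x) = ((2 * σ : ℝ) : ℂ) * Z := by
      rw [hZ]; push_cast; field_simp
    have h2 := congrArg Complex.im h1
    rw [Complex.im_ofReal_mul] at h2
    simpa [sub_eq_add_neg] using h2
  have e4 : |Z.im - Real.sin ((ev b x).im / σ)| ≤ η := by
    have h1 := (Complex.abs_im_le_norm _).trans hη
    rwa [Complex.sub_im, mul_comm Complex.I, Complex.exp_ofReal_mul_I_im] at h1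
  have e1' := (Complex.abs_im_le_norm _).trans e1
  have e2' := (Complex.abs_im_le_norm _).trans e2
  have e3' := (Complex.abs_im_le_norm _).trans e3
  have e5 : |(φ - 20 * σ * τ * A) * x.im| ≤ |φ - 20 * σ * τ * A| := by
    rw [abs_mul]
    exact mul_le_of_le_one_right (abs_nonneg _) (hx ▸ Complex.abs_im_le_norm x)
  simp only [Complex.sub_im, Complex.add_im, Complex.I_mul_im, mul_neg,
    Complex.neg_im, ← Complex.ofReal_natCast, Complex.im_ofReal_mul] at e1' e2'
  rw [hev] at e3'
  have hev2 : (τ * (40 * ev b x + 13 * (ev a x - ev d x)) - 40 * ev (mulReL b t) x - φ * x).im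
      = τ * (40 * (ev b x).im + 13 * (2 * σ * Z.im)) - 40 * (ev (mulReL b t) x).im - φ * x.im := by
    rw [← hZim]
    simp
  rw [hev2] at e3'
  have key : 2 * ((ev b x).im / σ) + 1.3 * Real.sin ((ev b x).im / σ) - (ev b (x * w)).im / σ
      - (ev b (x * (starRingEnd ℂ) w)).im / σ - A * x.im
      = ((τ * (40 * (ev b x).im + 13 * (2 * σ * Z.im)) - 40 * (ev (mulReL b t) x).im - φ * x.im)
        - 20 * (τ * (ev b (x * w)).im - ((ev (mulReL b t) x).im + (ev (mulImL b t) x).re))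
        - 20 * (τ * (ev b (x * (starRingEnd ℂ) w)).im
          - ((ev (mulReL b t) x).im + -(ev (mulImL b t) x).re))
        + (φ - 20 * σ * τ * A) * x.im) / (20 * σ * τ)
        - 1.3 * (Z.im - Real.sin ((ev b x).im / σ)) := by
    field_simp
    ring
  rw [key]
  refine (abs_sub _ _).trans (add_le_add ?_ ?_)
  · rw [abs_div, abs_of_pos (by positivity : (0 : ℝ) < 20 * σ * τ)]
    gcongr
    rw [abs_le] at *
    constructor <;> linarith [e1'.1, e1'.2, e2'.1, e2'.2, e3'.1, e3'.2, e5.1, e5.2]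
  · rw [abs_mul, abs_of_pos (by norm_num : (0 : ℝ) < 1.3)]
    gcongr

/-- Real part of the scaled defect of the weight. -/
def weightDefectRe (σ τ den n K : ℕ) (P₁ P₂ E₁ : List ℤ) (T : List (ℤ × ℤ)) : List ℤ :=
  addL (smulL (1487000 * τ) E₁) (addL (smulL (-40 * σ) (shiftL K (addL (smulL 3211169 (mulReL P₁ T))
    (smulL (-1211169) (mulImL P₂ T))))) (shiftL (K + n) [-den]))

/-- Imaginary part of the scaled defect of the weight. -/
def weightDefectIm (σ τ K : ℕ) (P₁ P₂ E₂ : List ℤ) (T : List (ℤ × ℤ)) : List ℤ :=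
  addL (smulL (1487000 * τ) E₂) (smulL (-40 * σ) (shiftL K (addL (smulL 1211169 (mulImL P₁ T))
    (smulL 3211169 (mulReL P₂ T)))))

/-- Scaled coefficients of the approximate potential. -/
def potL (σ K : ℕ) (a d : List ℤ) : List ℤ :=
  addL (smulL 13 (glueL K (addL a d) (addL a d))) (shiftL K [80 * σ])

/-- A nonnegative trigonometric polynomial, given by a spectral factor. -/
noncomputable def weight (μ : ℝ) (A B : List ℤ) (x : ℂ) : ℝ :=
  Complex.normSq (ev A x + Complex.I * ev B x) / μ

theorem weight_nonneg {μ : ℝ} (hμ : 0 < μ) (A B : List ℤ) (x : ℂ) : 0 ≤ weight μ A B x :=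
  div_nonneg (Complex.normSq_nonneg _) hμ.le

theorem length_addL {l m : List ℤ} (h : l.length = m.length) : (addL l m).length = l.length := by
  induction l generalizing m with
  | nil => simpa [addL] using h.symm
  | cons c l ih =>
    cases m with
    | nil => simp at h
    | cons d m => simpa [addL] using ih (by simpa using h)

section Weight

variable {μ : ℝ} {A B c₁ c₂ c₃ c₄ : List ℤ} {n N : ℕ}

theorem ev_weight (hμ : 0 < μ) (hA : A.length = n + 1) (hB : B.length = n + 1)
    (h₁ : isMul N A A.reverse c₁ = true) (h₂ : isMul N B B.reverse c₂ = true)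
    (h₃ : isMul N B A.reverse c₃ = true) (h₄ : isMul N A B.reverse c₄ = true)
    {x : ℂ} (hx : ‖x‖ = 1) :
    ev (addL c₁ c₂) x + Complex.I * ev (addL c₃ (smulL (-1) c₄)) x
      = x ^ n * (μ * weight μ A B x : ℝ) := by
  have hμc : μ ≠ 0 := hμ.ne'
  rw [weight, mul_div_cancel₀ _ hμc, Complex.normSq_eq_conj_mul_self]
  simp only [ev_addL, ev_smulL, ← ev_mul_of_isMul h₁, ← ev_mul_of_isMul h₂, ← ev_mul_of_isMul h₃,
    ← ev_mul_of_isMul h₄, ev_reverse_conj hx hA, ev_reverse_conj hx hB]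
  simp only [map_add, map_mul, Complex.conj_I]
  push_cast
  linear_combination (x ^ n * ev B x * (starRingEnd ℂ) (ev B x)) * Complex.I_sq

theorem weight_le (hμ : 0 < μ) {Q₁ Q₂ : List ℤ} {x : ℂ} (hx : ‖x‖ = 1)
    (hQ : ev Q₁ x + Complex.I * ev Q₂ x = x ^ n * (μ * weight μ A B x : ℝ)) {M : ℝ}
    (hM : ((l1 Q₁ + l1 Q₂ : ℕ) : ℝ) ≤ M * μ) :
    weight μ A B x ≤ M := by
  have h1 : ‖ev Q₁ x + Complex.I * ev Q₂ x‖ ≤ (l1 Q₁ + l1 Q₂ : ℕ) := by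
    refine (norm_add_le _ _).trans ?_
    rw [norm_mul, Complex.norm_I, one_mul, Nat.cast_add]
    exact add_le_add (norm_ev_le _ hx) (norm_ev_le _ hx)
  rw [hQ, norm_mul, norm_pow, hx, one_pow, one_mul, Complex.norm_real, Real.norm_eq_abs] at h1
  have h2 := (le_abs_self _).trans (h1.trans hM)
  rw [mul_comm] at h2
  exact le_of_mul_le_mul_right h2 hμ

theorem norm_rotate_weight_sub_le {τ : ℕ} {w : ℂ} (hw : ‖w‖ = 1) {δ : ℝ} {T : List (ℤ × ℤ)}
    (hT : IsTable w δ (τ * (starRingEnd ℂ) w ^ n) T) {Q₁ Q₂ : List ℤ} (hQ₁ : Q₁.length ≤ T.length)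
    (hQ₂ : Q₂.length ≤ T.length)
    (hQ : ∀ x : ℂ, ‖x‖ = 1 →
      ev Q₁ x + Complex.I * ev Q₂ x = x ^ n * (μ * weight μ A B x : ℝ)) {x : ℂ} (hx : ‖x‖ = 1) :
    ‖τ * (x ^ n * (μ * weight μ A B (x * w) : ℝ)) - ((ev (mulReL Q₁ T) x - ev (mulImL Q₂ T) x)
      + Complex.I * (ev (mulImL Q₁ T) x + ev (mulReL Q₂ T) x))‖ ≤ δ * (l1 Q₁ + l1 Q₂ : ℕ) := by
  have hww : (starRingEnd ℂ) w ^ n * w ^ n = 1 := by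
    rw [← mul_pow, mul_comm, Complex.mul_conj, Complex.normSq_eq_norm_sq, hw]; norm_num
  have e1 := norm_rotate_sub_le hT hQ₁ hx
  have e2 := norm_rotate_sub_le hT hQ₂ hx
  have h := hQ (x * w) (by rw [norm_mul, hx, hw, one_mul])
  have key : τ * (x ^ n * (μ * weight μ A B (x * w) : ℝ))
      - ((ev (mulReL Q₁ T) x - ev (mulImL Q₂ T) x)
        + Complex.I * (ev (mulImL Q₁ T) x + ev (mulReL Q₂ T) x))
      = (τ * (starRingEnd ℂ) w ^ n * ev Q₁ (x * w)
          - (ev (mulReL Q₁ T) x + Complex.I * ev (mulImL Q₁ T) x))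
        + Complex.I * (τ * (starRingEnd ℂ) w ^ n * ev Q₂ (x * w)
          - (ev (mulReL Q₂ T) x + Complex.I * ev (mulImL Q₂ T) x)) := by
    rw [mul_pow] at h
    linear_combination (-(τ : ℂ) * (starRingEnd ℂ) w ^ n) * h
      - (τ : ℂ) * x ^ n * (μ * weight μ A B (x * w) : ℝ) * hww
      + ev (mulImL Q₂ T) x * Complex.I_sq
  rw [key]
  refine (norm_add_le _ _).trans ?_
  rw [norm_mul, Complex.norm_I, one_mul, Nat.cast_add, mul_add]
  exact add_le_add e1 e2

theorem weight_expansion (hμ : 0 < μ) {σ τ K den δ : ℕ} (hσ : 0 < σ) (hτ : 0 < τ) {w : ℂ}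
    (hw : ‖w‖ = 1) {T : List (ℤ × ℤ)} (hT : IsTable w δ (τ * (starRingEnd ℂ) w ^ n) T)
    {Q₁ Q₂ E₁ E₂ a d : List ℤ} (hQ₁ : Q₁.length ≤ T.length) (hQ₂ : Q₂.length ≤ T.length)
    (hQ : ∀ x : ℂ, ‖x‖ = 1 →
      ev Q₁ x + Complex.I * ev Q₂ x = x ^ n * (μ * weight μ A B x : ℝ))
    (ha : a.length = K + 1) (hd : d.length = K + 1)
    (hE₁ : isMul N (potL σ K a d) Q₁ E₁ = true) (hE₂ : isMul N (potL σ K a d) Q₂ E₂ = true)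
    (hden : (den : ℝ) = 1487000 * (40 * σ) * τ * μ)
    (hr : 4 * (l1 (weightDefectRe σ τ den n K Q₁ Q₂ E₁ T) + l1 (weightDefectIm σ τ K Q₁ Q₂ E₂ T)
      + 40 * σ * 3211169 * δ * (l1 Q₁ + l1 Q₂)) ≤ den)
    {x : ℂ} (hx : ‖x‖ = 1) :
    1.487 * weight μ A B (x * w) + 1.487⁻¹ * weight μ A B (x * (starRingEnd ℂ) w) + 3 / 4
      ≤ (2 + 1.3 * ((ev a x + (starRingEnd ℂ) (ev d x)) / (2 * σ)).re) * weight μ A B x := by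
  have hσ' : (0 : ℝ) < σ := by exact_mod_cast hσ
  have hτ' : (0 : ℝ) < τ := by exact_mod_cast hτ
  have hden0 : (0 : ℝ) < den := by rw [hden]; positivity
  have e1 := norm_rotate_weight_sub_le hw hT hQ₁ hQ₂ hQ hx
  have e2 := norm_rotate_weight_sub_le (w := (starRingEnd ℂ) w) (T := conjT T) (τ := τ) (δ := δ)
    (by rw [Complex.norm_conj, hw]) (by simpa using hT.conj) (by simpa [conjT] using hQ₁)
    (by simpa [conjT] using hQ₂) hQ hx
  rw [mulReL_conjT, ev_mulImL_conjT, mulReL_conjT, ev_mulImL_conjT] at e2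
  set V := ((ev a x + (starRingEnd ℂ) (ev d x)) / (2 * σ)).re with hV
  have hpot : ev (potL σ K a d) x = x ^ K * ((40 * σ * (2 + 1.3 * V) : ℝ) : ℂ) := by
    rw [potL, ev_addL, ev_smulL, ev_shiftL,
      ev_glueL _ (by rw [length_addL (ha.trans hd.symm), ha]) hx, Complex.add_conj, ev_addL]
    have h1 : 2 * σ * V = (ev a x + ev d x).re := by
      rw [hV, show (2 * σ : ℂ) = ((2 * σ : ℝ) : ℂ) by push_cast; rfl, Complex.div_ofReal_re]
      field_simp
      simp
    rw [← h1]
    simp only [ev_cons, ev_nil]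
    push_cast
    ring
  set G := (2 + 1.3 * V) * weight μ A B x - 1.487 * weight μ A B (x * w)
    - 1.487⁻¹ * weight μ A B (x * (starRingEnd ℂ) w) - 1 with hG
  have e3 := norm_ev_le (weightDefectRe σ τ den n K Q₁ Q₂ E₁ T) hx
  have e4 := norm_ev_le (weightDefectIm σ τ K Q₁ Q₂ E₂ T) hx
  have key : (den * G : ℝ) * x ^ (K + n) = (ev (weightDefectRe σ τ den n K Q₁ Q₂ E₁ T) x
      + Complex.I * ev (weightDefectIm σ τ K Q₁ Q₂ E₂ T) x)
      - (1487000 * 1.487 * 40 * σ : ℝ) * x ^ K * (τ * (x ^ n * (μ * weight μ A B (x * w) : ℝ))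
        - ((ev (mulReL Q₁ T) x - ev (mulImL Q₂ T) x)
          + Complex.I * (ev (mulImL Q₁ T) x + ev (mulReL Q₂ T) x)))
      - (1487000 * 1.487⁻¹ * 40 * σ : ℝ) * x ^ K
        * (τ * (x ^ n * (μ * weight μ A B (x * (starRingEnd ℂ) w) : ℝ))
        - ((ev (mulReL Q₁ T) x - -ev (mulImL Q₂ T) x)
          + Complex.I * (-ev (mulImL Q₁ T) x + ev (mulReL Q₂ T) x))) := by
    have h1 := hQ x hx
    simp only [weightDefectRe, weightDefectIm, ev_addL, ev_smulL, ev_shiftL, ev_cons, ev_nil,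
      ← ev_mul_of_isMul hE₁, ← ev_mul_of_isMul hE₂, hpot, hG]
    have hdc : (den : ℂ) = 1487000 * (40 * σ) * τ * μ := by exact_mod_cast hden
    push_cast
    rw [hdc]
    push_cast at h1
    rw [pow_add]
    linear_combination (1487000 * (40 * σ) * τ * (2 + 1.3 * V) * x ^ K : ℂ) * (-h1)
  have e5 : den * |G| ≤ den / 4 := by
    have h1 := congrArg norm key
    rw [norm_mul, Complex.norm_real, norm_pow, hx, one_pow, mul_one, Real.norm_eq_abs, abs_mul,
      abs_of_pos hden0] at h1
    have h2 : ((4 * (l1 (weightDefectRe σ τ den n K Q₁ Q₂ E₁ T)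
        + l1 (weightDefectIm σ τ K Q₁ Q₂ E₂ T)
        + 40 * σ * 3211169 * δ * (l1 Q₁ + l1 Q₂)) : ℕ) : ℝ) ≤ den := by exact_mod_cast hr
    have scale : ∀ (c : ℝ) (z : ℂ), 0 ≤ c → ‖z‖ ≤ δ * (l1 Q₁ + l1 Q₂ : ℕ) →
        ‖(c : ℂ) * x ^ K * z‖ ≤ c * (δ * (l1 Q₁ + l1 Q₂ : ℕ)) := fun c z hc hz => by
      rw [norm_mul, norm_mul, norm_pow, hx, one_pow, mul_one, Complex.norm_real, Real.norm_eq_abs,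
        abs_of_nonneg hc]
      gcongr
    have h3 := scale (1487000 * 1.487 * 40 * σ) _ (by positivity) e1
    have h4 := scale (1487000 * 1.487⁻¹ * 40 * σ) _ (by positivity) e2
    have h5 : ‖ev (weightDefectRe σ τ den n K Q₁ Q₂ E₁ T) x
        + Complex.I * ev (weightDefectIm σ τ K Q₁ Q₂ E₂ T) x‖
        ≤ l1 (weightDefectRe σ τ den n K Q₁ Q₂ E₁ T) + l1 (weightDefectIm σ τ K Q₁ Q₂ E₂ T) := by
      refine (norm_add_le _ _).trans (add_le_add e3 ?_)
      rwa [norm_mul, Complex.norm_I, one_mul]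
    rw [h1]
    refine (norm_sub_le_of_le (norm_sub_le_of_le h5 h3) h4).trans ?_
    push_cast at h2 ⊢
    linarith
  have e6 : |G| ≤ 1 / 4 := by
    have : den * |G| ≤ den * (1 / 4) := by linarith
    exact le_of_mul_le_mul_left this hden0
  have := (abs_le.mp e6).1
  linarith

end Weight

/-- Sine coefficients of odd order of the approximate torus, scaled by `2 ^ 64`, in zigzag
encoding. -/
def sineCoeffs : List ℕ := [
  68363982387495972920, 12046199229035985749, 8073280087229948144, 1498479548896846333,
  546523151080547922, 838097212658256243, 1582367925955153536, 410219300904892731,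
  166426915869593700, 249451497357016511, 671748232683117650, 229065108351644863,
  75406517585192348, 77816806501540583, 195183841495983704, 106859839412687217, 32125456939169034,
  26082924737685735, 58507054864651418, 60780059521706989, 17958071547899708, 12713473669186327,
  28136613084738810, 55082236094852669, 16061979718704698, 8684024295133035, 16322535667435876,
  45844458138285707, 15234559465063602, 5762748524958349, 7071264103963666, 19420632994966383,
  9726702109951348, 3172103748380539, 2895257117674678, 6984666099156251, 6439116271450236,
  2017940424830585, 1577627424322670, 3668556556847835, 6450323505550458, 1937347692412003,
  1187622861601344, 2465591283214155, 6689150594513056, 2127131300788365, 881528236702340,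
  1223611097066657, 3510349507852112, 1578817548539139, 535744027106542, 526383347015443,
  1323576946863596, 1058852166086283, 341096424187004, 282437114285897, 670956695571570,
  1034074555457731, 317794834403904, 214165854310289, 474093140694788, 1205186697490057,
  371386867715058, 169275908254001, 264329261060718, 776797604359167, 315642422806994,
  111081616377771, 117248405498708, 305955913703071, 211955846989310, 69534549660147,
  60243416529832, 145198510458117, 193704715981178, 60777262563377, 44147878907626,
  101852675538329, 237136973016262, 71972422459411, 36352741769862, 63507599943679,
  187500988693616, 69654982171603, 25588706398476, 29236688837555, 79153601905234, 47687774474277,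
  15883316007698, 14356592719885, 35115728088146, 40265770241909, 12868337923452, 9923513589953,
  23481636023146, 49135933794291, 14904286958364, 8360292029123, 16139543692562, 46822693114603,
  16139437461774, 6260914951649, 7828641734842, 21960260465535, 11595342990956, 3922840311009,
  3707105198974, 9234047478033, 9072293164442, 2944554002885, 2382909473912, 5721590514291,
  10589036579974, 3243348495939, 2008553252768, 4205712782489, 11708552918318, 3808743277919,
  1583186059220, 2190351931241, 6336088796060, 2962306518549, 1021655139426, 1015414150349,
  2588385119400, 2179482728303, 716346730204, 603593406003, 1461902676544, 2361198769959,
  734257124230, 495965023209, 1102947041474, 2879206999027, 900316071336, 407200420075,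
  628038899118, 1855577224407, 777624343210, 275264496247, 290391354788, 761373326719,
  551327561594, 183163357883, 160087998064, 390585586291, 545049899564, 172373931713, 125188454018,
  290034439891, 695160210202, 212843741821, 106059978974, 182450956175, 542311619040, 206564954095,
  75790486184, 85859649395, 232432142702, 145639174833, 48891483610, 44327463697, 109201260016,
  130805674627, 42045635924, 32395453281, 77006480374, 166357716075, 50691296312, 27988080189,
  53247717876, 156081750759, 54878328900, 21138352009, 26049551678, 72898382415, 39861390290,
  13542972901, 12778955782, 31931042511, 32726528940, 10670089369, 8625247310, 20808464759,
  39866556836, 12234138417, 7461043378, 15443992795, 43641298478, 14409007701, 5915882178,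
  8030576709, 23169091978, 11172883471, 3856983946, 3811649109, 9714521658, 8518603485, 2810035958,
  2364046741, 5750459674, 9636830525, 2998366140, 1998642281, 4410873528, 11742706871, 3708872846,
  1649431571, 2489661676, 7348497387, 3163917134, 1117265595, 1167142294, 3051537287, 2296372450,
  764985219, 666934250, 1632316933, 2367131310, 748610455, 537905080, 1241110379, 3047080408,
  938147671, 458246290, 771304597, 2297951174, 895672219, 326660226, 364941297, 983404482,
  638788925, 214798296, 193971877, 478536150, 596150309, 191610820, 146403315, 347527758,
  772074509, 235716296, 127447419, 237762316, 701765281, 251437452, 95890371, 116076006, 323094235,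
  182639382, 62069575, 58219582, 145396921, 154993026, 50540289, 40587786, 97957099, 193674274,
  59407113, 35520962, 72384421, 207026628, 69347957, 28071342, 37303357, 107098164, 53225451,
  18345508, 17976731, 45699510, 41652995, 13744736, 11500037, 28006636, 48575773, 15088868,
  9887699, 21581064, 58451563, 18644588, 8142085, 12004564, 35326825, 15622238, 5495093, 5674724,
  14771691, 11538890, 3845089, 3334554, 8169089, 12286870]

/-- Fourier coefficients of the exponential of the approximate torus, scaled by `2 ^ 64`, in zigzag
encoding. -/
def phaseCoeffs : List ℕ := [
  12744787619641692604, 37347147170785630958, 28975730697672080876, 7256651524610599028,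
  8623832981649319517, 1940626564809513037, 3839546749832698342, 3367906614419573444,
  2850928958461939, 1617999072474281933, 72604956827690498, 903489600112953112, 863540695626971099,
  56780781089985381, 756780492884456660, 712210563435444238, 13744607913104279, 511864172525077301,
  1200371724639564, 401498496479887970, 317295940778383743, 9229394174341189, 350016398603168050,
  275060899575467616, 31373072493814433, 226531941911015627, 11116264080932083, 165936687743415386,
  62731053728053295, 34475641003009729, 99749950480069994, 75486162374507758, 20122422106744053,
  88499365693694583, 7467941586883793, 67377384957124180, 8293367292160297, 29533896215460349,
  34323167419367154, 19023275753690110, 16651830052435585, 42342524479236391, 3781310980580223,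
  36960733909740406, 1870180109725561, 26966015071821267, 27718926149589458, 3761459426470896,
  22834534192676159, 29898816264793421, 1046632028448067, 26617512877030628, 129131822891389,
  24196445934123123, 21961986173936590, 92014436225054, 22964014967179863, 20199148194359365,
  1250482699128488, 17505761774453776, 936477240256418, 14235856527899677, 6892389581182498,
  2372934535918716, 9748101179429473, 7937835540620653, 1440281470039984, 8972068925221424,
  799621372632090, 7198734420348961, 1215826212724396, 2893334494233608, 3787511746330905,
  2536772452050133, 1466094214481576, 4969309262064870, 496591687418862, 4487625988840949,
  283658502984698, 3091595601085468, 3214845334367909, 714257289096323, 2420121254194490,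
  3844771936993936, 222554483586970, 3615350891397309, 73705513739000, 3342473003330112,
  3279193033113319, 5128887755005, 3255659005692408, 3089460974617614, 100518345366205,
  2698454562904471, 121982334863433, 2313546384581658, 1375447878768595, 271743658083993,
  1765018535641636, 1469410931939268, 202582267184717, 1550037954159497, 132267873106923,
  1254426907820716, 282293437358539, 438589318068571, 680752419508336, 511166773379730,
  206548668952311, 873535888746285, 90520480003343, 783185031852590, 60940372301219,
  491013592845567, 515818888459272, 168477031731402, 347154782375051, 668830194985809,
  50077961827235, 645279007580864, 22470619285191, 583205018171103, 598519128711570,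
  12084135963516, 564050327527231, 586615003000553, 4073570255448, 520367071823524, 17092745759220,
  466779603916421, 329822495451668, 33103237617428, 391661247066723, 331257259101445,
  35416390471072, 327558269147468, 25847312233674, 266629210276573, 78307044214066, 78549683673506,
  152941804129811, 122671003469169, 36037025626934, 184432195308462, 19129353423274,
  162231686632931, 15857576481708, 90952719480790, 98149319619335, 43489011252993, 57363666425000,
  134972595498996, 11867192868582, 131194896408907, 6103429459042, 112725952044594,
  118210062205077, 7048647670743, 105208119914262, 122811091696852, 2049903572350, 111841281136123,
  1946996627997, 104120590224370, 84683112839823, 3381110923179, 94354545075674, 81606087482672,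
  6620221069461, 76631524321473, 5431464135253, 63150655717290, 23729924661501, 15106969053347,
  39192207083270, 32490282291846, 7194487044261, 43459817697873, 4394948425137, 37399434277858,
  4710823306897, 18513788292139, 21185970058022, 11881255319498, 10397225789161, 30012725491167,
  2920347010649, 28983156408966, 1630711554275, 23160154770943, 24436399177548, 2934583140272,
  20333341546979, 27305464298197, 1041743758893, 25653844047580, 2835056701, 24409512951403,
  22117470233970, 179446213410, 23324395374273, 20919725845155, 1196622352996, 18975133541598,
  1165181042554, 15983435015363, 7521762352306, 2946622527402, 10896389219417, 9157086480079,
  1576905704778, 11030340283444, 1063670991026, 9304283406323, 1532290239310, 4016321779642,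
  5093874363839, 3394130924503, 2030240304792, 7179968981352, 740970720644, 6815493408729,
  449309844604, 4975689698080, 5244896801649, 1057012147273, 4016952009544, 6343148817292,
  362146968294, 6126215126557, 108414078000, 5826965162862, 5697818871959, 1309892625,
  5711047664552, 5417755531698, 182029515709, 4839050641237, 243585791485, 4205271387532,
  2420297536477, 551825849217, 3165049211390, 2675680789782, 365433593787, 2941101564097,
  265228790571, 2445151901794, 527082477891, 906471931825, 1342942230728, 1005005336442,
  423243344113, 1818332282223, 192624707423, 1684407323902, 131337202241, 1107429228651,
  1169776621466, 353572856968, 806745983275, 1524741939281, 111756935411, 1498444501398,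
  49703120225, 1389290532477, 1424688480054, 19855415388, 1357203766251, 1395048691933,
  13980835380, 1250902899062, 46583823586, 1127673587471, 773043741732, 92623255734, 932245431681,
  794033302777, 86115577226, 808326790566, 66897976252, 667981057899, 186887535006, 208298154154,
  381641069187, 306250523811, 93747144358, 481987945086, 51028055860, 434247971469, 41369385838,
  254173823212, 273305262729, 113995874749, 164977794110, 378143581942, 32702087716, 373356019343,
  17010762304, 329377447532, 346096389837, 16780424615, 311995623348, 356830860230, 4611987206,
  326337964049, 7080534583, 304589547364, 241535562411, 12421395411, 272660014300, 235999072952,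
  19835710003, 226218148579, 16805033425, 187802629782, 67215481939, 47786702077, 114974475712,
  95619125036, 22009248301, 132844273807, 13729155819, 116424575654, 14040046643, 60064755613,
  67729199402, 36315535366, 34609659063, 96975214863, 9344378185, 95034439760, 5278402141,
  78117900543, 82731025606, 8604437490, 69938653177, 91372672987, 3137413627, 85961851720,
  350570772, 82130514945, 73012597318, 974283828, 77902492811, 69508293341, 4241175636,
  63904274640, 4132536878, 53920821273, 24230969378, 10694772008, 36073819779, 30439758081,
  5438136126, 37849040512, 3738076602, 32368384767, 5056005538, 14562897946, 17966048579,
  11608803877, 7509662042, 25756219880, 2649366158, 24799899185, 1608868730, 18660918876,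
  19743706321, 3566402251, 15429135996, 23572348766, 1262437362, 22796177679, 318459432,
  21859224730, 21107078317, 1864909, 21395208870, 20065140360, 763188973, 18051521755, 968911927,
  15650912800, 8638415119, 2254943135, 11540629998, 9787704856, 1387575719, 11045512137,
  1022728559, 9272339132, 1889399249, 3589523271, 5101324312, 3747305656, 1694288801, 7068186421,
  750619879, 6637851740, 504075747, 4505704301, 4765040950, 1321105642, 3372603485, 6141712225,
  431349057, 6053865692, 183094721, 5686458427, 5792055894, 51064946, 5582703329, 5635596001,
  83346806, 5062529808, 206881166, 4543868335, 3003811364, 424625860, 3684847035, 3141547463,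
  355277854, 3266607496, 278449428, 2715021961, 718236048, 887724554, 1538167599, 1222987375,
  398819452, 1996711964, 213006460, 1821885899, 166821612, 1102526778, 1180211469, 459908591,
  736414736, 1621831492, 136314348, 1609648265, 69930426, 1445517866, 1515629353, 58292129,
  1384429848, 1544724392, 12604032, 1409884095, 36268153, 1310690888, 1008857655, 65155197,
  1155104380, 997386102, 88341853, 971577195, 74682389, 808131518, 274150273, 217174493, 486956020,
  403790748, 98251547, 579441381, 60628711, 513536794, 58863793, 274310487, 305197174, 155397508,
  162503065, 436924203, 41360661, 431298104, 23248817, 362386443, 384126444, 34192994, 329897221,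
  417903189, 12476345, 391725700, 3268872, 373866833, 324912662, 6480734, 350991491, 311051605,
  20436582, 289108066, 19487032, 243526915, 104131566, 51619002, 159648947, 134760581, 25292368,
  172376244, 17310340, 148787865, 21950854, 69442536, 83561393, 52041793, 36673282, 120740014,
  12304244, 117291525, 7415028, 90530924, 95982251, 15424963, 76499570, 112732164, 5580642,
  108694681, 1081432, 104617894, 99463855, 114633, 101999098, 94497268, 4067615, 85490595, 4838261,
  73773078, 38946225, 11575063, 53237450, 45187000, 6720483, 52243283, 4929905, 44156936, 8496333,
  17782729, 24350974, 17450724, 8552007, 34237925, 3614877, 32467650, 2411271, 22673189, 24030094,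
  6064556, 17450063, 30464297, 2009571, 30001034, 839837, 28448111, 28771472, 128170, 28074237,
  27748249, 611560, 24921852, 1035742, 22216473, 14252382, 2298930, 17822249, 15012975, 1939502,
  15860900, 1249204, 13191729, 3555626, 4444566, 7827015, 5741839, 2461000, 9625616, 613342,
  8641725, 1516600, 4993576, 7437609, 56942, 3462016, 6789698, 2566896, 2867567, 1762337, 1153134,
  1835348, 243927, 1253973, 451522, 730774, 686483, 575451, 414294, 741154, 114737, 625381, 174388,
  425934, 332835, 285529, 254086, 395068, 74239, 366951, 74202, 276368, 174683, 166839, 168554,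
  223264, 60977, 228809, 38266, 185648, 94679, 111055, 111430, 129386, 50477, 145567, 21872,
  124750, 48449, 79987, 70868, 74756, 41183, 93625, 14048, 84894, 24781, 60049, 46538, 44692,
  34665, 61455, 10964, 59104, 13089, 45639, 30454, 28976, 28319, 40147, 10056, 41272, 7343, 33877,
  18480, 20472, 20773, 25311, 8904, 28066, 4249, 24107, 9928, 15318, 13771, 15335, 7530, 18766,
  2721, 17009, 5222, 11888, 9335, 9415, 6612, 12748, 2123, 12239, 2868, 9380, 6471, 6181, 5760,
  8674, 1985, 8845, 1646, 7230, 4165, 4397, 4484, 5676, 1823, 6193, 954, 5290, 2321, 3313, 3056,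
  3522, 1567, 4209, 596, 3784, 1225, 2593, 2074, 2176, 1385, 2889, 450, 2752, 677, 2075, 1472,
  1424, 1247, 2003, 418, 2022, 391, 1637, 990, 1008, 1019, 1343, 396, 1444, 227, 1223, 574, 758,
  717, 849, 346, 994, 137, 883, 304, 592, 483, 527, 304, 684, 99, 643, 168, 478, 345, 341, 278,
  478, 89, 477, 96, 382, 239, 239, 238, 328, 87, 345, 56, 292, 145, 177, 174, 210, 77, 241, 34,
  212, 77, 139, 116, 132, 67, 165, 24, 154, 41, 111, 82, 84, 63, 115, 20, 114, 23, 89, 58, 58, 55,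
  79, 20, 84, 13, 69, 38, 42, 41, 53, 18, 60, 7, 51, 20, 34, 27, 33, 16, 40, 5, 37, 10, 26, 19, 21,
  14, 28, 3, 27, 6, 22, 13, 13, 14, 20, 3, 19, 4, 18, 9, 9, 10, 14, 3, 13, 2, 12, 5, 7, 8, 8, 3]

/-- Real parts of the Fourier coefficients of even positive order of a spectral factor of the
weight, scaled by `2 ^ 20`, in zigzag encoding. -/
def factorReCoeffs : List ℕ := [
  36875415, 8909370, 8051683, 23124616, 11111509, 2007358, 1798059, 6207388, 5763131, 941566,
  743715, 2655350, 3401771, 485608, 399623, 1925396, 4705789, 177946, 282219, 584276, 4253857,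
  997792, 209675, 188098, 1003749, 562352, 101073, 85490, 369829, 383922, 55903, 48510, 203541,
  385198, 36665, 39600, 82135, 753594, 172569, 35072, 30631, 178582, 100763, 17462, 16033, 73606,
  89075, 12382, 11775, 45722, 132741, 15490, 9989, 14226, 167431, 42652, 7635, 5496, 26201, 21864,
  3609, 3672, 15753, 27368, 3833, 4190, 15233, 74786, 8837, 3610, 7270, 60824, 26019, 2044, 2032,
  26517, 2885, 39, 249, 402, 6575, 674, 785, 3354, 9811, 1300, 1397, 6386, 35023, 3032, 1195, 1454,
  7083, 2276, 473, 410, 1935, 1510, 251, 224, 935, 1560, 193, 186, 785, 2912, 243, 146, 205, 1576,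
  445, 92, 75, 442, 299, 52, 47, 216, 343, 42, 41, 168, 637, 60, 31, 26, 315, 110, 19, 12, 71, 66,
  11, 10, 47, 90, 11, 12, 43, 214, 19, 6, 28, 13, 37, 2, 6, 41, 7, 0, 1, 8, 19, 2, 1]

/-- Imaginary parts of the Fourier coefficients of even positive order of a spectral factor of the
weight, scaled by `2 ^ 20`, in zigzag encoding. -/
def factorImCoeffs : List ℕ := [
  12158895, 390559, 3635474, 32692749, 2695838, 947591, 648850, 4105425, 1212439, 39473, 92753,
  402198, 4663197, 595904, 541341, 2101130, 16973951, 1872240, 418267, 205544, 1542228, 209640,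
  23259, 25666, 171182, 277000, 36475, 34362, 129167, 542670, 62557, 52016, 213635, 1403952,
  127855, 25136, 24798, 532095, 26772, 8319, 9624, 82177, 12207, 1590, 817, 4554, 59441, 5566,
  4217, 18288, 158705, 8432, 3642, 30151, 290340, 32553, 8216, 9055, 48990, 12235, 2462, 2747,
  12716, 3241, 2044, 2389, 12258, 4203, 8864, 11647, 50836, 417391, 49776, 12339, 11998, 43525,
  16242, 2891, 2622, 9263, 6232, 979, 734, 1831, 2663, 576, 545, 1604, 28115, 3864, 537, 263, 7380,
  627, 152, 157, 1224, 33, 8, 21, 38, 878, 117, 90, 377, 3746, 369, 40, 134, 2055, 228, 49, 54,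
  355, 64, 7, 14, 43, 89, 10, 3, 22, 447, 24, 16, 97, 984, 129, 30, 31, 162, 51, 8, 9, 40, 19, 6,
  7, 30, 5, 18, 23, 96, 859, 112, 25, 24, 89, 36, 5, 6, 17, 12, 1, 0]

/-- The integer with a given zigzag encoding. -/
def zigzag (n : ℕ) : ℤ := bif n.testBit 0 then Int.negSucc (n / 2) else Int.ofNat (n / 2)

/-- Coefficients of an odd polynomial. -/
def oddL : List ℤ → List ℤ
  | [] => []
  | c :: l => 0 :: c :: oddL l

/-- Change of sign of every second coefficient. -/
def altL : List ℤ → List ℤ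
  | [] => []
  | [c] => [c]
  | c :: d :: l => c :: -d :: altL l

/-- Coefficients of the approximate torus. -/
def sineL : List ℤ := oddL (sineCoeffs.map zigzag)

/-- Coefficients of positive order of the exponential of the approximate torus. -/
def phaseL : List ℤ := phaseCoeffs.map zigzag

/-- Coefficients of negative order of the exponential of the approximate torus. -/
def phaseNegL : List ℤ := altL phaseL

/-- Real parts of the coefficients of the spectral factor. -/
def factorReL : List ℤ :=
  (oddL (factorReCoeffs.map zigzag)).reverse ++ 152269059 :: oddL (factorReCoeffs.map zigzag)

/-- Imaginary parts of the coefficients of the spectral factor. -/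
def factorImL : List ℤ :=
  (smulL (-1) (oddL (factorImCoeffs.map zigzag))).reverse ++ 0 :: oddL (factorImCoeffs.map zigzag)

/-- Powers of the rotation, from the zeroth one. -/
def rotTable : List (ℤ × ℤ) := rotT (-13602054981829108552) (-12460596582517082391) 621 (2 ^ 64) 0

/-- Powers of the rotation, from the first one. -/
def rotTableSucc : List (ℤ × ℤ) :=
  rotT (-13602054981829108552) (-12460596582517082391) 621
    (-13602054981829108552) (-12460596582517082391)

/-- Powers of the rotation, positive and negative. -/
def rotTableSymm : List (ℤ × ℤ) := reflectT rotTable rotTableSucc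

/-- Base of the arithmetic certificates. -/
abbrev base : ℕ := 2 ^ 200

/-- Product in the differential equation of the exponential of the approximate torus. -/
def phaseProd : List ℤ :=
  mulL base (glueL 581 (eulerL 0 sineL) (eulerL 0 sineL)) (glueL 841 phaseL phaseNegL)

/-- Real parts of the coefficients of the weight. -/
def weightReL : List ℤ :=
  addL (mulL base factorReL factorReL.reverse) (mulL base factorImL factorImL.reverse)

/-- Imaginary parts of the coefficients of the weight. -/
def weightImL : List ℤ := addL (mulL base factorImL factorReL.reverse)
  (smulL (-1) (mulL base factorReL factorImL.reverse))

/-- Coefficients of the approximate potential. -/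
def potentialL : List ℤ := potL (2 ^ 64) 841 phaseL phaseNegL

theorem length_sineL : sineL.length = 582 := by decide +kernel

theorem length_phaseL : phaseL.length = 842 := by decide +kernel

theorem length_phaseNegL : phaseNegL.length = 842 := by decide +kernel

theorem l1_sineL : l1F sineL ≤ 3 * 2 ^ 64 := by decide +kernel

theorem isMul_phaseProd : isMul base (glueL 581 (eulerL 0 sineL) (eulerL 0 sineL))
    (glueL 841 phaseL phaseNegL) phaseProd = true := by
  decide +kernel

theorem l1_phaseDefect :
    10 ^ 14 * l1F (phaseDefect (2 ^ 64) 581 841 phaseL phaseNegL phaseProd) ≤ 2 ^ 130 := by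
  decide +kernel

theorem packL_phase :
    (packF 12 1 phaseL + packF 12 1 phaseNegL - 2 * (2 ^ 64 : ℕ)).natAbs ≤ 1000 := by
  decide +kernel

theorem l1_torusDefect :
    10 ^ 12 * l1F (torusDefect (2 ^ 64) 52775803138119278408336700662255236829986 sineL phaseL
      phaseNegL rotTable) ≤ 20 * 2 ^ 128 := by
  decide +kernel

theorem length_factorReL : factorReL.length = 621 := by decide +kernel

theorem length_factorImL : factorImL.length = 621 := by decide +kernel

theorem length_weightReL : weightReL.length = 1242 := by decide +kernel

theorem length_weightImL : weightImL.length = 1242 := by decide +kernel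

/-- Product of the potential and the real parts of the weight. -/
def potWeightReL : List ℤ := mulL base potentialL weightReL

/-- Product of the potential and the imaginary parts of the weight. -/
def potWeightImL : List ℤ := mulL base potentialL weightImL

theorem isMul_factorRe_factorRe : isMul base factorReL factorReL.reverse
    (mulL base factorReL factorReL.reverse) = true := by
  decide +kernel

theorem isMul_factorIm_factorIm : isMul base factorImL factorImL.reverse
    (mulL base factorImL factorImL.reverse) = true := by
  decide +kernel

theorem isMul_factorIm_factorRe : isMul base factorImL factorReL.reverse
    (mulL base factorImL factorReL.reverse) = true := by
  decide +kernel

theorem isMul_factorRe_factorIm : isMul base factorReL factorImL.reverse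
    (mulL base factorReL factorImL.reverse) = true := by
  decide +kernel

theorem isMul_potWeightReL : isMul base potentialL weightReL potWeightReL = true := by
  decide +kernel

theorem isMul_potWeightImL : isMul base potentialL weightImL potWeightImL = true := by
  decide +kernel

theorem l1_weight : l1F weightReL + l1F weightImL ≤ 107000 * 2 ^ 40 := by
  decide +kernel

/-- Common denominator of the defect of the weight. -/
def weightDen : ℕ := 1487000 * (40 * 2 ^ 64) * 2 ^ 64 * 2 ^ 40

theorem l1_weightDefectRe :
    7 * l1F (weightDefectRe (2 ^ 64) (2 ^ 64) weightDen 620 841 weightReL weightImL potWeightReL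
      rotTableSymm) ≤ weightDen := by
  decide +kernel

theorem l1_weightDefectIm :
    10 * l1F (weightDefectIm (2 ^ 64) (2 ^ 64) 841 weightReL weightImL potWeightImL rotTableSymm)
      ≤ weightDen := by
  decide +kernel

theorem isTable_rotTable {ω : ℝ} (hω : ω = (√5 - 1) / 2) :
    IsTable (Complex.exp (Complex.I * (2 * Real.pi * ω : ℝ))) 4096 ((2 ^ 64 : ℕ) : ℂ) rotTable :=
  isTable_rotT (Complex.norm_exp_I_mul_ofReal _) (norm_rotation_sub_le hω) (by norm_num) 621
    (by norm_num) (by norm_num)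

theorem isTable_rotTableSucc {ω : ℝ} (hω : ω = (√5 - 1) / 2) :
    IsTable (Complex.exp (Complex.I * (2 * Real.pi * ω : ℝ))) 4096
      ((2 ^ 64 : ℕ) * Complex.exp (Complex.I * (2 * Real.pi * ω : ℝ))) rotTableSucc :=
  isTable_rotT (Complex.norm_exp_I_mul_ofReal _) (norm_rotation_sub_le hω) (by norm_num) 621
    (by rw [norm_mul, Complex.norm_exp_I_mul_ofReal]; norm_num)
    (by
      rw [Nat.cast_pow, Nat.cast_ofNat]
      exact (norm_rotation_sub_le hω).trans (by norm_num))

attribute [irreducible] IsTable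

theorem isTable_rotTableSymm {ω : ℝ} (hω : ω = (√5 - 1) / 2) :
    IsTable (Complex.exp (Complex.I * (2 * Real.pi * ω : ℝ))) ((4096 : ℕ) : ℝ)
      ((2 ^ 64 : ℕ) * (starRingEnd ℂ) (Complex.exp (Complex.I * (2 * Real.pi * ω : ℝ))) ^ 620)
      rotTableSymm := by
  have hw : ‖Complex.exp (Complex.I * (2 * Real.pi * ω : ℝ))‖ = 1 :=
    Complex.norm_exp_I_mul_ofReal _
  have h1 := isTable_rotTable hω
  have h2 := isTable_rotTableSucc hω
  generalize Complex.exp (Complex.I * (2 * Real.pi * ω : ℝ)) = w at hw h1 h2 ⊢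
  have hww : w * (starRingEnd ℂ) w = 1 := by
    rw [Complex.mul_conj, Complex.normSq_eq_norm_sq, hw]; norm_num
  have h3 := isTable_reflectT hw h1 (acc := rotTableSucc)
    (by rwa [Complex.conj_natCast])
  rw [show rotTable.length = 620 + 1 from length_rotT _ _ _ _ _, Complex.conj_natCast] at h3
  rw [Nat.cast_ofNat, rotTableSymm]
  convert h3 using 1
  rw [pow_succ]
  linear_combination (-((2 ^ 64 : ℕ) : ℂ) * (starRingEnd ℂ) w ^ 620) * hww

theorem length_reflectT (t acc : List (ℤ × ℤ)) :
    (reflectT t acc).length = t.length + acc.length := by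
  induction t generalizing acc with
  | nil => simp [reflectT]
  | cons z t ih => rw [reflectT, ih, List.length_cons, List.length_cons]; ring

theorem length_rotTableSymm : rotTableSymm.length = 1242 := by
  rw [rotTableSymm, length_reflectT, rotTable, rotTableSucc, length_rotT, length_rotT]

theorem norm_phaseL_sub_exp_le {x : ℂ} (hx : ‖x‖ = 1) :
    ‖(ev phaseL x + (starRingEnd ℂ) (ev phaseNegL x)) / (2 * (2 ^ 64 : ℕ))
      - Complex.exp (Complex.I * ((ev sineL x).im / (2 ^ 64 : ℕ) : ℝ))‖ ≤ 1 / 10 ^ 13 := by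
  refine (norm_phase_sub_exp_le (by norm_num) length_sineL length_phaseNegL isMul_phaseProd
    hx).trans ?_
  have h1 := packL_phase
  have h2 := l1_phaseDefect
  rw [packF_eq_ev, packF_eq_ev, ← packL_eq_ev, ← packL_eq_ev] at h1
  rw [l1F_eq_l1] at h2
  generalize (packL 1 phaseL + packL 1 phaseNegL - 2 * (2 ^ 64 : ℕ)).natAbs = A at h1 ⊢
  generalize l1 (phaseDefect (2 ^ 64) 581 841 phaseL phaseNegL phaseProd) = B at h2 ⊢
  have h1' : (A : ℝ) ≤ 1000 := by exact_mod_cast h1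
  have h2' : (10 ^ 14 * B : ℝ) ≤ 2 ^ 130 := by exact_mod_cast h2
  have h3 : (B : ℝ) / (2 * (2 ^ 64 : ℕ)) ^ 2 ≤ 1 / 10 ^ 14 := by
    rw [div_le_iff₀ (by positivity)]
    norm_num at h2' ⊢
    linarith
  have h4 : (A : ℝ) / (2 * (2 ^ 64 : ℕ)) ≤ 1 / 10 ^ 16 := by
    rw [div_le_iff₀ (by positivity)]
    norm_num
    linarith
  have h5 := mul_le_mul Real.pi_le_four h3 (by positivity) (by norm_num)
  norm_num at h4 h5 ⊢
  linarith

theorem abs_forcing_sub_le :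
    |((52775803138119278408336700662255236829986 : ℤ) : ℝ)
      - 20 * (2 ^ 64 : ℕ) * (2 ^ 64 : ℕ) * (2 * Real.pi * 1.2342)| ≤ 2 ^ 74 := by
  have h1 := Real.pi_gt_d20
  have h2 := Real.pi_lt_d20
  rw [abs_le]
  constructor
  · norm_num at h1 h2 ⊢
    linarith
  · norm_num at h1 h2 ⊢
    linarith

theorem abs_sineL_defect_le {ω : ℝ} (hω : ω = (√5 - 1) / 2) {x w : ℂ}
    (hw : w = Complex.exp (Complex.I * (2 * Real.pi * ω : ℝ))) (hx : ‖x‖ = 1) :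
    |2 * ((ev sineL x).im / (2 ^ 64 : ℕ)) + 1.3 * Real.sin ((ev sineL x).im / (2 ^ 64 : ℕ))
      - (ev sineL (x * w)).im / (2 ^ 64 : ℕ)
      - (ev sineL (x * (starRingEnd ℂ) w)).im / (2 ^ 64 : ℕ) - 2 * Real.pi * 1.2342 * x.im|
      ≤ 1 / (16 * 1.3 * 107000 ^ 2) := by
  have ht := isTable_rotTable hω
  rw [← hw] at ht
  refine (abs_torusDefect_le (by norm_num) (by norm_num) ht
    (by rw [length_sineL, rotTable, length_rotT]; norm_num) hx (norm_phaseL_sub_exp_le hx) _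
    52775803138119278408336700662255236829986).trans ?_
  have h1 := l1_torusDefect
  have h2 := l1_sineL
  rw [l1F_eq_l1] at h1 h2
  have h3 := abs_forcing_sub_le
  generalize |((52775803138119278408336700662255236829986 : ℤ) : ℝ)
      - 20 * (2 ^ 64 : ℕ) * (2 ^ 64 : ℕ) * (2 * Real.pi * 1.2342)| = C at h3 ⊢
  generalize l1 sineL = A at h2 ⊢
  generalize l1 (torusDefect (2 ^ 64) 52775803138119278408336700662255236829986 sineL phaseL
      phaseNegL rotTable) = B at h1 ⊢
  have h1' : (10 ^ 12 * B : ℝ) ≤ 20 * 2 ^ 128 := by exact_mod_cast h1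
  have h2' : (A : ℝ) ≤ 3 * 2 ^ 64 := by exact_mod_cast h2
  have h4 : ((B : ℝ) + 40 * 4096 * A + C) / (20 * (2 ^ 64 : ℕ) * (2 ^ 64 : ℕ)) ≤ 11 / 10 ^ 13 := by
    rw [div_le_iff₀ (by positivity)]
    norm_num at h1' h3 ⊢
    linarith
  norm_num at h4 ⊢
  linarith

/-- The weight given by the tabulated spectral factor. -/
noncomputable def tableWeight (x : ℂ) : ℝ := weight (2 ^ 40) factorReL factorImL x

theorem ev_tableWeight {x : ℂ} (hx : ‖x‖ = 1) :
    ev weightReL x + Complex.I * ev weightImL x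
      = x ^ 620 * ((2 ^ 40 : ℝ) * tableWeight x : ℝ) :=
  ev_weight (by norm_num) length_factorReL length_factorImL isMul_factorRe_factorRe
    isMul_factorIm_factorIm isMul_factorIm_factorRe isMul_factorRe_factorIm hx

theorem tableWeight_nonneg (x : ℂ) : 0 ≤ tableWeight x :=
  weight_nonneg (by norm_num) _ _ _

theorem tableWeight_le {x : ℂ} (hx : ‖x‖ = 1) : tableWeight x ≤ 107000 :=
  weight_le (by norm_num) hx (ev_tableWeight hx) (by
    have h := l1_weight
    rw [l1F_eq_l1, l1F_eq_l1] at h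
    exact_mod_cast h)

theorem tableWeight_expansion {ω : ℝ} (hω : ω = (√5 - 1) / 2) {x w : ℂ}
    (hw : w = Complex.exp (Complex.I * (2 * Real.pi * ω : ℝ))) (hx : ‖x‖ = 1) :
    1.487 * tableWeight (x * w) + 1.487⁻¹ * tableWeight (x * (starRingEnd ℂ) w) + 1 / 2
      ≤ (2 + 1.3 * Real.cos ((ev sineL x).im / (2 ^ 64 : ℕ))) * tableWeight x := by
  have hT := isTable_rotTableSymm hω
  have hw1 : ‖w‖ = 1 := hw ▸ Complex.norm_exp_I_mul_ofReal _
  rw [← hw] at hT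
  have h1 := weight_expansion (n := 620) (K := 841) (den := weightDen) (μ := 2 ^ 40)
    (by norm_num) (by norm_num) (by norm_num) hw1 hT
    (by rw [length_weightReL, length_rotTableSymm]) (by rw [length_weightImL, length_rotTableSymm])
    (fun x hx => ev_tableWeight hx) length_phaseL length_phaseNegL isMul_potWeightReL
    isMul_potWeightImL (by rw [weightDen]; push_cast; ring) (by
      have h1 := l1_weightDefectRe
      have h2 := l1_weightDefectIm
      have h3 := l1_weight
      simp only [l1F_eq_l1] at h1 h2 h3
      generalize l1 weightReL = A at h3 ⊢
      generalize l1 weightImL = B at h3 ⊢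
      generalize l1 (weightDefectRe _ _ _ _ _ _ _ _ _) = C at h1 ⊢
      generalize l1 (weightDefectIm _ _ _ _ _ _ _) = D at h2 ⊢
      rw [weightDen] at h1 h2 ⊢
      lia) hx
  have h2 := (Complex.abs_re_le_norm _).trans (norm_phaseL_sub_exp_le hx)
  rw [Complex.sub_re, mul_comm Complex.I, Complex.exp_ofReal_mul_I_re, abs_le] at h2
  have h3 := tableWeight_le hx
  have h4 := tableWeight_nonneg x
  change 1.487 * tableWeight (x * w) + 1.487⁻¹ * tableWeight (x * (starRingEnd ℂ) w) + 3 / 4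
    ≤ _ * tableWeight x at h1
  nlinarith

end CoeffList

/-- The approximate torus. -/
noncomputable def approxTorus : CircleFun :=
  ⟨fun x => (CoeffList.ev CoeffList.sineL (fourier 1 x : ℂ)).im / (2 ^ 64 : ℕ), by
    have := (CoeffList.continuous_ev CoeffList.sineL).comp (fourier (T := 1) 1).continuous
    exact (Complex.continuous_im.comp this).div_const _⟩

/-- The approximate growing solution of the linearised equation. -/
noncomputable def approxGrowth : CircleFun :=
  ⟨fun x => CoeffList.tableWeight (fourier 1 x : ℂ), by
    have h1 := (CoeffList.continuous_ev CoeffList.factorReL).comp (fourier (T := 1) 1).continuous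
    have h2 := (CoeffList.continuous_ev CoeffList.factorImL).comp (fourier (T := 1) 1).continuous
    exact (Complex.continuous_normSq.comp (h1.add (continuous_const.mul h2))).div_const _⟩

theorem approxTorus_apply (x : UnitAddCircle) : approxTorus x
    = (CoeffList.ev CoeffList.sineL (fourier 1 x : ℂ)).im / (2 ^ 64 : ℕ) := rfl

theorem approxGrowth_apply (x : UnitAddCircle) :
    approxGrowth x = CoeffList.tableWeight (fourier 1 x : ℂ) := rfl

/-- For ω the golden mean, κ = 1.3, ε = 1.2342, the perturbed standard map has
a real-analytic, 1-periodic fiberwise hyperbolic invariant torus with constant diagonal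
reduced linearized dynamics, with `|λ_s| ≤ 0.6725` and `|λ_u| ≥ 1.487`. This parameter value is close to the critical breakdown value ε_c ≈ 1.2352755. -/
theorem hyperbolic_torus_eps (ω : ℝ) (hω : ω = (Real.sqrt 5 - 1) / 2) :
    ∃ (K : ℝ → ℝ × ℝ) (P : ℝ → Matrix (Fin 2) (Fin 2) ℝ) (lams lamu : ℝ),
      (∀ θ : ℝ, AnalyticAt ℝ K θ) ∧ Function.Periodic K 1 ∧
      (∀ θ : ℝ, stdF 1.3 1.2342 (K (θ - ω)).1 (K (θ - ω)).2 (θ - ω) = K θ) ∧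
      (∀ (i j : Fin 2) (θ : ℝ), AnalyticAt ℝ (fun t => P t i j) θ) ∧
      Function.Periodic P 1 ∧
      (∀ θ : ℝ, IsUnit (P θ)) ∧
      |lams| ≤ 0.6725 ∧ 1.487 ≤ |lamu| ∧ |lams| < 1 ∧ 1 < |lamu| ∧
      (∀ θ : ℝ,
        stdDF 1.3 (K (θ - ω)).1 * P (θ - ω) = P θ * Matrix.diagonal ![lams, lamu]) := by
  set w := Complex.exp (Complex.I * (2 * Real.pi * ω : ℝ)) with hw
  have hneg : ∀ x : UnitAddCircle, (fourier 1 (-x) : ℂ) = (starRingEnd ℂ) (fourier 1 x) :=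
    fun x => by
      rw [fourier_apply, fourier_apply, one_smul, one_smul, AddCircle.toCircle_neg,
        Circle.coe_inv_eq_conj]
  have hadd : ∀ x y : UnitAddCircle, (fourier 1 (x + y) : ℂ) = fourier 1 x * fourier 1 y :=
    fun x y => by simp [fourier_apply, AddCircle.toCircle_add]
  have hrot : (fourier 1 (ω : UnitAddCircle) : ℂ) = w := by
    rw [fourier_coe_apply, hw]
    congr 1
    push_cast
    ring
  have hrot' : (fourier 1 (-(ω : UnitAddCircle)) : ℂ) = (starRingEnd ℂ) w := by rw [hneg, hrot]
  have hnorm : ∀ x : UnitAddCircle, ‖(fourier 1 x : ℂ)‖ = 1 := fun x => Circle.norm_coe _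
  refine torus_of_certificate ω hω (f₀ := approxTorus) (p := approxGrowth) (M := 107000)
    (fun x => ?_) (fun x => CoeffList.tableWeight_nonneg _)
    (fun x => CoeffList.tableWeight_le (hnorm x)) (fun x => ?_) fun x => ?_
  · rw [approxTorus_apply, approxTorus_apply, hneg, CoeffList.ev_conj, Complex.conj_im, neg_div]
  · simp only [CircleFun.torusPot_apply, approxTorus_apply, approxGrowth_apply, sub_eq_add_neg,
      hadd, hrot, hrot']
    exact CoeffList.tableWeight_expansion hω hw (hnorm x)
  · simp only [CircleFun.torusEq_apply, approxTorus_apply]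
    rw [sub_eq_add_neg x, hadd, hadd, hrot, hrot']
    exact CoeffList.abs_sineL_defect_le hω hw (hnorm x)
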